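/- There exist constants 0 < c ≤ C < ∞ such that for all integers n ≥ 1 and all y ∈ B(n/2), c/n² ≤ P(U(y, B(n))) ≤ C/n². -/

import Mathlib

/-!
Critical site percolation on the triangular lattice realized on `ℤ²`.
A configuration assigns to each site `true` (open) or `false` (closed),
and `P` is the product Bernoulli(1/2) measure, axiomatized by
`IsBernoulliHalf` below (finite cylinder events have product probability).
-/

open MeasureTheory
open scoped ENNReal

/-- Sites of the lattice: vertices of `ℤ²`. -/
abbrev Site : Type := ℤ × ℤ

/-- A percolation configuration: `true` = open, `false` = closed. -/
abbrev Config : Type := Site → Bool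

/-- Adjacency for the triangular lattice realized on `ℤ²`:
the neighbors of `(x,y)` are `(x±1,y)`, `(x,y±1)`, `(x+1,y-1)`, `(x-1,y+1)`. -/
def Adj (a b : Site) : Prop :=
  (b.1 - a.1, b.2 - a.2) ∈
    ({(1, 0), (-1, 0), (0, 1), (0, -1), (1, -1), (-1, 1)} : Set (ℤ × ℤ))

/-- A (nonempty, self-avoiding) lattice path: a list of distinct sites in which
consecutive sites are neighbors. -/
def IsPath (p : List Site) : Prop := p ≠ [] ∧ p.Nodup ∧ p.Chain' Adj

/-- A path all of whose vertices lie in the set `S`. -/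
def PathIn (S : Set Site) (p : List Site) : Prop := IsPath p ∧ ∀ v ∈ p, v ∈ S

/-- All sites of `p` are open in `ω`. -/
def IsOpenOn (ω : Config) (p : List Site) : Prop := ∀ v ∈ p, ω v = true

/-- All sites of `p` are closed in `ω`. -/
def IsClosedOn (ω : Config) (p : List Site) : Prop := ∀ v ∈ p, ω v = false

/-- The first vertex of `p` lies in `A`. -/
def FirstIn (A : Set Site) (p : List Site) : Prop := ∃ a ∈ A, p.head? = some a

/-- The last vertex of `p` lies in `A`. -/
def LastIn (A : Set Site) (p : List Site) : Prop := ∃ a ∈ A, p.getLast? = some a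

/-- `μ` is the product Bernoulli(1/2) measure on configurations: a probability
measure for which every finite cylinder event has the product probability. -/
def IsBernoulliHalf (μ : Measure Config) : Prop :=
  IsProbabilityMeasure μ ∧
    ∀ (S : Finset Site) (f : Site → Bool),
      μ {ω | ∀ v ∈ S, ω v = f v} = (1 / 2 : ℝ≥0∞) ^ S.card

/-- The lattice rectangle `[x₀,x₁] × [y₀,y₁]`. -/
def rect (x₀ x₁ y₀ y₁ : ℤ) : Set Site :=
  {v | x₀ ≤ v.1 ∧ v.1 ≤ x₁ ∧ y₀ ≤ v.2 ∧ v.2 ≤ y₁}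

/-- The left side of a rectangle. -/
def rectLeft (x₀ x₁ y₀ y₁ : ℤ) : Set Site := {v ∈ rect x₀ x₁ y₀ y₁ | v.1 = x₀}

/-- The right side of a rectangle. -/
def rectRight (x₀ x₁ y₀ y₁ : ℤ) : Set Site := {v ∈ rect x₀ x₁ y₀ y₁ | v.1 = x₁}

/-- The top side of a rectangle. -/
def rectTop (x₀ x₁ y₀ y₁ : ℤ) : Set Site := {v ∈ rect x₀ x₁ y₀ y₁ | v.2 = y₁}

/-- The bottom side of a rectangle. -/
def rectBot (x₀ x₁ y₀ y₁ : ℤ) : Set Site := {v ∈ rect x₀ x₁ y₀ y₁ | v.2 = y₀}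

/-- A horizontal open crossing of the rectangle `[x₀,x₁] × [y₀,y₁]`:
an open path in the rectangle from its left side to its right side. -/
def HorizCrossing (x₀ x₁ y₀ y₁ : ℤ) (ω : Config) (p : List Site) : Prop :=
  PathIn (rect x₀ x₁ y₀ y₁) p ∧ IsOpenOn ω p ∧
    FirstIn (rectLeft x₀ x₁ y₀ y₁) p ∧ LastIn (rectRight x₀ x₁ y₀ y₁) p

/-- The set of sites of the rectangle lying on or beneath the path `q`: sites
that are on `q` or cannot be joined to the top side of the rectangle by a
lattice path avoiding `q`. -/
def OnOrBelow (x₀ x₁ y₀ y₁ : ℤ) (q : List Site) : Set Site :=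
  {v ∈ rect x₀ x₁ y₀ y₁ | v ∈ q ∨
    ¬ ∃ r : List Site, PathIn (rect x₀ x₁ y₀ y₁ \ {w | w ∈ q}) r ∧
        r.head? = some v ∧ LastIn (rectTop x₀ x₁ y₀ y₁) r}

/-- `p` is the lowest horizontal open crossing of the rectangle: it is a
horizontal open crossing lying on or beneath every horizontal open crossing. -/
def IsLowestCrossing (x₀ x₁ y₀ y₁ : ℤ) (ω : Config) (p : List Site) : Prop :=
  HorizCrossing x₀ x₁ y₀ y₁ ω p ∧
    ∀ q, HorizCrossing x₀ x₁ y₀ y₁ ω q → ∀ v ∈ p, v ∈ OnOrBelow x₀ x₁ y₀ y₁ q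

/-- `y` and `y + (1,0)` are the unique pair of neighboring sites of highest
vertical level on the path `p`: both belong to `p`, and every vertex of `p` of
maximal `y`-coordinate is one of them. -/
def HighestPair (p : List Site) (y : Site) : Prop :=
  y ∈ p ∧ (y.1 + 1, y.2) ∈ p ∧
    ∀ v ∈ p, v.2 ≤ y.2 ∧ (v.2 = y.2 → v = y ∨ v = (y.1 + 1, y.2))

namespace Perc

/-! ### Connectivity inside a set of sites -/

theorem adj_iff {a b : Site} : Adj a b ↔
    (b.1 = a.1 + 1 ∧ b.2 = a.2) ∨ (b.1 = a.1 - 1 ∧ b.2 = a.2) ∨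
    (b.1 = a.1 ∧ b.2 = a.2 + 1) ∨ (b.1 = a.1 ∧ b.2 = a.2 - 1) ∨
    (b.1 = a.1 + 1 ∧ b.2 = a.2 - 1) ∨ (b.1 = a.1 - 1 ∧ b.2 = a.2 + 1) := by
  simp only [Adj, Set.mem_insert_iff, Set.mem_singleton_iff, Prod.mk.injEq]
  omega

theorem _root_.Adj.symm {a b : Site} (h : Adj a b) : Adj b a := by
  rw [adj_iff] at *; omega

/-- `u` and `v` are joined by a lattice path in `S`. -/
def Conn (S : Set Site) (u v : Site) : Prop :=
  u ∈ S ∧ Relation.ReflTransGen (fun a b => Adj a b ∧ b ∈ S) u v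

namespace Conn

variable {S T : Set Site} {u v w : Site}

theorem refl (h : u ∈ S) : Conn S u u := ⟨h, .refl⟩

theorem left_mem (h : Conn S u v) : u ∈ S := h.1

theorem right_mem (h : Conn S u v) : v ∈ S := by
  rcases h with ⟨h, h'⟩
  induction h' with
  | refl => exact h
  | tail _ h _ => exact h.2

theorem trans (h : Conn S u v) (h' : Conn S v w) : Conn S u w := ⟨h.1, h.2.trans h'.2⟩

theorem single (hu : u ∈ S) (hv : v ∈ S) (h : Adj u v) : Conn S u v := ⟨hu, .single ⟨h, hv⟩⟩

theorem tail (h : Conn S u v) (ha : Adj v w) (hw : w ∈ S) : Conn S u w :=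
  ⟨h.1, h.2.tail ⟨ha, hw⟩⟩

theorem head (hu : u ∈ S) (ha : Adj u v) (h : Conn S v w) : Conn S u w :=
  (single hu h.1 ha).trans h

@[elab_as_elim]
theorem induction {u : Site} {P : Site → Prop} {v : Site} (h : Conn S u v) (h0 : P u)
    (step : ∀ a b, Conn S u a → Adj a b → b ∈ S → P a → P b) : P v := by
  rcases h with ⟨h, h'⟩
  induction h' with
  | refl => exact h0
  | tail hab hbc ih => exact step _ _ ⟨h, hab⟩ hbc.1 hbc.2 ih

theorem symm (h : Conn S u v) : Conn S v u := by
  refine h.induction (P := fun x => Conn S x u) (refl h.1) ?_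
  intro a b ha hab hb ih
  exact head hb hab.symm ih

theorem map {f : Site → Site} (hf : ∀ a b, Adj a b → Adj (f a) (f b))
    (hS : ∀ a ∈ S, f a ∈ T) (h : Conn S u v) : Conn T (f u) (f v) :=
  h.induction (refl (hS _ h.1)) fun _ _ _ hab hb ih => ih.tail (hf _ _ hab) (hS _ hb)

theorem mono (hST : S ⊆ T) (h : Conn S u v) : Conn T u v :=
  h.map (f := id) (fun _ _ h => h) hST

theorem component (h : Conn S u v) : Conn {z | Conn S u z} u v :=
  h.induction (refl (refl h.1)) fun _ _ ha hab hb ih => ih.tail hab (ha.tail hab hb)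

theorem first_exit {A : Set Site} (h : Conn S u v) (hu : u ∈ A) (hv : v ∉ A) :
    ∃ a b, Conn (S ∩ A) u a ∧ Adj a b ∧ b ∉ A ∧ Conn S b v := by
  have : Conn (S ∩ A) u v ∨ ∃ a b, Conn (S ∩ A) u a ∧ Adj a b ∧ b ∉ A ∧ Conn S b v := by
    refine h.induction (P := fun x => Conn (S ∩ A) u x ∨
      ∃ a b, Conn (S ∩ A) u a ∧ Adj a b ∧ b ∉ A ∧ Conn S b x) (.inl (refl ⟨h.1, hu⟩)) ?_
    rintro a b ha hab hb (ih | ⟨c, d, h1, h2, h3, h4⟩)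
    · by_cases hbA : b ∈ A
      · exact .inl (ih.tail hab ⟨hb, hbA⟩)
      · exact .inr ⟨a, b, ih, hab, hbA, refl hb⟩
    · exact .inr ⟨c, d, h1, h2, h3, h4.tail hab hb⟩
  rcases this with h' | h'
  · exact absurd h'.right_mem.2 hv
  · exact h'

/-- A path reaching a set `B` has an initial piece hitting `B` only at its end. -/
theorem first_hit {B : Set Site} (h : Conn S u v) (hu : u ∉ B) (hv : v ∈ B) :
    ∃ a b, Conn (S \ B) u a ∧ Adj a b ∧ b ∈ B ∧ b ∈ S := by
  obtain ⟨a, b, h1, h2, h3, h4⟩ := h.first_exit (A := Bᶜ) hu (by simpa using hv)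
  exact ⟨a, b, h1, h2, by simpa using h3, h4.left_mem⟩

end Conn

theorem conn_row {S : Set Site} {x0 x1 y : ℤ} (h : x0 ≤ x1)
    (hS : ∀ x, x0 ≤ x → x ≤ x1 → (x, y) ∈ S) : Conn S (x0, y) (x1, y) := by
  obtain ⟨k, rfl⟩ := Int.le.dest h
  induction k with
  | zero => simpa using Conn.refl (hS x0 le_rfl (by simp))
  | succ k ih =>
    refine (ih (by omega) fun x h1 h2 => hS x h1 (by push_cast; omega)).tail ?_
      (hS _ (by push_cast; omega) le_rfl)
    rw [adj_iff]; push_cast; omega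

theorem conn_col {S : Set Site} {x y0 y1 : ℤ} (h : y0 ≤ y1)
    (hS : ∀ y, y0 ≤ y → y ≤ y1 → (x, y) ∈ S) : Conn S (x, y0) (x, y1) := by
  obtain ⟨k, rfl⟩ := Int.le.dest h
  induction k with
  | zero => simpa using Conn.refl (hS y0 le_rfl (by simp))
  | succ k ih =>
    refine (ih (by omega) fun y h1 h2 => hS y h1 (by push_cast; omega)).tail ?_
      (hS _ (by push_cast; omega) le_rfl)
    rw [adj_iff]; push_cast; omega

theorem conn_row' {S : Set Site} {a b y : ℤ}
    (hS : ∀ x, min a b ≤ x → x ≤ max a b → (x, y) ∈ S) : Conn S (a, y) (b, y) := by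
  rcases le_total a b with h | h
  · exact conn_row h (by simpa [h] using hS)
  · exact (conn_row h (by simpa [h] using hS)).symm

theorem conn_of_path {S : Set Site} : ∀ {p : List Site} {u v : Site}, PathIn S p →
    p.head? = some u → p.getLast? = some v → Conn S u v ∧ Conn {w | w ∈ p} u v := by
  intro p
  induction p with
  | nil => intro u v h; exact absurd rfl h.1.1
  | cons a p ih =>
    intro u v h hu hv
    obtain rfl : a = u := by simpa using hu
    rcases p with _ | ⟨b, p⟩
    · obtain rfl : a = v := by simpa using hv
      exact ⟨.refl (h.2 _ (by simp)), .refl (by simp)⟩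
    · obtain ⟨⟨h1, h2, h3⟩, h4⟩ := h
      have h3' := List.isChain_cons_cons.1 h3
      obtain ⟨i1, i2⟩ := ih (u := b) (v := v) ⟨⟨by simp, (List.nodup_cons.1 h2).2, h3'.2⟩,
        fun w hw => h4 w (by simp [List.mem_cons.1 hw])⟩ (by simp)
        (by simpa [List.getLast?_cons_cons] using hv)
      refine ⟨.head (h4 _ (by simp)) h3'.1 i1, .head (by simp) h3'.1 (i2.mono ?_)⟩
      intro w hw
      exact List.mem_cons_of_mem _ hw

theorem exists_path {S : Set Site} {u v : Site} (h : Conn S u v) :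
    ∃ p, PathIn S p ∧ p.head? = some u ∧ p.getLast? = some v := by
  refine h.symm.induction (P := fun x => ∃ p, PathIn S p ∧ p.head? = some x ∧
    p.getLast? = some v) ⟨[v], ⟨⟨by simp, by simp, by simp [List.Chain']⟩, by
      simpa using h.right_mem⟩, by simp, by simp⟩ ?_
  rintro b a hb hab ha ⟨p, hp, hp1, hp2⟩
  by_cases hap : a ∈ p
  · obtain ⟨s, t, rfl⟩ := List.append_of_mem hap
    refine ⟨a :: t, ⟨⟨by simp, ?_, ?_⟩, fun w hw => hp.2 w (by
      rw [List.mem_append]; exact .inr hw)⟩, by simp, by simpa using hp2⟩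
    · exact (List.nodup_append.1 hp.1.2.1).2.1
    · exact (List.isChain_append.1 hp.1.2.2).2.1
  · rcases p with _ | ⟨c, p⟩
    · simp at hp1
    obtain rfl : c = b := by simpa using hp1
    refine ⟨a :: c :: p, ⟨⟨by simp, List.nodup_cons.2 ⟨hap, hp.1.2.1⟩,
      List.isChain_cons_cons.2 ⟨hab.symm, hp.1.2.2⟩⟩, ?_⟩, by simp,
      by simpa [List.getLast?_cons_cons] using hp2⟩
    intro w hw
    rcases List.mem_cons.1 hw with rfl | hw
    · exact ha
    · exact hp.2 w hw

/-- A path ending in `B` has an initial piece meeting `B` exactly at its last site. -/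
theorem Conn.upto {S B : Set Site} {u v : Site} (h : Conn S u v) (hv : v ∈ B) :
    ∃ b ∈ B, Conn {z | z ∈ S ∧ (z ∈ B → z = b)} u b := by
  by_cases hu : u ∈ B
  · exact ⟨u, hu, Conn.refl ⟨h.1, fun _ => rfl⟩⟩
  · obtain ⟨a, b, h1, h2, h3, h4⟩ := h.first_hit hu hv
    refine ⟨b, h3, Conn.tail (h1.mono ?_) h2 ⟨h4, fun _ => rfl⟩⟩
    exact fun z hz => ⟨hz.1, fun h => absurd h hz.2⟩


/-! ### Planarity: horizontal and vertical crossings meet -/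

theorem winding_step_up {p q r s x y : ℤ}
    (h : s = q ∧ (r = p + 1 ∨ r = p - 1) ∨ s = q + 1 ∧ (r = p ∨ r = p - 1) ∨
      q = s + 1 ∧ (p = r ∨ p = r - 1))
    (n1 : ¬ (p = x ∧ q = y + 1)) (n2 : ¬ (r = x ∧ s = y + 1)) :
    ((if q = y ∧ s = y + 1 ∧ x < p then 1 else 0) - (if s = y ∧ q = y + 1 ∧ x < r then 1 else 0)) -
    ((if q = y + 1 ∧ s = y + 1 + 1 ∧ x < p then 1 else 0) -
      (if s = y + 1 ∧ q = y + 1 + 1 ∧ x < r then 1 else 0)) =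
    (if s = y + 1 ∧ x < r then 1 else 0) - (if q = y + 1 ∧ x < p then (1 : ℤ) else 0) := by
  rcases h with ⟨rfl, h⟩ | ⟨rfl, h⟩ | ⟨rfl, h⟩
  · rw [if_neg (by omega), if_neg (by omega), if_neg (by omega), if_neg (by omega)]
    rw [if_congr (show s = y + 1 ∧ x < r ↔ s = y + 1 ∧ x < p by omega) rfl rfl]; simp
  · rw [if_neg (show ¬ (q + 1 = y ∧ q = y + 1 ∧ x < r) by omega),
      if_neg (show ¬ (q + 1 = y + 1 ∧ q = y + 1 + 1 ∧ x < r) by omega)]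
    omega
  · rw [if_neg (show ¬ (s + 1 = y ∧ s = y + 1 ∧ x < p) by omega),
      if_neg (show ¬ (s + 1 = y + 1 ∧ s = y + 1 + 1 ∧ x < p) by omega)]
    omega

theorem winding_step_diag {p q r s x y : ℤ}
    (h : s = q ∧ (r = p + 1 ∨ r = p - 1) ∨ s = q + 1 ∧ (r = p ∨ r = p - 1) ∨
      q = s + 1 ∧ (p = r ∨ p = r - 1))
    (n1 : ¬ (p = x - 1 ∧ q = y + 1)) (n2 : ¬ (r = x - 1 ∧ s = y + 1))
    (n3 : ¬ (p = x ∧ q = y)) (n4 : ¬ (r = x ∧ s = y)) :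
    ((if q = y ∧ s = y + 1 ∧ x < p then 1 else 0) - (if s = y ∧ q = y + 1 ∧ x < r then 1 else 0)) -
    ((if q = y + 1 ∧ s = y + 1 + 1 ∧ x - 1 < p then 1 else 0) -
      (if s = y + 1 ∧ q = y + 1 + 1 ∧ x - 1 < r then 1 else 0)) =
    (if s = y + 1 ∧ x ≤ r then 1 else 0) - (if q = y + 1 ∧ x ≤ p then (1 : ℤ) else 0) := by
  rcases h with ⟨rfl, h⟩ | ⟨rfl, h⟩ | ⟨rfl, h⟩
  · rw [if_neg (by omega), if_neg (by omega), if_neg (by omega), if_neg (by omega)]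
    rw [if_congr (show s = y + 1 ∧ x ≤ r ↔ s = y + 1 ∧ x ≤ p by omega) rfl rfl]; simp
  · rw [if_neg (show ¬ (q + 1 = y ∧ q = y + 1 ∧ x < r) by omega),
      if_neg (show ¬ (q + 1 = y + 1 ∧ q = y + 1 + 1 ∧ x - 1 < r) by omega)]
    omega
  · rw [if_neg (show ¬ (s + 1 = y ∧ s = y + 1 ∧ x < p) by omega),
      if_neg (show ¬ (s + 1 = y + 1 ∧ s = y + 1 + 1 ∧ x - 1 < p) by omega)]
    omega

/-- Signed number of times a path from `a` to `z` crosses the horizontal ray to the right of a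
site (at half-integer height). -/
theorem exists_winding {T : Set Site} {a z : Site} (h : Conn T a z) : ∃ e : ℤ → ℤ → ℤ,
    (∀ x y, (x + 1, y) ∉ T → e x y = e (x + 1) y) ∧
    (∀ x y, (x, y + 1) ∉ T → e x y - e x (y + 1) =
      (if z.2 = y + 1 ∧ x < z.1 then 1 else 0) - (if a.2 = y + 1 ∧ x < a.1 then 1 else 0)) ∧
    (∀ x y, (x, y) ∉ T → (x - 1, y + 1) ∉ T → e x y - e (x - 1) (y + 1) =
      (if z.2 = y + 1 ∧ x ≤ z.1 then 1 else 0) - (if a.2 = y + 1 ∧ x ≤ a.1 then 1 else 0)) ∧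
    (∀ x y, (∀ w ∈ T, w.2 = y → w.1 ≤ x) → e x y = 0) ∧
    (∀ x y, (∀ w ∈ T, w.2 = y → x < w.1) → e x y =
      (if a.2 ≤ y then 1 else 0) - (if z.2 ≤ y then 1 else 0)) := by
  refine h.induction ⟨fun _ _ => 0, by simp⟩ ?_
  · rintro c d hc hcd hd ⟨e, h1, h2, h3, h4, h5⟩
    have hcT := hc.right_mem
    have hs : d.2 = c.2 ∧ (d.1 = c.1 + 1 ∨ d.1 = c.1 - 1) ∨
        d.2 = c.2 + 1 ∧ (d.1 = c.1 ∨ d.1 = c.1 - 1) ∨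
        c.2 = d.2 + 1 ∧ (c.1 = d.1 ∨ c.1 = d.1 - 1) := by
      rw [adj_iff] at hcd; omega
    refine ⟨fun x y => e x y + (if c.2 = y ∧ d.2 = y + 1 ∧ x < c.1 then 1 else 0) -
      (if d.2 = y ∧ c.2 = y + 1 ∧ x < d.1 then 1 else 0), ?_, ?_, ?_, ?_, ?_⟩
    · intro x y hx
      have e1 := h1 x y hx
      have n1 : ¬ (c.1 = x + 1 ∧ c.2 = y) := fun ⟨p, q⟩ => hx (by rwa [← p, ← q])
      have n2 : ¬ (d.1 = x + 1 ∧ d.2 = y) := fun ⟨p, q⟩ => hx (by rwa [← p, ← q])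
      have k1 : (c.2 = y ∧ d.2 = y + 1 ∧ x < c.1) ↔ (c.2 = y ∧ d.2 = y + 1 ∧ x + 1 < c.1) := by
        omega
      have k2 : (d.2 = y ∧ c.2 = y + 1 ∧ x < d.1) ↔ (d.2 = y ∧ c.2 = y + 1 ∧ x + 1 < d.1) := by
        omega
      simp only [e1, k1, k2]
    · intro x y hx
      have e1 := h2 x y hx
      have n1 : ¬ (c.1 = x ∧ c.2 = y + 1) := fun ⟨p, q⟩ => hx (by rwa [← p, ← q])
      have n2 : ¬ (d.1 = x ∧ d.2 = y + 1) := fun ⟨p, q⟩ => hx (by rwa [← p, ← q])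
      have k := winding_step_up hs n1 n2
      dsimp only
      linarith
    · intro x y hx' hx
      have e1 := h3 x y hx' hx
      have n1 : ¬ (c.1 = x - 1 ∧ c.2 = y + 1) := fun ⟨p, q⟩ => hx (by rwa [← p, ← q])
      have n2 : ¬ (d.1 = x - 1 ∧ d.2 = y + 1) := fun ⟨p, q⟩ => hx (by rwa [← p, ← q])
      have n3 : ¬ (c.1 = x ∧ c.2 = y) := fun ⟨p, q⟩ => hx' (by rwa [← p, ← q])
      have n4 : ¬ (d.1 = x ∧ d.2 = y) := fun ⟨p, q⟩ => hx' (by rwa [← p, ← q])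
      have k := winding_step_diag hs n1 n2 n3 n4
      dsimp only
      linarith
    · intro x y hx
      have n1 := hx c hcT
      have n2 := hx d hd
      dsimp only
      rw [h4 x y hx, if_neg (by omega), if_neg (by omega)]
      rfl
    · intro x y hx
      have e1 := h5 x y hx
      have n1 := hx c hcT
      have n2 := hx d hd
      have k : ((if c.2 = y ∧ d.2 = y + 1 ∧ x < c.1 then 1 else 0) -
          (if d.2 = y ∧ c.2 = y + 1 ∧ x < d.1 then 1 else 0)) =
          (if c.2 ≤ y then 1 else 0) - (if d.2 ≤ y then (1 : ℤ) else 0) := by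
        rw [adj_iff] at hcd
        obtain h | h | h : d.2 = c.2 ∨ d.2 = c.2 + 1 ∨ d.2 = c.2 - 1 := by omega
        all_goals rw [h] at n2 ⊢; clear e1 h1 h2 h3 h4 h5 hx; omega
      dsimp only
      linarith

theorem conn_meet {S T : Set Site} {x0 x1 y0 y1 : ℤ} {u v a b : Site}
    (hS : Conn S u v) (hSy : ∀ w ∈ S, y0 ≤ w.2 ∧ w.2 ≤ y1) (hu : u.1 ≤ x0) (hv : x1 ≤ v.1)
    (hT : Conn T a b) (hTx : ∀ w ∈ T, x0 ≤ w.1 ∧ w.1 ≤ x1) (ha : a.2 ≤ y0) (hb : y1 ≤ b.2) :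
    ∃ z, Conn S u z ∧ Conn T a z := by
  by_contra! hne
  have hbT := hT.right_mem
  obtain ⟨b', hb', hT'⟩ : ∃ b' : Site, y1 < b'.2 ∧
      Conn ({z | Conn T a z} ∪ {(b.1, b.2 + 1)}) a b' := by
    refine ⟨(b.1, b.2 + 1), by dsimp; omega, ?_⟩
    exact (hT.component.mono Set.subset_union_left).tail (by rw [adj_iff]; omega) (by simp)
  obtain ⟨e, h1, h2, h3, h4, h5⟩ := exists_winding hT'
  set T' : Set Site := {z | Conn T a z} ∪ {(b.1, b.2 + 1)} with hT'def
  have hT'x : ∀ w ∈ T', x0 ≤ w.1 ∧ w.1 ≤ x1 := by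
    rintro w (hw | rfl)
    · exact hTx _ hw.right_mem
    · exact hTx b hbT
  have hdis : ∀ w, Conn S u w → w ∉ T' := by
    rintro w hw (hw' | rfl)
    · exact hne w hw hw'
    · have := (hSy _ hw.right_mem).2
      dsimp at this; omega
  have key : e v.1 v.2 = e u.1 u.2 := by
    refine hS.induction (P := fun w => e w.1 w.2 = e u.1 u.2) rfl ?_
    rintro ⟨p, q⟩ ⟨r, s⟩ hp hadj hr ih
    have hr' := hp.tail hadj hr
    have n1 := hdis _ hp
    have n2 := hdis _ hr'
    have y1' := hSy _ hp.right_mem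
    have y2' := hSy _ hr
    rw [adj_iff] at hadj
    dsimp at hadj ih y1' y2' ⊢
    rw [← ih]
    rcases hadj with ⟨rfl, rfl⟩ | ⟨rfl, rfl⟩ | ⟨rfl, rfl⟩ | ⟨rfl, rfl⟩ | ⟨rfl, rfl⟩ | ⟨rfl, rfl⟩
    · exact (h1 _ _ n2).symm
    · have := h1 (p - 1) s (by simpa using n1)
      simpa using this
    · have := h2 r q n2
      split_ifs at this <;> omega
    · have := h2 r (q - 1) (by simpa using n1)
      rw [sub_add_cancel] at this
      split_ifs at this <;> omega
    · have := h3 (p + 1) (q - 1) n2 (by simpa using n1)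
      rw [sub_add_cancel, add_sub_cancel_right] at this
      split_ifs at this <;> omega
    · have := h3 p q n1 n2
      split_ifs at this <;> omega
  have hv0 : e v.1 v.2 = 0 := h4 _ _ fun w hw _ => (hT'x w hw).2.trans hv
  have hu0 := h5 u.1 u.2 (by
    intro w hw hwy
    rcases (hu.trans (hT'x w hw).1).lt_or_eq with h | h
    · exact h
    · exact absurd (Prod.ext h.symm hwy ▸ hw) (hdis u (.refl hS.1)))
  have := hSy _ hS.1
  rw [if_pos (by omega), if_neg (by omega)] at hu0
  omega


/-! ### Lifting `ℤ/4`-valued labellings and the frontier of a cluster -/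

theorem exists_antideriv (c : ℤ) (f : ℤ → ℤ) :
    ∃ F : ℤ → ℤ, F 0 = c ∧ ∀ n, F (n + 1) = F n + f n := by
  refine ⟨fun n => c + ∑ i ∈ Finset.Ico 0 n, f i - ∑ i ∈ Finset.Ico n 0, f i, by simp, ?_⟩
  intro n
  rcases le_or_gt 0 n with h | h
  · have h1 : Finset.Ico 0 (n + 1) = insert n (Finset.Ico 0 n) := by ext i; simp; omega
    have h2 : Finset.Ico (n + 1) 0 = ∅ := by ext i; simp; omega
    have h3 : Finset.Ico n 0 = ∅ := by ext i; simp; omega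
    simp only [h1, h2, h3, Finset.sum_empty]
    rw [Finset.sum_insert (by simp)]; ring
  · have h1 : Finset.Ico n 0 = insert n (Finset.Ico (n + 1) 0) := by ext i; simp; omega
    have h2 : Finset.Ico 0 (n + 1) = ∅ := by ext i; simp; omega
    have h3 : Finset.Ico 0 n = ∅ := by ext i; simp; omega
    simp only [h1, h2, h3, Finset.sum_empty]
    rw [Finset.sum_insert (by simp)]; ring

/-- A labelling of the lattice by integers modulo `4` with no two adjacent labels opposite lifts
to a `1`-Lipschitz height function. -/
theorem exists_lift (l : Site → ℤ) (hl : ∀ a b, Adj a b → ¬ (4 : ℤ) ∣ l b - l a - 2) :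
    ∃ h : Site → ℤ, (∀ v, (4 : ℤ) ∣ h v - l v) ∧
      ∀ a b, Adj a b → h b ≤ h a + 1 ∧ h a ≤ h b + 1 := by
  let d : Site → Site → ℤ := fun a b => (l b - l a + 1) % 4 - 1
  have dtri : ∀ a b c, Adj a b → Adj b c → Adj a c → d a c = d a b + d b c := by
    intro a b c h1 h2 h3
    have := hl _ _ h1; have := hl _ _ h2; have := hl _ _ h3
    simp only [d]; omega
  obtain ⟨A, hA0, hA⟩ := exists_antideriv (l (0, 0)) (fun x => d (x, 0) (x + 1, 0))
  choose B hB0 hB using fun x => exists_antideriv (A x) (fun y => d (x, y) (x, y + 1))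
  have hor : ∀ x y, B (x + 1) y = B x y + d (x, y) (x + 1, y) := by
    intro x y
    have st : ∀ y, (B (x + 1) y = B x y + d (x, y) (x + 1, y)) ↔
        (B (x + 1) (y + 1) = B x (y + 1) + d (x, y + 1) (x + 1, y + 1)) := by
      intro y
      have e1 := hB x y
      have e2 := hB (x + 1) y
      have e3 := dtri (x, y) (x + 1, y) (x, y + 1) (by rw [adj_iff]; simp) (by rw [adj_iff]; simp)
        (by rw [adj_iff]; simp)
      have e4 := dtri (x + 1, y) (x, y + 1) (x + 1, y + 1) (by rw [adj_iff]; simp)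
        (by rw [adj_iff]; simp) (by rw [adj_iff]; simp)
      constructor <;> intro h <;> linarith
    induction y using Int.induction_on with
    | zero => rw [hB0, hB0, hA]
    | succ i ih => exact (st _).1 ih
    | pred i ih => refine (st _).2 ?_; rwa [sub_add_cancel]
  have dstep : ∀ a b, Adj a b → B b.1 b.2 = B a.1 a.2 + d a b := by
    have dneg : ∀ a b, Adj a b → d b a = - d a b := by
      intro a b h
      have := hl _ _ h
      simp only [d]; omega
    have key : ∀ x y x' y', (x' = x + 1 ∧ y' = y ∨ x' = x ∧ y' = y + 1 ∨
        x' = x - 1 ∧ y' = y + 1) → B x' y' = B x y + d (x, y) (x', y') := by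
      rintro x y x' y' (⟨rfl, rfl⟩ | ⟨rfl, rfl⟩ | ⟨rfl, rfl⟩)
      · exact hor _ _
      · exact hB _ _
      · have e1 := hor (x - 1) y
        have e2 := hB (x - 1) y
        rw [sub_add_cancel] at e1
        have e3 := dtri (x - 1, y) (x, y) (x - 1, y + 1) (by rw [adj_iff]; simp)
          (by rw [adj_iff]; simp) (by rw [adj_iff]; simp)
        linarith
    rintro ⟨x, y⟩ ⟨x', y'⟩ h
    have h' := dneg _ _ h
    rw [adj_iff] at h
    dsimp only at h ⊢
    by_cases hc : x' = x + 1 ∧ y' = y ∨ x' = x ∧ y' = y + 1 ∨ x' = x - 1 ∧ y' = y + 1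
    · exact key _ _ _ _ hc
    · have := key x' y' x y (by omega)
      linarith
  refine ⟨fun v => B v.1 v.2, ?_, ?_⟩
  · have dl : ∀ a b, (4 : ℤ) ∣ d a b - (l b - l a) := fun a b => by simp only [d]; omega
    rintro ⟨x, y⟩
    have ax : (4 : ℤ) ∣ A x - l (x, 0) := by
      induction x using Int.induction_on with
      | zero => simp [hA0]
      | succ i ih => have := hA i; have := dl (i, 0) (i + 1, 0); omega
      | pred i ih =>
        have := hA (-i - 1); have := dl (-i - 1, 0) (-i - 1 + 1, 0)
        rw [sub_add_cancel] at *; omega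
    dsimp only
    induction y using Int.induction_on with
    | zero => rwa [hB0]
    | succ i ih => have := hB x i; have := dl (x, i) (x, i + 1); omega
    | pred i ih =>
      have := hB x (-i - 1); have := dl (x, -i - 1) (x, -i - 1 + 1)
      rw [sub_add_cancel] at *; omega
  · intro a b h
    have := dstep a b h
    have := hl _ _ h
    simp only [d] at *
    omega

theorem adj_clamp {c c' : ℤ → ℤ} (hc : ∀ x, c (x + 1) = c x ∨ c (x + 1) = c x + 1)
    (hc' : ∀ x, c' (x + 1) = c' x ∨ c' (x + 1) = c' x + 1) (a b : Site) (h : Adj a b) :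
    (c a.1, c' a.2) = (c b.1, c' b.2) ∨ Adj (c a.1, c' a.2) (c b.1, c' b.2) := by
  obtain ⟨x, y⟩ := a
  obtain ⟨x', y'⟩ := b
  rw [adj_iff] at h ⊢
  have h1 := hc x
  have h2 := hc' y
  have h3 := hc x'
  have h4 := hc' y'
  simp only [Prod.ext_iff] at h ⊢
  rcases h with h | h | h | h | h | h <;> obtain ⟨e1, e2⟩ := h
  · subst e1 e2; rcases h1 with h1 | h1 <;> simp [h1]
  · obtain rfl : x = x' + 1 := by omega
    subst e2; rcases h3 with h3 | h3 <;> simp [h3]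
  · subst e1 e2; rcases h2 with h2 | h2 <;> simp [h2]
  · obtain rfl : y = y' + 1 := by omega
    subst e1; rcases h4 with h4 | h4 <;> simp [h4]
  · obtain rfl : y = y' + 1 := by omega
    subst e1; rcases h1 with h1 | h1 <;> rcases h4 with h4 | h4 <;> simp [h1, h4]
  · obtain rfl : x = x' + 1 := by omega
    subst e2; rcases h3 with h3 | h3 <;> rcases h2 with h2 | h2 <;> simp [h3, h2]

/-- The sites of the rectangle outside `D` connected to the top side outside `D`. -/
def Above (x0 x1 y0 y1 : ℤ) (D : Set Site) : Set Site :=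
  {v | ∃ t : Site, t.2 = y1 ∧ Conn (rect x0 x1 y0 y1 \ D) v t}

/-- The upper frontier of `D`: the sites of `Above` adjacent to `D`. -/
def Frontier (x0 x1 y0 y1 : ℤ) (D : Set Site) : Set Site :=
  {v | v ∈ Above x0 x1 y0 y1 D ∧ ∃ d ∈ D, Adj d v}

theorem above_subset {x0 x1 y0 y1 : ℤ} {D : Set Site} {v : Site}
    (h : v ∈ Above x0 x1 y0 y1 D) : v ∈ rect x0 x1 y0 y1 ∧ v ∉ D := by
  obtain ⟨t, _, ht⟩ := h
  exact ht.left_mem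

theorem frontier_subset {x0 x1 y0 y1 : ℤ} {D : Set Site} {v : Site}
    (h : v ∈ Frontier x0 x1 y0 y1 D) : v ∈ rect x0 x1 y0 y1 ∧ v ∉ D := above_subset h.1

/-- From every site of the frontier of a connected set containing the bottom side one reaches
every column of the rectangle inside the frontier. -/
theorem frontier_conn {x0 x1 y0 y1 : ℤ} {D : Set Site} (hDR : D ⊆ rect x0 x1 y0 y1)
    (hbot : ∀ x, x0 ≤ x → x ≤ x1 → (x, y0) ∈ D)
    (hD : ∀ v ∈ D, ∃ x, Conn D v (x, y0)) (htop : ∀ v ∈ D, v.2 < y1)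
    {x : ℤ} (hx0 : x0 ≤ x) (hx1 : x ≤ x1) {w : Site} (hw : w ∈ Frontier x0 x1 y0 y1 D) :
    ∃ y, Conn (Frontier x0 x1 y0 y1 D) w (x, y) := by
  classical
  by_contra! hno
  set R := rect x0 x1 y0 y1 with hR
  set C := Above x0 x1 y0 y1 D with hC
  set g := Frontier x0 x1 y0 y1 D with hg
  let cl : Site → Site := fun v => (max x0 (min v.1 x1), max y0 (min v.2 y1))
  have hx01 : x0 ≤ x1 := hx0.trans hx1
  have hy01 : y0 < y1 := htop _ (hbot x hx0 hx1)
  have clR : ∀ v, cl v ∈ R := fun v => by simp only [cl, hR, rect, Set.mem_ofPred_eq]; omega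
  have clid : ∀ v ∈ R, cl v = v := by
    intro v hv
    simp only [hR, rect, Set.mem_ofPred_eq] at hv
    simp only [cl, Prod.ext_iff]; omega
  have cladj : ∀ a b, Adj a b → cl a = cl b ∨ Adj (cl a) (cl b) := by
    exact adj_clamp (c := fun z => max x0 (min z x1)) (c' := fun z => max y0 (min z y1))
      (fun z => by omega) (fun z => by omega)
  let l : Site → ℤ := fun v => if v ∈ C then
    (if v ∈ g then (if Conn g w v then 0 else 2) else 1) else 3
  have hgC : ∀ v, v ∈ g → v ∈ C := fun v h => h.1
  have lC : ∀ v ∈ C, ¬ (4 : ℤ) ∣ l v - 3 := by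
    intro v hv; simp only [l, if_pos hv]; split_ifs <;> norm_num
  have stepC : ∀ a b, a ∈ C → Adj a b → b ∈ R → b ∉ D → b ∈ C := by
    rintro a b ⟨t, ht, hat⟩ hab hb hbD
    exact ⟨t, ht, .head ⟨hb, hbD⟩ hab.symm hat⟩
  have lR : ∀ a b, a ∈ R → b ∈ R → Adj a b → ¬ (4 : ℤ) ∣ l b - l a - 2 := by
    intro a b ha hb hab
    have key : ∀ a b, b ∈ R → Adj a b → a ∈ C → a ∉ g → b ∈ C := by
      intro a b hb hab haC hag
      refine stepC a b haC hab hb fun hbD => hag ⟨haC, b, hbD, hab.symm⟩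
    have k1 := key a b hb hab
    have k2 := key b a ha hab.symm
    have k3 : b ∈ g → Conn g w a → Conn g w b := fun h1 h2 => h2.tail hab h1
    have k4 : a ∈ g → Conn g w b → Conn g w a := fun h1 h2 => h2.tail hab.symm h1
    have k5 := hgC a
    have k6 := hgC b
    have lval : ∀ v, l v = 3 ∧ v ∉ C ∨ l v = 1 ∧ v ∈ C ∧ v ∉ g ∨ l v = 0 ∧ v ∈ g ∧ Conn g w v ∨
        l v = 2 ∧ v ∈ g ∧ ¬ Conn g w v := by
      intro v
      have := hgC v
      by_cases c1 : v ∈ C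
      · by_cases c2 : v ∈ g
        · by_cases c3 : Conn g w v <;> simp [l, c1, c2, c3]
        · simp [l, c1, c2]
      · have c2 : v ∉ g := fun h => c1 (this h)
        simp [l, c1, c2]
    clear_value l
    rcases lval a with ⟨la, p⟩ | ⟨la, p⟩ | ⟨la, p⟩ | ⟨la, p⟩ <;>
      rcases lval b with ⟨lb, q⟩ | ⟨lb, q⟩ | ⟨lb, q⟩ | ⟨lb, q⟩ <;> rw [la, lb] <;>
      first
      | (norm_num; done)
      | exact absurd (k1 p.1 p.2) q
      | exact absurd (k2 q.1 q.2) p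
      | exact absurd (k3 q.1 p.2) q.2
      | exact absurd (k4 p.1 q.2) p.2
  obtain ⟨h, hl, hlip⟩ := exists_lift (fun v => l (cl v)) (by
    intro a b hab
    rcases cladj a b hab with h | h
    · simp only [h]; norm_num
    · exact lR _ _ (clR _) (clR _) h)
  have hlR : ∀ v ∈ R, (4 : ℤ) ∣ h v - l v := fun v hv => by
    have := hl v; simp only [clid v hv] at this; exact this
  have lD : ∀ v ∈ D, l v = 3 := fun v hv => if_neg fun h => (above_subset h).2 hv
  -- heights on `D`
  have hDc : ∀ a b, Conn D a b → h b = h a := by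
    intro a b hab
    refine hab.induction rfl ?_
    intro c d hc hcd hd ih
    have e1 := hlR _ (hDR hc.right_mem)
    have e2 := hlR _ (hDR hd)
    rw [lD _ hc.right_mem] at e1
    rw [lD _ hd] at e2
    have := hlip _ _ hcd
    omega
  set h0 := h (x, y0) with hh0
  have hDh : ∀ v ∈ D, h v = h0 := by
    intro v hv
    obtain ⟨x', hx'⟩ := hD v hv
    have hm := hDR hx'.right_mem
    simp only [hR, rect, Set.mem_ofPred_eq] at hm
    rw [hh0, ← hDc _ _ hx']
    exact (hDc _ _ (conn_row' fun z h1 h2 => hbot z (by omega) (by omega)))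
  have hl0 : (4 : ℤ) ∣ h0 - 3 := by
    have := hlR _ (hDR (hbot x hx0 hx1)); rwa [lD _ (hbot x hx0 hx1)] at this
  have hcol : ∀ y, y0 ≤ y → y ≤ y1 → h0 - 2 ≤ h (x, y) ∧ h (x, y) ≤ h0 := by
    intro y hy hy'
    have := conn_col (S := {v : Site | v.1 = x ∧ v ∈ R}) (x := x) hy (by
      intro z h1 h2; exact ⟨rfl, by simp only [hR, rect, Set.mem_ofPred_eq]; omega⟩)
    refine this.induction (P := fun v => h0 - 2 ≤ h v ∧ h v ≤ h0) (by omega) ?_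
    rintro a b ha hab ⟨hbx, hb⟩ ih
    have e1 := hlip _ _ hab
    have e2 := hlR _ hb
    have e3 : l b = 1 ∨ l b = 2 ∨ l b = 3 := by
      have : ¬ Conn g w b := by
        have := hno b.2; rwa [← hbx] at this
      simp only [l, if_neg this]
      split_ifs <;> simp
    omega
  obtain ⟨hwC, dd, hdd, hadj⟩ := hw
  have hCpath : ∀ b, Conn (R \ D) w b → h0 + 1 ≤ h b ∧ h b ≤ h0 + 3 := by
    intro b hb
    refine hb.component.induction (P := fun v => h0 + 1 ≤ h v ∧ h v ≤ h0 + 3) ?_ ?_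
    · have e1 := hlip _ _ hadj
      have e2 := hlR _ (above_subset hwC).1
      have hwg : w ∈ g := ⟨hwC, dd, hdd, hadj⟩
      have hwC' : w ∈ C := hwC
      rw [show l w = 0 by simp only [l, if_pos hwC', if_pos hwg, if_pos (Conn.refl hwg)]] at e2
      rw [hDh _ hdd] at e1
      omega
    · intro a b ha hab hb ih
      have hbC : b ∈ C := by
        obtain ⟨t, ht, hwt⟩ := hwC
        exact ⟨t, ht, (Conn.symm hb).trans hwt⟩
      have e1 := hlip _ _ hab
      have e2 := hlR _ hb.right_mem.1
      have e3 := lC b hbC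
      omega
  obtain ⟨t, ht, hwt⟩ := hwC
  have htR := hwt.right_mem.1
  simp only [rect, Set.mem_ofPred_eq] at htR
  have htop' : Conn (R \ D) t (x, y1) := by
    have : t = (t.1, y1) := Prod.ext rfl ht
    rw [this]
    refine conn_row' fun z h1 h2 => ⟨?_, fun hz => ?_⟩
    · simp only [hR, rect, Set.mem_ofPred_eq]; omega
    · exact absurd (htop _ hz) (by simp)
  have := hCpath _ (hwt.trans htop')
  have := hcol y1 hy01.le le_rfl
  omega


/-! ### Clusters, duality of crossings, and the lowest crossing -/

/-- The sites reached from `U` by paths whose sites outside `U` lie in `K`. -/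
def Clu (U K : Set Site) : Set Site := {v | ∃ u ∈ U, Conn (U ∪ K) u v}

section Clu

variable {U K : Set Site} {v w : Site}

theorem subset_clu : U ⊆ Clu U K := fun u hu => ⟨u, hu, .refl (.inl hu)⟩

theorem clu_subset : Clu U K ⊆ U ∪ K := by
  rintro v ⟨u, _, h⟩
  exact h.right_mem

theorem clu_step (hv : v ∈ Clu U K) (h : Adj v w) (hw : w ∈ K) : w ∈ Clu U K := by
  obtain ⟨u, hu, huv⟩ := hv
  exact ⟨u, hu, huv.tail h (.inr hw)⟩

theorem clu_conn (hv : v ∈ Clu U K) : ∃ u ∈ U, Conn (Clu U K) u v := by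
  obtain ⟨u, hu, huv⟩ := hv
  exact ⟨u, hu, huv.component.mono fun z hz => ⟨u, hu, hz⟩⟩

theorem clu_mono {K' : Set Site} (h : K ⊆ K') : Clu U K ⊆ Clu U K' := by
  rintro v ⟨u, hu, huv⟩
  exact ⟨u, hu, huv.mono (Set.union_subset_union_right _ h)⟩

/-- A cluster only depends on its sites and their neighbours. -/
theorem clu_congr {K' : Set Site} (h : ∀ v, (v ∈ Clu U K ∨ ∃ w ∈ Clu U K, Adj w v) →
    (v ∈ K ↔ v ∈ K')) : Clu U K' = Clu U K := by
  apply Set.Subset.antisymm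
  · rintro v ⟨u, hu, huv⟩
    refine huv.induction (subset_clu hu) ?_
    rintro a b _ hab (hb | hb) ih
    · exact subset_clu hb
    · exact clu_step ih hab ((h b (.inr ⟨a, ih, hab⟩)).2 hb)
  · rintro v hv
    obtain ⟨u, hu, huv⟩ := clu_conn hv
    refine huv.induction (P := fun v => v ∈ Clu U K') (subset_clu hu) ?_
    intro a b _ hab hb ih
    rcases clu_subset hb with hb' | hb'
    · exact subset_clu hb'
    · exact clu_step ih hab ((h b (.inl hb)).1 hb')

end Clu

/-- The row just beneath the rectangle. -/
def Bot (x0 x1 y0 : ℤ) : Set Site := rect x0 x1 (y0 - 1) (y0 - 1)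

section BotClu

variable {x0 x1 y0 y1 : ℤ} {K : Set Site}

theorem mem_rect {v : Site} :
    v ∈ rect x0 x1 y0 y1 ↔ x0 ≤ v.1 ∧ v.1 ≤ x1 ∧ y0 ≤ v.2 ∧ v.2 ≤ y1 := Iff.rfl

theorem mem_bot {v : Site} : v ∈ Bot x0 x1 y0 ↔ x0 ≤ v.1 ∧ v.1 ≤ x1 ∧ v.2 = y0 - 1 := by
  simp only [Bot, mem_rect]; omega

theorem botClu_subset (hK : K ⊆ rect x0 x1 y0 y1) (hy : y0 ≤ y1 + 1) :
    Clu (Bot x0 x1 y0) K ⊆ rect x0 x1 (y0 - 1) y1 := by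
  intro v hv
  rcases clu_subset hv with h | h
  · rw [mem_bot] at h; rw [mem_rect]; omega
  · have := hK h; rw [mem_rect] at *; omega

theorem botClu_frontier_conn (hK : K ⊆ rect x0 x1 y0 y1) (hy : y0 ≤ y1)
    (htop : ∀ v ∈ Clu (Bot x0 x1 y0) K, v.2 < y1) {x : ℤ} (hx0 : x0 ≤ x) (hx1 : x ≤ x1) {w : Site}
    (hw : w ∈ Frontier x0 x1 (y0 - 1) y1 (Clu (Bot x0 x1 y0) K)) :
    ∃ y, Conn (Frontier x0 x1 (y0 - 1) y1 (Clu (Bot x0 x1 y0) K)) w (x, y) := by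
  refine frontier_conn (botClu_subset hK (by omega)) ?_ ?_ htop hx0 hx1 hw
  · exact fun x h1 h2 => subset_clu (by rw [mem_bot]; exact ⟨h1, h2, rfl⟩)
  · intro v hv
    obtain ⟨u, hu, huv⟩ := clu_conn hv
    rw [mem_bot] at hu
    refine ⟨u.1, ?_⟩
    rw [show (u.1, y0 - 1) = u from Prod.ext rfl hu.2.2.symm]
    exact huv.symm

theorem botClu_frontier_mem {w : Site}
    (hw : w ∈ Frontier x0 x1 (y0 - 1) y1 (Clu (Bot x0 x1 y0) K)) :
    w ∈ rect x0 x1 y0 y1 ∧ w ∉ K := by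
  obtain ⟨h1, h2⟩ := frontier_subset hw
  obtain ⟨_, d, hd, hdw⟩ := hw
  refine ⟨?_, fun hK => h2 (clu_step hd hdw hK)⟩
  have : w ∉ Bot x0 x1 y0 := fun h => h2 (subset_clu h)
  rw [mem_bot] at this
  rw [mem_rect] at *
  omega

theorem botClu_frontier_nonempty (hx : x0 ≤ x1) (hy : y0 ≤ y1)
    (htop : ∀ v ∈ Clu (Bot x0 x1 y0) K, v.2 < y1) :
    ∃ w, w ∈ Frontier x0 x1 (y0 - 1) y1 (Clu (Bot x0 x1 y0) K) := by
  have h := conn_col (S := {v : Site | v.1 = x0 ∧ v ∈ rect x0 x1 (y0 - 1) y1}) (x := x0)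
    (y0 := y0 - 1) (y1 := y1) (by omega)
    (fun y h1 h2 => ⟨rfl, by rw [mem_rect]; exact ⟨le_rfl, hx, h1, h2⟩⟩)
  obtain ⟨a, b, h1, h2, h3, h4⟩ := h.symm.first_hit (B := Clu (Bot x0 x1 y0) K)
    (fun h => absurd (htop _ h) (by simp)) (subset_clu (by rw [mem_bot]; exact ⟨le_rfl, hx, rfl⟩))
  exact ⟨a, ⟨(x0, y1), rfl, h1.symm.mono fun z hz => ⟨hz.1.2, hz.2⟩⟩, b, h3, h2.symm⟩

/-- There is a left-right path in the frontier of a cluster of the bottom not reaching the top. -/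
theorem botClu_frontier_cross (hK : K ⊆ rect x0 x1 y0 y1) (hx : x0 ≤ x1) (hy : y0 ≤ y1)
    (htop : ∀ v ∈ Clu (Bot x0 x1 y0) K, v.2 < y1) :
    ∃ a b, Conn (Frontier x0 x1 (y0 - 1) y1 (Clu (Bot x0 x1 y0) K)) (x0, a) (x1, b) := by
  obtain ⟨w, hw⟩ := botClu_frontier_nonempty (K := K) hx hy htop
  obtain ⟨a, ha⟩ := botClu_frontier_conn hK hy htop le_rfl hx hw
  obtain ⟨b, hb⟩ := botClu_frontier_conn hK hy htop hx le_rfl hw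
  exact ⟨a, b, ha.symm.trans hb⟩

/-- If the cluster of the bottom reaches the top row, there is a vertical crossing. -/
theorem vcross_of_botClu {v : Site} (hy : y0 ≤ v.2) (hv : v ∈ Clu (Bot x0 x1 y0) K) :
    ∃ u : Site, u.2 = y0 ∧ Conn K u v := by
  obtain ⟨u, hu, huv⟩ := hv
  rw [mem_bot] at hu
  obtain ⟨a, b, h1, h2, h3, h4⟩ := huv.symm.first_exit (A := {w | y0 ≤ w.2}) hy
    (by simp only [Set.mem_ofPred_eq]; omega)
  have ha := h1.right_mem.2
  rw [adj_iff] at h2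
  simp only [Set.mem_ofPred_eq] at ha h3
  refine ⟨a, by omega, h1.symm.mono ?_⟩
  rintro z ⟨hz | hz, hz'⟩
  · rw [mem_bot] at hz; simp only [Set.mem_ofPred_eq] at hz'; omega
  · exact hz

/-- Hex-type duality: for any set `O` of sites of a rectangle, there is a left-right crossing in
`O` or a bottom-top crossing in its complement. -/
theorem cross_or (O : Set Site) (hx : x0 ≤ x1) (hy : y0 ≤ y1) :
    (∃ a b, Conn (rect x0 x1 y0 y1 ∩ O) (x0, a) (x1, b)) ∨
    (∃ a b, Conn (rect x0 x1 y0 y1 \ O) (a, y0) (b, y1)) := by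
  by_cases htop : ∀ v ∈ Clu (Bot x0 x1 y0) (rect x0 x1 y0 y1 \ O), v.2 < y1
  · obtain ⟨a, b, hab⟩ := botClu_frontier_cross (fun v hv => hv.1) hx hy htop
    refine .inl ⟨a, b, hab.mono fun w hw => ?_⟩
    obtain ⟨h1, h2⟩ := botClu_frontier_mem hw
    exact ⟨h1, by_contra fun h => h2 ⟨h1, h⟩⟩
  · push Not at htop
    obtain ⟨v, hv, hvy⟩ := htop
    obtain ⟨u, hu, huv⟩ := vcross_of_botClu (hy.trans hvy) hv
    have hv' := (mem_rect.1 huv.right_mem.1).2.2.2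
    refine .inr ⟨u.1, v.1, ?_⟩
    rwa [show (u.1, y0) = u from Prod.ext rfl hu.symm,
      show (v.1, y1) = v from Prod.ext rfl (by dsimp; omega)]

/-- A left-right path meets the vertical path formed by a cluster of the bottom and a vertical
ray above one of its sites. -/
theorem meet_ray {P : Set Site} {u v z : Site} {c s : ℤ} (hK : K ⊆ rect x0 x1 y0 y1)
    (hP : Conn P u v) (hPR : ∀ w ∈ P, y0 ≤ w.2 ∧ w.2 ≤ y1) (hu : u.1 ≤ x0) (hv : x1 ≤ v.1)
    (hz : z ∈ Clu (Bot x0 x1 y0) K) (hc0 : x0 ≤ c) (hc1 : c ≤ x1) (hs : s ≤ y1)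
    (hzs : z = (c, s) ∨ Adj z (c, s)) :
    ∃ w ∈ P, w ∈ Clu (Bot x0 x1 y0) K ∨ w.1 = c ∧ s ≤ w.2 := by
  set D := Clu (Bot x0 x1 y0) K with hD
  obtain ⟨a, ha, haz⟩ := clu_conn hz
  have h1 : Conn (D ∪ {w : Site | w.1 = c ∧ s ≤ w.2}) a (c, s) := by
    have h := haz.mono (Set.subset_union_left (t := {w : Site | w.1 = c ∧ s ≤ w.2}))
    rcases hzs with rfl | h'
    · exact h
    · exact h.tail h' (.inr ⟨rfl, le_rfl⟩)
  have h2 : Conn (D ∪ {w : Site | w.1 = c ∧ s ≤ w.2}) (c, s) (c, y1) :=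
    conn_col hs fun y h1 _ => .inr ⟨rfl, h1⟩
  rw [mem_bot] at ha
  have hcol : ∀ w ∈ D ∪ {w : Site | w.1 = c ∧ s ≤ w.2}, x0 ≤ w.1 ∧ w.1 ≤ x1 := by
    rintro w (hw | ⟨rfl, _⟩)
    · rcases clu_subset hw with h | h
      · rw [mem_bot] at h; omega
      · have := hK h; rw [mem_rect] at this; omega
    · exact ⟨hc0, hc1⟩
  obtain ⟨w, hw1, hw2⟩ := conn_meet hP hPR hu hv (h1.trans h2) hcol (by omega) le_rfl
  exact ⟨w, hw1.right_mem, hw2.right_mem⟩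

end BotClu

/-- The closed sites. -/
def cl (ω : Config) : Set Site := {v | ω v = false}

/-- The open sites. -/
def op (ω : Config) : Set Site := {v | ω v = true}

theorem mem_op_iff {ω : Config} {v : Site} : v ∈ op ω ↔ v ∉ cl ω := by
  simp [op, cl]

/-- The union of the row beneath the rectangle and of the closed clusters touching it. -/
def BClu (x0 x1 y0 y1 : ℤ) (ω : Config) : Set Site :=
  Clu (Bot x0 x1 y0) (rect x0 x1 y0 y1 ∩ cl ω)

/-- `d` is the unique highest site of the closed clusters of the bottom. -/
def Peak (x0 x1 y0 y1 : ℤ) (d : Site) (ω : Config) : Prop :=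
  d ∈ BClu x0 x1 y0 y1 ω ∧ ∀ v ∈ BClu x0 x1 y0 y1 ω, v ≠ d → v.2 < d.2

section Lowest

variable {x0 x1 y0 y1 : ℤ} {ω : Config}

theorem horizCrossing_conn {p : List Site} (h : HorizCrossing x0 x1 y0 y1 ω p) :
    ∃ u v : Site, u.1 = x0 ∧ v.1 = x1 ∧ Conn {w | w ∈ p} u v := by
  obtain ⟨h1, h2, ⟨u, hu, hpu⟩, ⟨v, hv, hpv⟩⟩ := h
  exact ⟨u, v, hu.2, hv.2, (conn_of_path h1 hpu hpv).2⟩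

theorem horizCrossing_disj {p : List Site} (h : HorizCrossing x0 x1 y0 y1 ω p) {w : Site}
    (hw : w ∈ p) : w ∉ BClu x0 x1 y0 y1 ω := by
  intro hD
  have h1 := h.1.2 w hw
  rw [mem_rect] at h1
  rcases clu_subset hD with h' | h'
  · rw [mem_bot] at h'; omega
  · have : ω w = false := h'.2
    simp [h.2.1 w hw] at this

/-- When the bottom clusters do not reach the top, their frontier contains a lowest crossing. -/
theorem exists_lowest (hx : x0 ≤ x1) (hy : y0 ≤ y1) (htop : ∀ v ∈ BClu x0 x1 y0 y1 ω, v.2 < y1) :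
    ∃ p, IsLowestCrossing x0 x1 y0 y1 ω p ∧
      ∀ v ∈ p, v ∉ BClu x0 x1 y0 y1 ω ∧ ∃ d ∈ BClu x0 x1 y0 y1 ω, Adj d v := by
  obtain ⟨a, b, hab⟩ := botClu_frontier_cross Set.inter_subset_left hx hy htop
  obtain ⟨p, hp, hpa, hpb⟩ := exists_path hab
  have hmem := fun w (hw : w ∈ p) => botClu_frontier_mem (hp.2 w hw)
  have hl := botClu_frontier_mem hab.left_mem
  have hr := botClu_frontier_mem hab.right_mem
  refine ⟨p, ⟨⟨⟨hp.1, fun w hw => (hmem w hw).1⟩, fun w hw => ?_, ⟨_, ⟨hl.1, rfl⟩, hpa⟩,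
    ⟨_, ⟨hr.1, rfl⟩, hpb⟩⟩, ?_⟩, fun v hv => ⟨(frontier_subset (hp.2 v hv)).2, (hp.2 v hv).2⟩⟩
  · have := (hmem w hw).2
    by_contra h
    exact this ⟨(hmem w hw).1, by show ω w = false; simpa using h⟩
  · intro q hq v hv
    refine ⟨(hmem v hv).1, ?_⟩
    by_contra! hcon
    obtain ⟨hvq, r, hr, hrv, t, ht, hrt⟩ := hcon
    obtain ⟨u', v', hu', hv', hq'⟩ := horizCrossing_conn hq
    have hvt := (conn_of_path hr hrv hrt).1
    obtain ⟨d, hd, hdv⟩ := (hp.2 v hv).2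
    obtain ⟨s, hs, hsd⟩ := clu_conn hd
    set D := Clu (Bot x0 x1 y0) (rect x0 x1 y0 y1 ∩ cl ω) with hD
    have hT : Conn (D ∪ (rect x0 x1 y0 y1 \ {w | w ∈ q})) s t :=
      (hsd.mono Set.subset_union_left).trans
        (.head (.inl hd) hdv (hvt.mono Set.subset_union_right))
    rw [mem_bot] at hs
    obtain ⟨z, hz1, hz2⟩ := conn_meet hq' (fun w hw => (hq.1.2 w hw).2.2) hu'.le hv'.ge hT
      (by
        rintro w (hw | hw)
        · have := botClu_subset (fun _ h => h.1) (by omega) hw; rw [mem_rect] at this; omega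
        · have := hw.1; rw [mem_rect] at this; omega) (by omega) (by rw [ht.2])
    rcases hz2.right_mem with h | h
    · exact horizCrossing_disj hq hz1.right_mem h
    · exact h.2 hz1.right_mem

/-- The highest point of the lowest crossing is a horizontal pair exactly when the bottom closed
clusters have a unique highest site. -/
theorem highestPair_iff_peak {y : Site} (hx0 : x0 < y.1) (hx1 : y.1 < x1) (hy0 : y0 < y.2)
    (hy1 : y.2 < y1) : (∃ p, IsLowestCrossing x0 x1 y0 y1 ω p ∧ HighestPair p y) ↔
      Peak x0 x1 y0 y1 (y.1 + 1, y.2 - 1) ω := by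
  have hsub : BClu x0 x1 y0 y1 ω ⊆ rect x0 x1 (y0 - 1) y1 :=
    botClu_subset (fun _ h => h.1) (by omega)
  constructor
  · rintro ⟨p, ⟨hp, hlow⟩, hy, hye, hmax⟩
    obtain ⟨u, v, hu, hv, huv⟩ := horizCrossing_conn hp
    have ray : ∀ z ∈ BClu x0 x1 y0 y1 ω, ∀ c s, x0 ≤ c → c ≤ x1 → s ≤ y1 →
        (z = (c, s) ∨ Adj z (c, s)) → ∃ w ∈ p, w.1 = c ∧ s ≤ w.2 := by
      intro z hz c s h1 h2 h3 h4
      obtain ⟨w, hw, hw' | hw'⟩ := meet_ray (fun _ h => h.1) huv (fun w hw => (hp.1.2 w hw).2.2)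
        hu.le hv.ge hz h1 h2 h3 h4
      · exact absurd hw' (horizCrossing_disj hp hw)
      · exact ⟨w, hw, hw'⟩
    have s1 : ∀ z ∈ BClu x0 x1 y0 y1 ω, z.2 < y.2 := by
      intro z hz
      by_contra! h
      have hzR := mem_rect.1 (hsub hz)
      obtain ⟨w, hw, h1, h2⟩ := ray z hz z.1 z.2 (by omega) (by omega) (by omega) (.inl rfl)
      have := hmax w hw
      exact horizCrossing_disj hp hw (by rwa [show w = z from Prod.ext h1 (by omega)])
    have s2 : ∀ z ∈ BClu x0 x1 y0 y1 ω, z.2 = y.2 - 1 → z = (y.1 + 1, y.2 - 1) := by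
      intro z hz hzy
      have hzR := mem_rect.1 (hsub hz)
      have aux : ∀ w : Site, w ∈ p → y.2 ≤ w.2 → w.1 = y.1 ∨ w.1 = y.1 + 1 := by
        intro w hw h
        obtain ⟨h1, h2⟩ := hmax w hw
        rcases h2 (by omega) with rfl | rfl <;> simp
      obtain ⟨w, hw, h1, h2⟩ := ray z hz z.1 (z.2 + 1) (by omega) (by omega) (by omega)
        (.inr (by rw [adj_iff]; simp))
      have h3 := aux w hw (by omega)
      obtain ⟨w', hw', h1', h2'⟩ := ray z hz (z.1 - 1) (z.2 + 1) (by omega) (by omega) (by omega)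
        (.inr (by rw [adj_iff]; simp))
      have h4 := aux w' hw' (by omega)
      exact Prod.ext (by dsimp; omega) hzy
    have s3 : (y.1 + 1, y.2 - 1) ∈ BClu x0 x1 y0 y1 ω := by
      by_contra hd
      have s4 : ∀ z ∈ BClu x0 x1 y0 y1 ω, z.2 < y.2 - 1 := by
        intro z hz
        have h1 := s1 z hz
        by_contra h
        exact hd (s2 z hz (by omega) ▸ hz)
      obtain ⟨p0, ⟨hp0, _⟩, hp0'⟩ := exists_lowest (ω := ω) (x0 := x0) (x1 := x1) (by omega)
        (hy0.trans hy1).le (fun v hv => (s4 v hv).trans (by omega))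
      have hlt : ∀ v ∈ p0, v.2 < y.2 := by
        intro v hv
        obtain ⟨_, d, hd, hdv⟩ := hp0' v hv
        have := s4 d hd
        rw [adj_iff] at hdv
        omega
      rcases (hlow p0 hp0 y hy).2 with h | h
      · exact absurd (hlt _ h) (lt_irrefl _)
      · have hc := conn_col (S := rect x0 x1 y0 y1 \ {w | w ∈ p0}) (x := y.1) hy1.le (by
          intro z h1 h2
          refine ⟨by rw [mem_rect]; dsimp; omega, fun h => ?_⟩
          have := hlt _ h
          dsimp at this; omega)
        obtain ⟨r, hr, hr1, hr2⟩ := exists_path hc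
        exact h ⟨r, hr, hr1, _, ⟨by rw [mem_rect]; dsimp; omega, rfl⟩, hr2⟩
    refine ⟨s3, fun v hv hne => ?_⟩
    have := s1 v hv
    have : v.2 ≠ y.2 - 1 := fun h => hne (s2 v hv h)
    dsimp; omega
  · rintro ⟨hd, hmax⟩
    have hle : ∀ v ∈ BClu x0 x1 y0 y1 ω, v.2 < y.2 := by
      intro v hv
      by_cases h : v = (y.1 + 1, y.2 - 1)
      · rw [h]; dsimp; omega
      · have := hmax v hv h; dsimp at this; omega
    obtain ⟨p, hp, hp'⟩ := exists_lowest (ω := ω) (x0 := x0) (x1 := x1) (by omega)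
        (hy0.trans hy1).le (fun v hv => (hle v hv).trans hy1)
    obtain ⟨u, v, hu, hv, huv⟩ := horizCrossing_conn hp.1
    have htop : ∀ w ∈ p, w.2 ≤ y.2 := by
      intro w hw
      obtain ⟨_, d, hd, hdw⟩ := hp' w hw
      have := hle d hd
      rw [adj_iff] at hdw
      omega
    have ray : ∀ c, x0 ≤ c → c ≤ x1 → Adj (y.1 + 1, y.2 - 1) (c, y.2) → (c, y.2) ∈ p := by
      intro c h1 h2 h3
      obtain ⟨w, hw, hw' | hw'⟩ := meet_ray (fun _ h => h.1) huv
        (fun w hw => (hp.1.1.2 w hw).2.2) hu.le hv.ge hd h1 h2 hy1.le (.inr h3)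
      · exact absurd hw' (hp' w hw).1
      · have := htop w hw
        rwa [show (c, y.2) = w from Prod.ext hw'.1.symm (by dsimp; omega)]
    refine ⟨p, hp, ray y.1 (by omega) (by omega) (by rw [adj_iff]; simp),
      ray (y.1 + 1) (by omega) (by omega) (by rw [adj_iff]; simp), fun w hw => ⟨htop w hw, ?_⟩⟩
    intro hwy
    obtain ⟨_, d, hdD, hdw⟩ := hp' w hw
    by_cases h : d = (y.1 + 1, y.2 - 1)
    · subst h
      rw [adj_iff] at hdw
      dsimp at hdw
      simp only [Prod.ext_iff]
      omega
    · have := hmax d hdD h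
      rw [adj_iff] at hdw
      dsimp at this; omega

end Lowest


/-! ### Events depending on finitely many sites -/

/-- The event `E` only depends on the states of the sites in `S`. -/
def Dep (S : Finset Site) (E : Set Config) : Prop :=
  ∀ ω ω' : Config, (∀ v ∈ S, ω v = ω' v) → ω ∈ E → ω' ∈ E

/-- The section of an event when the state of the site `v` is set to `b`. -/
def sec (v : Site) (b : Bool) (E : Set Config) : Set Config := {ω | Function.update ω v b ∈ E}

/-- Increasing events. -/
def Inc (E : Set Config) : Prop := ∀ ω ω' : Config, (∀ v, ω v = true → ω' v = true) → ω ∈ E → ω' ∈ E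

section Dep

variable {S T : Finset Site} {E F : Set Config} {v : Site} {b : Bool}

theorem Dep.mono (h : Dep S E) (hST : S ⊆ T) : Dep T E :=
  fun ω ω' hω => h ω ω' fun v hv => hω v (hST hv)

theorem Dep.inter (hE : Dep S E) (hF : Dep S F) : Dep S (E ∩ F) :=
  fun ω ω' h hω => ⟨hE ω ω' h hω.1, hF ω ω' h hω.2⟩

theorem Dep.union (hE : Dep S E) (hF : Dep S F) : Dep S (E ∪ F) :=
  fun ω ω' h hω => hω.imp (hE ω ω' h) (hF ω ω' h)

theorem Dep.sec_of_insert (h : Dep (insert v S) E) : Dep S (sec v b E) := by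
  intro ω ω' hω hωE
  refine h _ _ (fun w hw => ?_) hωE
  by_cases hwv : w = v
  · subst hwv; simp
  · rw [Function.update_of_ne hwv, Function.update_of_ne hwv]
    exact hω w (Finset.mem_of_mem_insert_of_ne hw hwv)

theorem Dep.sec (h : Dep S E) : Dep S (Perc.sec v b E) :=
  (h.mono (Finset.subset_insert v S)).sec_of_insert

theorem Dep.sec_eq (h : Dep S E) (hv : v ∉ S) : Perc.sec v b E = E := by
  have key : ∀ ω : Config, ∀ w ∈ S, Function.update ω v b w = ω w := by
    intro ω w hw
    rw [Function.update_of_ne]; rintro rfl; exact hv hw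
  ext ω
  exact ⟨h _ _ (key ω), h _ _ fun w hw => (key ω w hw).symm⟩

theorem Dep.empty (h : Dep ∅ E) : E = ∅ ∨ E = Set.univ := by
  rcases E.eq_empty_or_nonempty with hE | ⟨ω, hω⟩
  · exact .inl hE
  · exact .inr (Set.eq_univ_of_forall fun ω' => h ω ω' (by simp) hω)

theorem Inc.sec (h : Inc E) : Inc (Perc.sec v b E) := by
  intro ω ω' hω
  refine h _ _ fun w => ?_
  by_cases hwv : w = v
  · subst hwv; simp
  · rw [Function.update_of_ne hwv, Function.update_of_ne hwv]; exact hω w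

theorem Inc.sec_le (h : Inc E) : Perc.sec v false E ⊆ Perc.sec v true E := by
  intro ω
  refine h _ _ fun w => ?_
  by_cases hwv : w = v
  · subst hwv; simp
  · rw [Function.update_of_ne hwv, Function.update_of_ne hwv]; exact id

theorem Inc.inter (hE : Inc E) (hF : Inc F) : Inc (E ∩ F) :=
  fun ω ω' h hω => ⟨hE ω ω' h hω.1, hF ω ω' h hω.2⟩

open Classical in
/-- The configuration whose open sites are those of `T`. -/
noncomputable def cfg (T : Set Site) : Config := fun v => decide (v ∈ T)

theorem cfg_apply {T : Set Site} {v : Site} : cfg T v = true ↔ v ∈ T := by simp [cfg]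

theorem measurableSet_cylinder (S : Finset Site) (f : Config) :
    MeasurableSet {ω : Config | ∀ v ∈ S, ω v = f v} := by
  have : {ω : Config | ∀ v ∈ S, ω v = f v} = ⋂ v ∈ S, (fun ω : Config => ω v) ⁻¹' {f v} := by
    ext ω; simp
  rw [this]
  exact Finset.measurableSet_biInter _ fun v _ => measurable_pi_apply v (measurableSet_singleton _)

open Classical in
theorem Dep.eq_biUnion (h : Dep S E) : E = ⋃ T ∈ S.powerset.filter (fun T : Finset Site => cfg (T : Set Site) ∈ E),
    {ω : Config | ∀ v ∈ S, ω v = cfg (T : Set Site) v} := by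
  ext ω
  simp only [Set.mem_iUnion, Finset.mem_filter, Finset.mem_powerset, Set.mem_ofPred_eq, exists_prop]
  constructor
  · intro hω
    have key : ∀ v ∈ S, ω v = cfg (((S.filter fun v => ω v = true) : Finset Site) : Set Site) v := by
      intro v hv
      rw [Bool.eq_iff_iff, cfg_apply]; simp [hv]
    exact ⟨S.filter fun v => ω v = true, ⟨Finset.filter_subset _ _, h _ _ key hω⟩, key⟩
  · rintro ⟨T, ⟨_, hT⟩, hω⟩
    exact h _ _ (fun v hv => (hω v hv).symm) hT

theorem Dep.measurableSet (h : Dep S E) : MeasurableSet E := by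
  rw [h.eq_biUnion]
  exact Finset.measurableSet_biUnion _ fun T _ => measurableSet_cylinder _ _

end Dep

section Prob

variable {μ : Measure Config} {S T : Finset Site} {E F : Set Config} {v : Site}

open Classical in
theorem prob_eq_sum (hμ : IsBernoulliHalf μ) (h : Dep S E) :
    μ.real E = ∑ T ∈ S.powerset, if cfg (T : Set Site) ∈ E then (1 / 2 : ℝ) ^ S.card else 0 := by
  have := hμ.1
  rw [← Finset.sum_filter]
  nth_rewrite 1 [h.eq_biUnion]
  rw [measureReal_biUnion_finset]
  · refine Finset.sum_congr rfl fun T _ => ?_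
    rw [measureReal_def, hμ.2]; simp
  · intro T hT T' hT' hne
    refine Set.disjoint_left.2 fun ω hω hω' => hne ?_
    simp only [Finset.coe_filter, Finset.mem_powerset, Set.mem_ofPred_eq] at hT hT' hω hω'
    ext v
    by_cases hv : v ∈ S
    · have := (hω v hv).symm.trans (hω' v hv)
      rw [Bool.eq_iff_iff, cfg_apply, cfg_apply] at this
      exact_mod_cast this
    · exact ⟨fun h => absurd (hT.1 h) hv, fun h => absurd (hT'.1 h) hv⟩
  · exact fun T _ => measurableSet_cylinder _ _

theorem prob_split_insert (hμ : IsBernoulliHalf μ) (hv : v ∉ S) (h : Dep (insert v S) E) :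
    μ.real E = (μ.real (sec v false E) + μ.real (sec v true E)) / 2 := by
  classical
  rw [prob_eq_sum hμ h, prob_eq_sum hμ (h.sec_of_insert (b := false)),
    prob_eq_sum hμ (h.sec_of_insert (b := true)), Finset.sum_powerset_insert hv,
    Finset.card_insert_of_notMem hv, add_div, Finset.sum_div, Finset.sum_div]
  have e0 : ∀ T ∈ S.powerset, Function.update (cfg (T : Set Site)) v false = cfg (T : Set Site) := by
    intro T hT
    have : v ∉ T := fun h => hv (Finset.mem_powerset.1 hT h)
    simp [cfg, this]
  have e1 : ∀ T ∈ S.powerset, Function.update (cfg (T : Set Site)) v true =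
      cfg ((insert v T : Finset Site) : Set Site) := by
    intro T hT
    funext w
    by_cases hw : w = v
    · subst hw; simp [cfg]
    · simp [cfg, hw]
  congr 1 <;> refine Finset.sum_congr rfl fun T hT => ?_
  · simp only [sec, Set.mem_ofPred_eq, e0 T hT]; split_ifs <;> ring
  · simp only [sec, Set.mem_ofPred_eq, e1 T hT]; split_ifs <;> ring

theorem prob_split (hμ : IsBernoulliHalf μ) (h : Dep S E) (v : Site) :
    μ.real E = (μ.real (sec v false E) + μ.real (sec v true E)) / 2 :=
  prob_split_insert hμ (S := S.erase v) (Finset.notMem_erase v S) (h.mono (by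
    intro w hw; by_cases hwv : w = v <;> simp [hwv, hw]))

theorem prob_sec_le (hμ : IsBernoulliHalf μ) (h : Dep S E) (v : Site) (b : Bool) :
    μ.real (sec v b E) ≤ 2 * μ.real E := by
  have h1 := prob_split hμ h v
  have h2 : 0 ≤ μ.real (sec v false E) := measureReal_nonneg
  have h3 : 0 ≤ μ.real (sec v true E) := measureReal_nonneg
  cases b <;> linarith

theorem prob_mono (hμ : IsBernoulliHalf μ) (h : E ⊆ F) : μ.real E ≤ μ.real F :=
  have := hμ.1
  measureReal_mono h

theorem prob_univ (hμ : IsBernoulliHalf μ) : μ.real Set.univ = 1 := by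
  have := hμ.1
  simp

theorem prob_le_one (hμ : IsBernoulliHalf μ) (E : Set Config) : μ.real E ≤ 1 := by
  have := hμ.1
  exact measureReal_le_one

theorem prob_union_le (hμ : IsBernoulliHalf μ) (E F : Set Config) :
    μ.real (E ∪ F) ≤ μ.real E + μ.real F := by
  have := hμ.1
  exact measureReal_union_le E F

theorem prob_compl (hμ : IsBernoulliHalf μ) (h : Dep S E) : μ.real Eᶜ = 1 - μ.real E := by
  have := hμ.1
  rw [measureReal_compl h.measurableSet, prob_univ hμ]

theorem fkg (hμ : IsBernoulliHalf μ) (hE : Dep S E) (hF : Dep S F) (iE : Inc E) (iF : Inc F) :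
    μ.real E * μ.real F ≤ μ.real (E ∩ F) := by
  classical
  induction S using Finset.induction generalizing E F with
  | empty =>
    rcases hE.empty with rfl | rfl
    · simp
    · rw [prob_univ hμ]; simp
  | insert v S hv ih =>
    rw [prob_split_insert hμ hv hE, prob_split_insert hμ hv hF,
      prob_split_insert hμ hv (hE.inter hF)]
    have h0 := ih hE.sec_of_insert hF.sec_of_insert (iE.sec (v := v) (b := false))
      (iF.sec (v := v) (b := false))
    have h1 := ih hE.sec_of_insert hF.sec_of_insert (iE.sec (v := v) (b := true))
      (iF.sec (v := v) (b := true))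
    have h2 := prob_mono hμ (iE.sec_le (v := v))
    have h3 := prob_mono hμ (iF.sec_le (v := v))
    have h0' : μ.real (sec v false E) * μ.real (sec v false F) ≤ μ.real (sec v false (E ∩ F)) := h0
    have h1' : μ.real (sec v true E) * μ.real (sec v true F) ≤ μ.real (sec v true (E ∩ F)) := h1
    nlinarith [mul_nonneg (sub_nonneg.2 h2) (sub_nonneg.2 h3)]

theorem prob_indep (hμ : IsBernoulliHalf μ) (hE : Dep S E) (hF : Dep T F) (hST : Disjoint S T) :
    μ.real (E ∩ F) = μ.real E * μ.real F := by
  classical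
  induction S using Finset.induction generalizing E with
  | empty =>
    rcases hE.empty with rfl | rfl
    · simp
    · rw [prob_univ hμ]; simp
  | insert v S hv ih =>
    rw [Finset.disjoint_insert_left] at hST
    have hd : Dep (insert v (S ∪ T)) (E ∩ F) :=
      (hE.mono (Finset.insert_subset_insert _ Finset.subset_union_left)).inter
        (hF.mono (Finset.subset_union_right.trans (Finset.subset_insert _ _)))
    rw [prob_split_insert hμ hv hE, prob_split hμ hd v]
    have e : ∀ b, sec v b (E ∩ F) = sec v b E ∩ F := by
      intro b
      conv_rhs => rw [← hF.sec_eq hST.1 (b := b)]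
      rfl
    rw [e, e, ih hE.sec_of_insert hST.2, ih hE.sec_of_insert hST.2]
    ring

/-- Relabelling the sites by a bijection and possibly exchanging the two states. -/
def relabel (e : Site ≃ Site) (c : Bool) (ω : Config) : Config := fun v => ω (e v) ^^ c

theorem Dep.relabel (h : Dep S E) (e : Site ≃ Site) (c : Bool) :
    Dep (S.map e.toEmbedding) {ω | Perc.relabel e c ω ∈ E} := by
  intro ω ω' hω
  refine h _ _ fun v hv => ?_
  have := hω (e v) (by simpa using hv)
  simp [Perc.relabel, this]

theorem prob_relabel (hμ : IsBernoulliHalf μ) (h : Dep S E) (e : Site ≃ Site) (c : Bool) :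
    μ.real {ω | relabel e c ω ∈ E} = μ.real E := by
  classical
  induction S using Finset.induction generalizing E with
  | empty =>
    rcases h.empty with rfl | rfl <;> simp
  | insert v S hv ih =>
    rw [prob_split_insert hμ hv h, prob_split hμ (h.relabel e c) (e v)]
    have key : ∀ b, sec (e v) b {ω | relabel e c ω ∈ E} = {ω | relabel e c ω ∈ sec v (b ^^ c) E} := by
      intro b
      ext ω
      simp only [sec, Set.mem_ofPred_eq]
      have : relabel e c (Function.update ω (e v) b) =
          Function.update (relabel e c ω) v (b ^^ c) := by
        funext w
        by_cases hw : w = v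
        · subst hw; simp [relabel]
        · simp [relabel, hw]
      rw [this]
    rw [key, key, ih h.sec_of_insert, ih h.sec_of_insert]
    cases c
    · simp
    · simp [add_comm]

/-! ### Disjoint occurrence -/

/-- Two increasing events occur thanks to disjoint sets of open sites. -/
def Box (E F : Set Config) : Set Config :=
  {ω | ∃ α β : Config, (∀ v, ¬ (α v = true ∧ β v = true)) ∧ (∀ v, α v = true → ω v = true) ∧
    (∀ v, β v = true → ω v = true) ∧ α ∈ E ∧ β ∈ F}

theorem Box.mono {E' F' : Set Config} (hE : E ⊆ E') (hF : F ⊆ F') : Box E F ⊆ Box E' F' := by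
  rintro ω ⟨α, β, h1, h2, h3, h4, h5⟩
  exact ⟨α, β, h1, h2, h3, hE h4, hF h5⟩

theorem Inc.box : Inc (Box E F) := by
  rintro ω ω' h ⟨α, β, h1, h2, h3, h4, h5⟩
  exact ⟨α, β, h1, fun v hv => h v (h2 v hv), fun v hv => h v (h3 v hv), h4, h5⟩

theorem Dep.box (hE : Dep S E) (hF : Dep S F) : Dep S (Box E F) := by
  classical
  rintro ω ω' h ⟨α, β, h1, h2, h3, h4, h5⟩
  refine ⟨fun v => α v && decide (v ∈ S), fun v => β v && decide (v ∈ S), ?_, ?_, ?_,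
    hE _ _ ?_ h4, hF _ _ ?_ h5⟩
  · intro v ⟨ha, hb⟩
    simp only [Bool.and_eq_true] at ha hb
    exact h1 v ⟨ha.1, hb.1⟩
  · intro v hv
    simp only [Bool.and_eq_true, decide_eq_true_eq] at hv
    rw [← h v hv.2]; exact h2 v hv.1
  · intro v hv
    simp only [Bool.and_eq_true, decide_eq_true_eq] at hv
    rw [← h v hv.2]; exact h3 v hv.1
  · intro v hv; simp [hv]
  · intro v hv; simp [hv]

theorem sec_false_box : sec v false (Box E F) ⊆ Box (sec v false E) (sec v false F) := by
  rintro ω ⟨α, β, h1, h2, h3, h4, h5⟩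
  have e : ∀ α : Config, (∀ w, α w = true → Function.update ω v false w = true) →
      Function.update α v false = α ∧ ∀ w, α w = true → ω w = true := by
    intro α h
    have hv : α v = false := by
      by_contra hc
      have := h v (by simpa using hc)
      simp at this
    refine ⟨by rw [← hv]; simp, fun w hw => ?_⟩
    have := h w hw
    rwa [Function.update_of_ne (by rintro rfl; simp [hv] at hw)] at this
  obtain ⟨a1, a2⟩ := e α h2
  obtain ⟨b1, b2⟩ := e β h3
  exact ⟨α, β, h1, a2, b2, by rwa [sec, Set.mem_ofPred_eq, a1], by rwa [sec, Set.mem_ofPred_eq, b1]⟩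

theorem sec_true_box (iE : Inc E) (iF : Inc F) : sec v true (Box E F) ⊆
    Box (sec v false E) (sec v true F) ∪ Box (sec v true E) (sec v false F) := by
  rintro ω ⟨α, β, h1, h2, h3, h4, h5⟩
  have k1 : ∀ w, ¬ (Function.update α v false w = true ∧ Function.update β v false w = true) := by
    intro w
    by_cases hw : w = v
    · subst hw; simp
    · rw [Function.update_of_ne hw, Function.update_of_ne hw]; exact h1 w
  have k2 : ∀ α : Config, (∀ w, α w = true → Function.update ω v true w = true) →
      ∀ w, Function.update α v false w = true → ω w = true := by
    intro α h w
    by_cases hw : w = v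
    · subst hw; simp
    · rw [Function.update_of_ne hw]
      have := h w
      rwa [Function.update_of_ne hw] at this
  have k3 : ∀ {α : Config} {E : Set Config}, Inc E → α ∈ E →
      Function.update α v false ∈ sec v true E := by
    intro α E iE hα
    refine iE _ _ (fun w hw => ?_) hα
    by_cases hwv : w = v
    · subst hwv; simp
    · simpa [hwv] using hw
  have k4 : ∀ {α : Config} {E : Set Config}, α v = false → α ∈ E →
      Function.update α v false ∈ sec v false E := by
    intro α E h hα
    rw [sec, Set.mem_ofPred_eq, ← h]; simpa using hα
  by_cases hβ : β v = true
  · have hα : α v = false := by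
      have := h1 v
      simpa [hβ] using this
    exact .inl ⟨_, _, k1, k2 α h2, k2 β h3, k4 hα h4, k3 iF h5⟩
  · exact .inr ⟨_, _, k1, k2 α h2, k2 β h3, k3 iE h4, k4 (by simpa using hβ) h5⟩

/-- The van den Berg–Kesten inequality for increasing events. -/
theorem bk (hμ : IsBernoulliHalf μ) (hE : Dep S E) (hF : Dep S F) (iE : Inc E) (iF : Inc F) :
    μ.real (Box E F) ≤ μ.real E * μ.real F := by
  classical
  have := hμ.1
  induction S using Finset.induction generalizing E F with
  | empty =>
    rcases hE.empty with rfl | rfl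
    · rw [show Box ∅ F = ∅ by ext; simp [Box]]; simp
    · rcases hF.empty with rfl | rfl
      · rw [show Box Set.univ ∅ = ∅ by ext; simp [Box]]; simp
      · rw [prob_univ hμ]; simp
  | insert v S hv ih =>
    rw [prob_split_insert hμ hv hE, prob_split_insert hμ hv hF,
      prob_split_insert hμ hv (hE.box hF)]
    set X := Box (sec v false E) (sec v true F)
    set Y := Box (sec v true E) (sec v false F)
    have dX : Dep S X := hE.sec_of_insert.box hF.sec_of_insert
    have dY : Dep S Y := hE.sec_of_insert.box hF.sec_of_insert
    have hX : μ.real X ≤ _ := ih hE.sec_of_insert hF.sec_of_insert iE.sec iF.sec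
    have hY : μ.real Y ≤ _ := ih hE.sec_of_insert hF.sec_of_insert iE.sec iF.sec
    have h0 : μ.real (sec v false (Box E F)) ≤ μ.real (X ∩ Y) :=
      prob_mono hμ fun ω hω => ⟨Box.mono subset_rfl iF.sec_le (sec_false_box hω),
        Box.mono iE.sec_le subset_rfl (sec_false_box hω)⟩
    have h1 : μ.real (sec v true (Box E F)) ≤ μ.real (X ∪ Y) := prob_mono hμ (sec_true_box iE iF)
    have h01 := measureReal_union_add_inter (μ := μ) (s := X) (t := Y) dY.measurableSet
    have h2 := prob_mono hμ (iE.sec_le (v := v))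
    have h3 := prob_mono hμ (iF.sec_le (v := v))
    nlinarith [mul_nonneg (sub_nonneg.2 h2) (sub_nonneg.2 h3)]

/-- `k` disjoint occurrences of an event. -/
def BoxPow (E : Set Config) : ℕ → Set Config
  | 0 => Set.univ
  | k + 1 => Box E (BoxPow E k)

theorem dep_boxPow (hE : Dep S E) : ∀ k, Dep S (BoxPow E k)
  | 0 => fun _ _ _ _ => trivial
  | k + 1 => hE.box (dep_boxPow hE k)

theorem inc_boxPow : ∀ k, Inc (BoxPow E k)
  | 0 => fun _ _ _ _ => trivial
  | _ + 1 => Inc.box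

theorem prob_boxPow_le (hμ : IsBernoulliHalf μ) (hE : Dep S E) (iE : Inc E) (k : ℕ) :
    μ.real (BoxPow E k) ≤ μ.real E ^ k := by
  induction k with
  | zero => simpa using prob_le_one hμ _
  | succ k ih =>
    rw [pow_succ']
    refine (bk hμ hE (dep_boxPow hE k) iE (inc_boxPow k)).trans ?_
    exact mul_le_mul_of_nonneg_left ih measureReal_nonneg

theorem mem_boxPow {ι : Type*} (J : Finset ι) (W : ι → Set Site) (ω : Config)
    (hW : ∀ i ∈ J, W i ⊆ op ω) (hd : ∀ i ∈ J, ∀ j ∈ J, i ≠ j → Disjoint (W i) (W j))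
    (hE : ∀ i ∈ J, cfg (W i) ∈ E) : ω ∈ BoxPow E J.card := by
  classical
  induction J using Finset.induction generalizing ω with
  | empty => trivial
  | insert i J hi ih =>
    rw [Finset.card_insert_of_notMem hi]
    refine ⟨cfg (W i), cfg (⋃ j ∈ J, W j), ?_, ?_, ?_, hE i (by simp), ?_⟩
    · intro v ⟨h1, h2⟩
      rw [cfg_apply] at h1 h2
      simp only [Set.mem_iUnion] at h2
      obtain ⟨j, hj, hv⟩ := h2
      exact Set.disjoint_left.1 (hd i (by simp) j (by simp [hj]) (by rintro rfl; exact hi hj)) h1 hv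
    · intro v hv
      exact hW i (by simp) (cfg_apply.1 hv)
    · intro v hv
      rw [cfg_apply] at hv
      simp only [Set.mem_iUnion] at hv
      obtain ⟨j, hj, hv⟩ := hv
      exact hW j (by simp [hj]) hv
    · refine ih _ (fun j hj v hv => ?_) (fun i hi j hj => hd i (by simp [hi]) j (by simp [hj]))
        fun j hj => hE j (by simp [hj])
      show cfg _ v = true
      rw [cfg_apply]
      simp only [Set.mem_iUnion]
      exact ⟨j, hj, hv⟩

theorem inc_boxPow_anti {k l : ℕ} (h : k ≤ l) : BoxPow E l ⊆ BoxPow E k := by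
  induction h with
  | refl => exact subset_rfl
  | step h ih =>
    refine fun ω hω => ih ?_
    obtain ⟨α, β, _, _, h3, _, h5⟩ := hω
    exact inc_boxPow _ _ _ h3 h5

/-- If at least `k` of the events `E d` can only occur on `B k`, the sum of their probabilities is
at most that of the `B k`. -/
theorem sum_prob_le {ι : Type*} (hμ : IsBernoulliHalf μ) (I : Finset ι) (E : ι → Set Config)
    (B : ℕ → Set Config) (hE : ∀ i ∈ I, ∃ S, Dep S (E i)) (hB : ∀ k, ∃ S, Dep S (B k))
    (h : ∀ J ⊆ I, ∀ ω, (∀ i ∈ J, ω ∈ E i) → ω ∈ B J.card) :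
    ∑ i ∈ I, μ.real (E i) ≤ ∑ k ∈ Finset.range I.card, μ.real (B (k + 1)) := by
  classical
  have := hμ.1
  have mE : ∀ i ∈ I, MeasurableSet (E i) := fun i hi => (hE i hi).choose_spec.measurableSet
  have mB : ∀ k, MeasurableSet (B k) := fun k => (hB k).choose_spec.measurableSet
  have key : ∑ i ∈ I, μ (E i) ≤ ∑ k ∈ Finset.range I.card, μ (B (k + 1)) := by
    calc ∑ i ∈ I, μ (E i) = ∑ i ∈ I, ∫⁻ ω, (E i).indicator 1 ω ∂μ :=
          Finset.sum_congr rfl fun i hi => (lintegral_indicator_one (mE i hi)).symm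
      _ = ∫⁻ ω, ∑ i ∈ I, (E i).indicator 1 ω ∂μ :=
          (lintegral_finsetSum' I fun i hi => (measurable_one.indicator (mE i hi)).aemeasurable).symm
      _ ≤ ∫⁻ ω, ∑ k ∈ Finset.range I.card, (B (k + 1)).indicator 1 ω ∂μ := by
          refine lintegral_mono fun ω => ?_
          simp only [Set.indicator_apply, Pi.one_apply, Finset.sum_boole]
          set m := (I.filter fun i => ω ∈ E i).card with hm
          refine Nat.cast_le.2 ?_
          rw [← Finset.card_range m]
          refine Finset.card_le_card fun k hk => ?_
          rw [Finset.mem_range] at hk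
          rw [Finset.mem_filter, Finset.mem_range]
          refine ⟨hk.trans_le (Finset.card_filter_le _ _), ?_⟩
          obtain ⟨J, hJ, hJk⟩ := Finset.exists_subset_card_eq (show k + 1 ≤ m from hk)
          rw [← hJk]
          exact h J (hJ.trans (Finset.filter_subset _ _)) ω fun i hi =>
            (Finset.mem_filter.1 (hJ hi)).2
      _ = ∑ k ∈ Finset.range I.card, ∫⁻ ω, (B (k + 1)).indicator 1 ω ∂μ :=
          lintegral_finsetSum' _ fun k _ => (measurable_one.indicator (mB _)).aemeasurable
      _ = ∑ k ∈ Finset.range I.card, μ (B (k + 1)) :=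
          Finset.sum_congr rfl fun k _ => lintegral_indicator_one (mB _)
  have t := ENNReal.toReal_mono (ENNReal.sum_ne_top.2 fun k _ => measure_ne_top μ _) key
  rwa [ENNReal.toReal_sum fun k _ => measure_ne_top μ _,
    ENNReal.toReal_sum fun k _ => measure_ne_top μ _] at t

/-- Revealing a random object `X`, then asking for an event not depending on what was revealed. -/
theorem prob_reveal {ι : Type*} (hμ : IsBernoulliHalf μ) (I : Finset ι) (X : Config → ι)
    (B : ι → Set Config) {c : ℝ} (h : ∀ i ∈ I, ∃ S T : Finset Site, Disjoint S T ∧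
      Dep S {ω | X ω = i} ∧ Dep T (B i) ∧ c ≤ μ.real (B i)) :
    c * μ.real {ω | X ω ∈ I} ≤ μ.real {ω | X ω ∈ I ∧ ω ∈ B (X ω)} := by
  classical
  have := hμ.1
  have e1 : {ω | X ω ∈ I} = ⋃ i ∈ I, {ω | X ω = i} := by ext; simp
  have e2 : {ω | X ω ∈ I ∧ ω ∈ B (X ω)} = ⋃ i ∈ I, ({ω | X ω = i} ∩ B i) := by
    ext ω
    simp only [Set.mem_ofPred_eq, Set.mem_iUnion, Set.mem_inter_iff, exists_prop]
    exact ⟨fun h => ⟨_, h.1, rfl, h.2⟩, by rintro ⟨i, h1, rfl, h2⟩; exact ⟨h1, h2⟩⟩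
  have dis : ∀ i j, i ≠ j → Disjoint {ω | X ω = i} {ω | X ω = j} := fun i j hij =>
    Set.disjoint_left.2 fun ω h1 h2 => hij (h1.symm.trans h2)
  rw [e1, e2, measureReal_biUnion_finset, measureReal_biUnion_finset, Finset.mul_sum]
  · refine Finset.sum_le_sum fun i hi => ?_
    obtain ⟨S, T, hST, hS, hT, hc⟩ := h i hi
    rw [prob_indep hμ hS hT hST, mul_comm]
    exact mul_le_mul_of_nonneg_left hc measureReal_nonneg
  · exact fun i _ j _ hij => (dis i j hij).mono Set.inter_subset_left Set.inter_subset_left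
  · intro i hi
    obtain ⟨S, T, _, hS, hT, _⟩ := h i hi
    exact hS.measurableSet.inter hT.measurableSet
  · exact fun i _ j _ hij => dis i j hij
  · intro i hi
    obtain ⟨S, T, _, hS, _⟩ := h i hi
    exact hS.measurableSet

end Prob


/-! ### Connection events -/

/-- The sites in state `c`. -/
def st (c : Bool) (ω : Config) : Set Site := {v | ω v = c}

theorem st_true (ω : Config) : st true ω = op ω := rfl

/-- Some site of `A` is joined to some site of `B` inside `S` by a path in state `c`. -/
def Lnk (c : Bool) (S A B : Set Site) : Set Config :=
  {ω | ∃ u ∈ A, ∃ v ∈ B, Conn (S ∩ st c ω) u v}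

/-- Events depending on finitely many sites. -/
def Loc (E : Set Config) : Prop := ∃ S, Dep S E

theorem rect_finite (x0 x1 y0 y1 : ℤ) : (rect x0 x1 y0 y1).Finite := by
  refine (Finset.finite_toSet (Finset.Icc ((x0, y0) : ℤ × ℤ) (x1, y1))).subset ?_
  intro v hv
  simp only [rect, Set.mem_ofPred_eq] at hv
  simp only [Finset.coe_Icc, Set.mem_Icc, Prod.le_def]
  exact ⟨⟨hv.1, hv.2.2.1⟩, hv.2.1, hv.2.2.2⟩

section Loc

variable {E F : Set Config}

theorem Loc.inter (hE : Loc E) (hF : Loc F) : Loc (E ∩ F) := by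
  classical
  obtain ⟨S, hS⟩ := hE
  obtain ⟨T, hT⟩ := hF
  exact ⟨S ∪ T, (hS.mono Finset.subset_union_left).inter (hT.mono Finset.subset_union_right)⟩

theorem Loc.union (hE : Loc E) (hF : Loc F) : Loc (E ∪ F) := by
  classical
  obtain ⟨S, hS⟩ := hE
  obtain ⟨T, hT⟩ := hF
  exact ⟨S ∪ T, (hS.mono Finset.subset_union_left).union (hT.mono Finset.subset_union_right)⟩

theorem Loc.fkg {μ : Measure Config} (hμ : IsBernoulliHalf μ) (hE : Loc E) (hF : Loc F)
    (iE : Inc E) (iF : Inc F) : μ.real E * μ.real F ≤ μ.real (E ∩ F) := by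
  classical
  obtain ⟨S, hS⟩ := hE
  obtain ⟨T, hT⟩ := hF
  exact Perc.fkg hμ (hS.mono Finset.subset_union_left) (hT.mono Finset.subset_union_right) iE iF

/-- A lower bound for intersections of increasing events. -/
theorem Loc.fkg_le {μ : Measure Config} (hμ : IsBernoulliHalf μ) (hE : Loc E) (hF : Loc F)
    (iE : Inc E) (iF : Inc F) {a b : ℝ} (hb0 : 0 ≤ b) (ha : a ≤ μ.real E)
    (hb : b ≤ μ.real F) : a * b ≤ μ.real (E ∩ F) :=
  (mul_le_mul ha hb hb0 measureReal_nonneg).trans (hE.fkg hμ hF iE iF)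

/-- A local event is determined by the states in some box. -/
theorem Loc.of_conn {R : Set Site} (hR : R.Finite)
    (h : ∀ ω ω' : Config, (∀ v ∈ R, ω v = ω' v) → ω ∈ E → ω' ∈ E) : Loc E :=
  ⟨hR.toFinset, fun ω ω' hω => h ω ω' fun v hv => hω v (hR.mem_toFinset.2 hv)⟩

end Loc

theorem lnk_dep {c : Bool} {S A B : Set Site} {ω ω' : Config} (h : ∀ v ∈ S, ω v = ω' v)
    (hω : ω ∈ Lnk c S A B) : ω' ∈ Lnk c S A B := by
  obtain ⟨u, hu, v, hv, huv⟩ := hω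
  refine ⟨u, hu, v, hv, huv.mono ?_⟩
  rintro z ⟨h1, h2⟩
  exact ⟨h1, (h z h1).symm.trans h2⟩

theorem lnk_loc {c : Bool} {S : Set Site} (A B : Set Site) (hS : S.Finite) : Loc (Lnk c S A B) :=
  .of_conn hS fun _ _ h => lnk_dep h

theorem lnk_inc (S A B : Set Site) : Inc (Lnk true S A B) := by
  rintro ω ω' h ⟨u, hu, v, hv, huv⟩
  exact ⟨u, hu, v, hv, huv.mono fun z hz => ⟨hz.1, h z hz.2⟩⟩

section Prob

variable {μ : Measure Config}

/-- Lattice symmetries and exchange of the two states. -/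
theorem prob_lnk_le (hμ : IsBernoulliHalf μ) {S A B S' A' B' : Set Site} (hSf : S.Finite)
    (c c' : Bool) (e : Site ≃ Site) (he : ∀ a b, Adj a b → Adj (e a) (e b))
    (hS : ∀ v ∈ S, e v ∈ S') (hA : ∀ v ∈ S, v ∈ A → e v ∈ A') (hB : ∀ v ∈ S, v ∈ B → e v ∈ B') :
    μ.real (Lnk c S A B) ≤ μ.real (Lnk c' S' A' B') := by
  obtain ⟨F, hF⟩ := lnk_loc (c := c) A B hSf
  rw [← prob_relabel hμ hF e (c ^^ c')]
  refine prob_mono hμ ?_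
  rintro ω ⟨u, hu, v, hv, huv⟩
  refine ⟨e u, hA u huv.left_mem.1 hu, e v, hB v huv.right_mem.1 hv, huv.map he ?_⟩
  rintro z ⟨h1, h2⟩
  refine ⟨hS z h1, ?_⟩
  change (ω (e z) ^^ (c ^^ c')) = c at h2
  change ω (e z) = c'
  revert h2
  cases ω (e z) <;> cases c <;> cases c' <;> simp

/-- Exploring a cluster leaves the sites which are not adjacent to it independent. -/
theorem prob_reveal_clu (hμ : IsBernoulliHalf μ) (c : Bool) {U R : Set Site} (hU : U.Finite)
    (hR : R.Finite) (Good : Set Site → Prop) (B : Set Site → Set Config) {p : ℝ}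
    (h : ∀ ω, Good (Clu U (R ∩ st c ω)) → ∃ T : Finset Site, Dep T (B (Clu U (R ∩ st c ω))) ∧
      (∀ v ∈ T, v ∈ R → v ∉ Clu U (R ∩ st c ω) ∧ ∀ w ∈ Clu U (R ∩ st c ω), ¬ Adj w v) ∧
      p ≤ μ.real (B (Clu U (R ∩ st c ω)))) :
    p * μ.real {ω | Good (Clu U (R ∩ st c ω))} ≤
      μ.real {ω | Good (Clu U (R ∩ st c ω)) ∧ ω ∈ B (Clu U (R ∩ st c ω))} := by
  classical
  set X : Config → Set Site := fun ω => Clu U (R ∩ st c ω) with hX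
  have hfin : {K | Good K ∧ ∃ ω, X ω = K}.Finite := by
    refine ((hU.union hR).powerset).subset ?_
    rintro K ⟨_, ω, rfl⟩
    exact clu_subset.trans (Set.union_subset_union_right _ Set.inter_subset_left)
  have hmem : ∀ ω, X ω ∈ hfin.toFinset ↔ Good (X ω) := fun ω => by
    simp
  have key := prob_reveal (c := p) hμ hfin.toFinset X B ?_
  · simpa only [hmem] using key
  · intro K hK
    obtain ⟨hG, ω, rfl⟩ := hfin.mem_toFinset.1 hK
    obtain ⟨T, h1, h2, h3⟩ := h ω hG
    refine ⟨hR.toFinset.filter fun v => v ∈ X ω ∨ ∃ w ∈ X ω, Adj w v, T, ?_, ?_, h1, h3⟩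
    · refine Finset.disjoint_left.2 fun v hv hv' => ?_
      simp only [Finset.mem_filter, Set.Finite.mem_toFinset] at hv
      obtain ⟨h4, h5⟩ := h2 v hv' hv.1
      rcases hv.2 with h6 | ⟨w, h6, h7⟩
      · exact h4 h6
      · exact h5 w h6 h7
    · intro ω1 ω2 h12 h1
      change X ω1 = X ω at h1
      change X ω2 = X ω
      rw [← h1]
      refine clu_congr fun v hv => ?_
      have hv' : v ∈ X ω ∨ ∃ w ∈ X ω, Adj w v := by rw [← h1]; exact hv
      have : v ∈ R → ω1 v = ω2 v := fun hvR => h12 v (by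
        simp only [Finset.mem_filter, Set.Finite.mem_toFinset]; exact ⟨hvR, hv'⟩)
      constructor
      · rintro ⟨h3, h4⟩
        exact ⟨h3, (this h3).symm.trans h4⟩
      · rintro ⟨h3, h4⟩
        exact ⟨h3, (this h3).trans h4⟩

end Prob

/-- Left-right crossings of a rectangle in state `c`. -/
def Hz (c : Bool) (x0 x1 y0 y1 : ℤ) : Set Config :=
  Lnk c (rect x0 x1 y0 y1) {v | v.1 = x0} {v | v.1 = x1}

/-- Bottom-top crossings of a rectangle in state `c`. -/
def Vt (c : Bool) (x0 x1 y0 y1 : ℤ) : Set Config :=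
  Lnk c (rect x0 x1 y0 y1) {v | v.2 = y0} {v | v.2 = y1}

/-- The translation by `(p, q)`. -/
def shift (p q : ℤ) : Site ≃ Site where
  toFun v := (v.1 + p, v.2 + q)
  invFun v := (v.1 - p, v.2 - q)
  left_inv v := by simp
  right_inv v := by simp

/-- The reflection exchanging the coordinates. -/
def transp : Site ≃ Site where
  toFun v := (v.2, v.1)
  invFun v := (v.2, v.1)
  left_inv _ := rfl
  right_inv _ := rfl

section Cross

variable {μ : Measure Config} {x0 x1 y0 y1 : ℤ}

theorem shift_adj (p q : ℤ) (a b : Site) (h : Adj a b) : Adj (shift p q a) (shift p q b) := by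
  simp only [adj_iff, shift, Equiv.coe_fn_mk] at *; omega

theorem transp_adj (a b : Site) (h : Adj a b) : Adj (transp a) (transp b) := by
  simp only [adj_iff, transp, Equiv.coe_fn_mk] at *; omega

/-- A horizontal crossing can be extracted from a path going across. -/
theorem exists_subcrossing {S : Set Site} {u v : Site} {a b : ℤ} (h : Conn S u v) (hu : u.1 ≤ a)
    (hv : b ≤ v.1) (hab : a ≤ b) :
    ∃ u' v' : Site, u'.1 = a ∧ v'.1 = b ∧ Conn (S ∩ {w | a ≤ w.1 ∧ w.1 ≤ b}) u' v' := by
  have h1 : ∃ v' : Site, v'.1 = b ∧ Conn (S ∩ {w | w.1 ≤ b}) u v' := by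
    by_cases hvb : v.1 ≤ b
    · by_cases hc : ∃ v' : Site, v'.1 = b ∧ Conn (S ∩ {w | w.1 ≤ b}) u v'
      · exact hc
      · obtain ⟨w, hw, hu2⟩ := h.upto (B := {w | w.1 = b}) (show v.1 = b by omega)
        by_cases hub : u.1 = b
        · exact ⟨u, hub, .refl ⟨h.left_mem, hub.le⟩⟩
        · have : ∀ z, Conn {z | z ∈ S ∧ (z ∈ {w : Site | w.1 = b} → z = w)} u z →
              Conn (S ∩ {w | w.1 ≤ b}) u z := by
            intro z hz
            refine hz.induction (.refl ⟨h.left_mem, (show u.1 ≤ b by omega)⟩) ?_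
            intro p q _ hpq hq ih
            refine ih.tail hpq ⟨hq.1, ?_⟩
            have hp : p.1 ≤ b := ih.right_mem.2
            have hp' : p.1 ≠ b := fun h => hc ⟨p, h, ih⟩
            rw [adj_iff] at hpq
            simp only [Set.mem_ofPred_eq]; omega
          exact ⟨w, hw, this w hu2⟩
    · obtain ⟨p, q, h1, h2, h3, _⟩ := h.first_exit (A := {w | w.1 ≤ b})
        (by simp only [Set.mem_ofPred_eq]; omega) hvb
      have : p.1 ≤ b := h1.right_mem.2
      rw [adj_iff] at h2
      simp only [Set.mem_ofPred_eq] at h3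
      exact ⟨p, by omega, h1⟩
  obtain ⟨v', hv', h1⟩ := h1
  by_cases hc : ∃ u' : Site, u'.1 = a ∧ Conn ((S ∩ {w | w.1 ≤ b}) ∩ {w | a ≤ w.1}) v' u'
  · obtain ⟨u', h2, h3⟩ := hc
    exact ⟨u', v', h2, hv', h3.symm.mono fun z hz => ⟨hz.1.1, hz.2, hz.1.2⟩⟩
  · exfalso
    have : ∀ z, Conn (S ∩ {w | w.1 ≤ b}) v' z →
        Conn ((S ∩ {w | w.1 ≤ b}) ∩ {w | a ≤ w.1}) v' z := by
      intro z hz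
      refine hz.induction (.refl ⟨h1.right_mem, (show a ≤ v'.1 by omega)⟩) ?_
      intro p q _ hpq hq ih
      refine ih.tail hpq ⟨hq, ?_⟩
      have hp : a ≤ p.1 := ih.right_mem.2
      have hp' : p.1 ≠ a := fun h => hc ⟨p, h, ih⟩
      rw [adj_iff] at hpq
      simp only [Set.mem_ofPred_eq]; omega
    have h2 := this u h1.symm
    have h3 : a ≤ u.1 := h2.right_mem.2
    exact hc ⟨u, by omega, h2⟩

end Cross


section Cross

variable {μ : Measure Config} {x0 x1 y0 y1 x0' x1' y0' y1' : ℤ} {c c' : Bool}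

theorem hz_loc : Loc (Hz c x0 x1 y0 y1) := lnk_loc _ _ (rect_finite _ _ _ _)

theorem vt_loc : Loc (Vt c x0 x1 y0 y1) := lnk_loc _ _ (rect_finite _ _ _ _)

theorem hz_inc : Inc (Hz true x0 x1 y0 y1) := lnk_inc _ _ _

theorem vt_inc : Inc (Vt true x0 x1 y0 y1) := lnk_inc _ _ _

theorem hz_mono (h0 : x0 ≤ x0') (h1 : x0' ≤ x1') (h2 : x1' ≤ x1) (h3 : y0' ≤ y0) (h4 : y1 ≤ y1') :
    Hz c x0 x1 y0 y1 ⊆ Hz c x0' x1' y0' y1' := by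
  rintro ω ⟨u, hu, v, hv, huv⟩
  have hu' : u.1 = x0 := hu
  have hv' : v.1 = x1 := hv
  obtain ⟨u', v', h5, h6, h7⟩ := exists_subcrossing (a := x0') (b := x1') huv (by omega) (by omega) h1
  refine ⟨u', h5, v', h6, h7.mono ?_⟩
  rintro z ⟨⟨hz1, hz2⟩, hz3⟩
  refine ⟨?_, hz2⟩
  rw [mem_rect] at *
  simp only [Set.mem_ofPred_eq] at hz3
  omega

theorem prob_hz_eq (hμ : IsBernoulliHalf μ) (hx : x1 - x0 = x1' - x0') (hy : y1 - y0 = y1' - y0') :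
    μ.real (Hz c x0 x1 y0 y1) ≤ μ.real (Hz c' x0' x1' y0' y1') := by
  refine prob_lnk_le hμ (rect_finite _ _ _ _) c c' (shift (x0' - x0) (y0' - y0)) (shift_adj _ _)
    ?_ ?_ ?_ <;> simp only [mem_rect, shift, Equiv.coe_fn_mk, Set.mem_ofPred_eq] <;> intros <;> omega

/-- Crossings of wider and lower rectangles are less likely. -/
theorem prob_hz_le (hμ : IsBernoulliHalf μ) (h : x0' ≤ x1') (hx : x1' - x0' ≤ x1 - x0)
    (hy : y1 - y0 ≤ y1' - y0') : μ.real (Hz c x0 x1 y0 y1) ≤ μ.real (Hz c' x0' x1' y0' y1') :=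
  (prob_mono hμ (hz_mono (x1' := x0 + (x1' - x0')) (y1' := y0 + (y1' - y0'))
    le_rfl (by omega) (by omega) le_rfl (by omega))).trans (prob_hz_eq hμ (by omega) (by omega))

theorem prob_hz_vt (hμ : IsBernoulliHalf μ) :
    μ.real (Hz c y0 y1 x0 x1) ≤ μ.real (Vt c' x0 x1 y0 y1) := by
  refine prob_lnk_le hμ (rect_finite _ _ _ _) c c' transp transp_adj
    ?_ ?_ ?_ <;> simp only [mem_rect, transp, Equiv.coe_fn_mk, Set.mem_ofPred_eq] <;> intros <;> omega

theorem prob_vt_hz (hμ : IsBernoulliHalf μ) :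
    μ.real (Vt c x0 x1 y0 y1) ≤ μ.real (Hz c' y0 y1 x0 x1) := by
  refine prob_lnk_le hμ (rect_finite _ _ _ _) c c' transp transp_adj
    ?_ ?_ ?_ <;> simp only [mem_rect, transp, Equiv.coe_fn_mk, Set.mem_ofPred_eq] <;> intros <;> omega

/-- A horizontal and a vertical crossing of a rectangle meet. -/
theorem hz_vt_meet {S T : Set Site} {u v a b : Site} (hS : Conn (rect x0 x1 y0 y1 ∩ S) u v)
    (hu : u.1 = x0) (hv : v.1 = x1) (hT : Conn (rect x0 x1 y0 y1 ∩ T) a b)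
    (ha : a.2 = y0) (hb : b.2 = y1) :
    ∃ z, Conn (rect x0 x1 y0 y1 ∩ S) u z ∧ Conn (rect x0 x1 y0 y1 ∩ T) a z :=
  conn_meet hS (fun _ hw => ⟨hw.1.2.2.1, hw.1.2.2.2⟩) hu.le hv.ge hT
    (fun _ hw => ⟨hw.1.1, hw.1.2.1⟩) ha.le hb.ge

theorem hz_vt_disj {ω : Config} (h1 : ω ∈ Hz c x0 x1 y0 y1) : ω ∉ Vt (!c) x0 x1 y0 y1 := by
  rintro ⟨a, ha, b, hb, hab⟩
  obtain ⟨u, hu, v, hv, huv⟩ := h1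
  obtain ⟨z, h1, h2⟩ := hz_vt_meet huv hu hv hab ha hb
  have h3 : ω z = c := h1.right_mem.2
  have h4 : ω z = !c := h2.right_mem.2
  rw [h3] at h4
  cases c <;> simp at h4

theorem hz_or_vt (ω : Config) (hx : x0 ≤ x1) (hy : y0 ≤ y1) :
    ω ∈ Hz true x0 x1 y0 y1 ∨ ω ∈ Vt false x0 x1 y0 y1 := by
  rcases cross_or (op ω) hx hy with ⟨a, b, h⟩ | ⟨a, b, h⟩
  · exact .inl ⟨_, rfl, _, rfl, h⟩
  · refine .inr ⟨_, rfl, _, rfl, h.mono fun z hz => ⟨hz.1, ?_⟩⟩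
    have := hz.2
    rw [mem_op_iff] at this
    exact not_not.1 this

/-- Squares are crossed with probability at least one half. -/
theorem half_le_hz (hμ : IsBernoulliHalf μ) (hx : x0 ≤ x1) (h : x1 - x0 ≤ y1 - y0) :
    1 / 2 ≤ μ.real (Hz c x0 x1 y0 y1) := by
  have h1 : (1 : ℝ) ≤ μ.real (Hz true 0 (x1 - x0) 0 (x1 - x0)) +
      μ.real (Vt false 0 (x1 - x0) 0 (x1 - x0)) := by
    rw [← prob_univ hμ]
    exact (prob_mono hμ fun ω _ => hz_or_vt ω (by omega) (by omega)).trans (prob_union_le hμ _ _)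
  have h2 := prob_vt_hz hμ (c := false) (c' := true) (x0 := 0) (x1 := x1 - x0) (y0 := 0)
    (y1 := x1 - x0)
  have h3 : μ.real (Hz true 0 (x1 - x0) 0 (x1 - x0)) ≤ μ.real (Hz c x0 x1 y0 y1) :=
    prob_hz_le hμ hx (by omega) (by omega)
  linarith

theorem half_le_vt (hμ : IsBernoulliHalf μ) (hy : y0 ≤ y1) (h : y1 - y0 ≤ x1 - x0) :
    1 / 2 ≤ μ.real (Vt c x0 x1 y0 y1) :=
  (half_le_hz (c := c) hμ hy h).trans (prob_hz_vt hμ)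

/-- Gluing two crossings of a rectangle through a crossing of a square. -/
theorem prob_hz_glue (hμ : IsBernoulliHalf μ) {L M : ℤ} (hM : 0 ≤ M) (hL : M ≤ L) {p : ℝ}
    (hp0 : 0 ≤ p) (hp : p ≤ μ.real (Hz true 0 L 0 M)) :
    p * (p * (1 / 2)) ≤ μ.real (Hz true 0 (2 * L - M) 0 M) := by
  have h1 : p ≤ μ.real (Hz true (L - M) (2 * L - M) 0 M) :=
    hp.trans (prob_hz_le hμ (by omega) (by omega) (by omega))
  have h2 : 1 / 2 ≤ μ.real (Vt true (L - M) L 0 M) := half_le_vt hμ hM (by omega)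
  have h3 := hz_loc.fkg_le hμ vt_loc hz_inc vt_inc (by norm_num) h1 h2
  refine (hz_loc.fkg_le hμ (hz_loc.inter vt_loc) hz_inc (hz_inc.inter vt_inc) (by positivity)
    hp h3).trans (prob_mono hμ ?_)
  rintro ω ⟨⟨u, hu, v, hv, huv⟩, ⟨u', hu', v', hv', huv'⟩, a, ha, b, hb, hab⟩
  simp only [Set.mem_ofPred_eq] at hu hv hu' hv' ha hb
  obtain ⟨z, z1, z2⟩ := conn_meet huv (y0 := 0) (y1 := M) (x0 := L - M) (x1 := L)
    (fun w hw => ⟨hw.1.2.2.1, hw.1.2.2.2⟩)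
    (by omega) hv.ge hab (fun w hw => ⟨hw.1.1, hw.1.2.1⟩) ha.le hb.ge
  obtain ⟨z', z1', z2'⟩ := conn_meet huv' (y0 := 0) (y1 := M) (x0 := L - M) (x1 := L)
    (fun w hw => ⟨hw.1.2.2.1, hw.1.2.2.2⟩)
    hu'.le (by omega) hab (fun w hw => ⟨hw.1.1, hw.1.2.1⟩) ha.le hb.ge
  have sub : ∀ {x0 x1 : ℤ}, 0 ≤ x0 → x1 ≤ 2 * L - M →
      rect x0 x1 0 M ∩ st true ω ⊆ rect 0 (2 * L - M) 0 M ∩ st true ω := by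
    rintro x0 x1 h0 h1 z ⟨hz, hz'⟩
    refine ⟨?_, hz'⟩
    rw [mem_rect] at *
    omega
  refine ⟨u, hu, v', hv', ?_⟩
  have e1 := (z1.mono (sub le_rfl (by omega))).trans (z2.mono (sub (by omega) (by omega))).symm
  have e2 := (z2'.mono (sub (by omega) (by omega))).trans (z1'.mono (sub (by omega) le_rfl)).symm
  exact e1.trans (e2.trans (huv'.mono (sub (by omega) le_rfl)))

end Cross


/-! ### Crossings of a square and of its mirror image -/

/-- The reflection of the lattice in the line `x = n`. -/
def mirror (n : ℤ) : Site ≃ Site where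
  toFun v := (2 * n - v.1, v.1 + v.2 - n)
  invFun v := (2 * n - v.1, v.1 + v.2 - n)
  left_inv v := by ext <;> dsimp only <;> ring
  right_inv v := by ext <;> dsimp only <;> ring

theorem mirror_apply (n : ℤ) (v : Site) : mirror n v = (2 * n - v.1, v.1 + v.2 - n) := rfl

theorem mirror_mirror (n : ℤ) (v : Site) : mirror n (mirror n v) = v := (mirror n).left_inv v

theorem mirror_adj (n : ℤ) (a b : Site) (h : Adj a b) : Adj (mirror n a) (mirror n b) := by
  simp only [adj_iff, mirror_apply] at *; omega

/-- The union of the square `[0, n]²` and of its mirror image. -/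
def Wedge (n : ℤ) : Set Site := {v | v ∈ rect 0 n 0 n ∨ mirror n v ∈ rect 0 n 0 n}

/-- The top and left sides of the square. -/
def topLeft (n : ℤ) : Set Site := {v | v.1 ≤ n ∧ (v.2 = n ∨ v.1 = 0)}

/-- The top and right sides of the mirror image of the square. -/
def topRight (n : ℤ) : Set Site := {v | n ≤ v.1 ∧ (v.1 + v.2 = 2 * n ∨ v.1 = 2 * n)}

/-- The sites above the frontier of `D`. -/
def Fresh (n : ℤ) (D : Set Site) : Set Site :=
  Above 0 n (-1) n D \ Frontier 0 n (-1) n D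

theorem fresh_spec {n : ℤ} {D : Set Site} (hD : Bot 0 n 0 ⊆ D) {v : Site} (hv : v ∈ Fresh n D) :
    (0 ≤ v.1 ∧ v.1 ≤ n ∧ 1 ≤ v.2 ∧ v.2 ≤ n) ∧ v ∉ D ∧ ∀ w ∈ D, ¬ Adj w v := by
  obtain ⟨h1, h2⟩ := hv
  obtain ⟨h3, h4⟩ := above_subset h1
  have h5 : ∀ w ∈ D, ¬ Adj w v := fun w hw h => h2 ⟨h1, w, hw, h⟩
  refine ⟨?_, h4, h5⟩
  rw [mem_rect] at h3
  have h6 : (v.1, (-1 : ℤ)) ∈ D := hD (by rw [mem_bot]; simp; omega)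
  have h7 : v.2 ≠ -1 := by
    intro h
    exact h4 (by rwa [← h] at h6)
  have h8 : v.2 ≠ 0 := by
    intro h
    exact h5 _ h6 (by rw [adj_iff]; simp; omega)
  omega

theorem frontier_of_adj_fresh {n : ℤ} {D : Set Site} {u b : Site} (hu : u ∈ rect 0 n 0 n)
    (hu' : u ∉ Fresh n D) (hb : b ∈ Fresh n D) (h : Adj u b) (hD : Bot 0 n 0 ⊆ D) :
    u ∈ Frontier 0 n (-1) n D := by
  by_contra hc
  refine hu' ⟨?_, hc⟩
  obtain ⟨t, ht, hbt⟩ := hb.1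
  have huD : u ∉ D := fun h' => (fresh_spec hD hb).2.2 u h' h
  refine ⟨t, ht, hbt.head ⟨?_, huD⟩ h⟩
  rw [mem_rect] at *
  omega

theorem frontier_of_top {n : ℤ} {D : Set Site} {u : Site} (hu : u ∈ rect 0 n 0 n)
    (hu' : u ∉ Fresh n D) (hun : u.2 = n) (hD : ∀ v ∈ D, v.2 < n) :
    u ∈ Frontier 0 n (-1) n D := by
  by_contra hc
  refine hu' ⟨⟨u, hun, .refl ⟨?_, fun h => (hD u h).ne hun⟩⟩, hc⟩
  rw [mem_rect] at *
  omega

/-- The sites above the frontier and their mirror images. -/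
def Fresh2 (n : ℤ) (D : Set Site) : Set Site := {v | v ∈ Fresh n D ∨ mirror n v ∈ Fresh n D}

/-- The sites of the square on or below the frontier. -/
def Under (n : ℤ) (D : Set Site) : Set Site := rect 0 n 0 n \ Fresh n D

/-- An open connection from the frontier to the top right. -/
def FreshOpen (n : ℤ) (D : Set Site) : Set Config :=
  {ω | ∃ v ∈ topRight n, v ∈ Clu (Under n D) (Fresh2 n D ∩ st true ω)}

/-- A closed connection from the mirror image of the frontier to the top left. -/
def FreshClosed (n : ℤ) (D : Set Site) : Set Config :=
  {ω | ∃ v ∈ topLeft n, v ∈ Clu (mirror n ⁻¹' Under n D) (Fresh2 n D ∩ st false ω)}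

theorem fresh2_finite (n : ℤ) (D : Set Site) : (Fresh2 n D).Finite := by
  have h : (Fresh n D).Finite :=
    (rect_finite 0 n (-1) n).subset fun v hv => (above_subset hv.1).1
  exact h.union (h.preimage (mirror n).injective.injOn)

theorem freshOpen_dep (n : ℤ) (D : Set Site) :
    Dep (fresh2_finite n D).toFinset (FreshOpen n D) := by
  rintro ω ω' h ⟨v, hv, hv'⟩
  refine ⟨v, hv, clu_mono ?_ hv'⟩
  rintro z ⟨h1, h2⟩
  exact ⟨h1, (h z ((fresh2_finite n D).mem_toFinset.2 h1)).symm.trans h2⟩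

theorem freshOpen_or_closed {n : ℤ} (hn : 1 ≤ n) {D : Set Site} (hD : Bot 0 n 0 ⊆ D) (ω : Config) :
    ω ∈ FreshOpen n D ∨ ω ∈ FreshClosed n D := by
  have fr : ∀ v ∈ Fresh2 n D, (0 ≤ v.1 ∧ v.1 ≤ n ∧ 1 ≤ v.2 ∧ v.2 ≤ n) ∨
      (n ≤ v.1 ∧ v.1 ≤ 2 * n ∧ n + 1 ≤ v.1 + v.2 ∧ v.1 + v.2 ≤ 2 * n) := by
    rintro v (hv | hv)
    · exact .inl (fresh_spec hD hv).1
    · have := (fresh_spec hD hv).1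
      rw [mirror_apply] at this
      right; dsimp only at this; omega
  have un : ∀ v ∈ Under n D, 0 ≤ v.1 ∧ v.1 ≤ n ∧ 0 ≤ v.2 ∧ v.2 ≤ n := fun v hv => hv.1
  set Up : Set Site := {v | n < v.1 ∧ 2 * n < v.1 + v.2} with hUp
  have hout : ∀ a t : Site, a ∈ Fresh2 n D → t ∈ Up → Adj a t → a ∈ topRight n := by
    rintro a t ha ⟨h1, h2⟩ h
    have := fr a ha
    rw [adj_iff] at h
    simp only [topRight, Set.mem_ofPred_eq]; omega
  rcases cross_or (x0 := -1) (x1 := 2 * n) (y0 := -n) (y1 := n)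
    (Under n D ∪ {v | v.1 ≤ n ∧ v.2 < 0} ∪ Up ∪ (Fresh2 n D ∩ st true ω)) (by omega) (by omega) with
    ⟨a, b, h⟩ | ⟨a, b, h⟩
  · left
    obtain ⟨p, q, h1, h2, h3, -⟩ := h.symm.first_hit (B := Under n D ∪ {v | v.1 ≤ n ∧ v.2 < 0})
      (by
        rintro (h | h)
        · have := (un _ h).2.1; dsimp only at this; omega
        · have : 2 * n ≤ n := h.1; omega)
      (by
        rcases h.left_mem.2 with ((h | h) | h) | h
        · exact .inl h
        · exact .inr h
        · exact absurd h.1 (by dsimp only; omega)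
        · exact absurd (fr _ h.1) (by dsimp only; omega))
    have hsub : ∀ z, z ∈ ((rect (-1) (2 * n) (-n) n ∩ (Under n D ∪ {v | v.1 ≤ n ∧ v.2 < 0} ∪ Up ∪
        (Fresh2 n D ∩ st true ω))) \ (Under n D ∪ {v | v.1 ≤ n ∧ v.2 < 0})) →
        z ∈ Up ∨ z ∈ Fresh2 n D ∩ st true ω := by
      rintro z ⟨⟨_, (h | h) | h⟩, h'⟩
      · exact absurd h h'
      · exact .inl h
      · exact .inr h
    rcases hsub p h1.right_mem with hp | hp
    · have hq : q = (n, n) := by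
        obtain ⟨p1, p2⟩ := hp
        rw [adj_iff] at h2
        rcases h3 with h3 | ⟨h3, h4⟩
        · have := un q h3
          ext <;> dsimp only <;> omega
        · omega
      rcases h3 with h3 | h3
      · exact ⟨q, by rw [hq]; exact ⟨le_rfl, .inl (by dsimp only; omega)⟩, subset_clu h3⟩
      · have := h3.2; rw [hq] at this; dsimp only at this; omega
    · have hq : q ∈ Under n D := by
        rcases h3 with h3 | ⟨h3, h4⟩
        · exact h3
        · have := fr p hp.1
          rw [adj_iff] at h2; omega
      have hpc : p ∈ Clu (Under n D) (Fresh2 n D ∩ st true ω) :=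
        clu_step (subset_clu hq) h2.symm hp
      by_cases hpT : p ∈ topRight n
      · exact ⟨p, hpT, hpc⟩
      have hpU : p ∉ Up := by
        intro h; have := fr p hp.1; have := h.1; have := h.2; omega
      obtain ⟨s, t, g1, g2, g3, g4⟩ := h1.symm.first_hit (B := topRight n ∪ Up)
        (by rintro (h | h) <;> contradiction) (.inl ⟨by dsimp only; omega, .inr rfl⟩)
      have hs : Conn (Fresh2 n D ∩ st true ω) p s := g1.mono fun z hz =>
        (hsub z hz.1).resolve_left fun h => hz.2 (.inr h)
      have hsc : s ∈ Clu (Under n D) (Fresh2 n D ∩ st true ω) := by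
        obtain ⟨w, hw, hwp⟩ := hpc
        exact ⟨w, hw, hwp.trans (hs.mono Set.subset_union_right)⟩
      have ht : t ∉ Up := fun ht => g1.right_mem.2 (.inl (hout s t hs.right_mem.1 ht g2))
      exact ⟨t, g3.resolve_right ht, clu_step hsc g2 ((hsub t g4).resolve_left ht)⟩
  · right
    have hsub : ∀ z, z ∈ ((rect (-1) (2 * n) (-n) n \ (Under n D ∪ {v | v.1 ≤ n ∧ v.2 < 0} ∪ Up ∪
        (Fresh2 n D ∩ st true ω))) \ (mirror n ⁻¹' Under n D ∪ {v | n < v.1 ∧ v.1 + v.2 < n})) →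
        z.1 = -1 ∨ z ∈ Fresh2 n D ∩ st false ω := by
      rintro z ⟨⟨h1, h2⟩, h3⟩
      simp only [Set.mem_union, not_or] at h2 h3
      obtain ⟨⟨⟨h4, h5⟩, h6⟩, h7⟩ := h2
      obtain ⟨h8, h9⟩ := h3
      rw [mem_rect] at h1
      simp only [Set.mem_ofPred_eq, hUp] at h5 h6 h9
      have hcl : z ∈ Fresh2 n D → z ∈ Fresh2 n D ∩ st false ω := fun h =>
        ⟨h, (Bool.eq_false_iff.2 fun h' => h7 ⟨h, h'⟩ : ω z = false)⟩
      by_cases hz : z.1 = -1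
      · exact .inl hz
      right
      by_cases hzn : z.1 ≤ n
      · refine hcl (.inl (by_contra fun h => h4 ⟨?_, h⟩))
        rw [mem_rect]; omega
      · refine hcl (.inr (by_contra fun h => h8 ⟨?_, h⟩))
        rw [mem_rect, mirror_apply]; dsimp only; omega
    have ha : n < a := by
      by_contra hc
      exact h.left_mem.2 (.inl (.inl (.inr ⟨by dsimp only; omega, by dsimp only; omega⟩)))
    have ha' : a ≤ 2 * n := h.left_mem.1.2.1
    have hb : b ≤ n := by
      by_contra hc
      exact h.right_mem.2 (.inl (.inr ⟨by dsimp only; omega, by dsimp only; omega⟩))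
    obtain ⟨p, q, h1, h2, h3, -⟩ := h.symm.first_hit
      (B := mirror n ⁻¹' Under n D ∪ {v | n < v.1 ∧ v.1 + v.2 < n})
      (by
        rintro (h' | h')
        · have h0 : mirror n (b, n) ∈ Under n D := h'
          have h4 := un _ h0
          rw [mirror_apply] at h4
          dsimp only at h4
          have : b = n := by omega
          subst this
          rw [mirror_apply] at h0
          dsimp only at h0
          rw [show 2 * b - b = b by ring, show b + b - b = b by ring] at h0
          exact h.right_mem.2 (.inl (.inl (.inl h0)))
        · have := h'.1; dsimp only at this; omega)
      (by
        by_cases h' : a = 2 * n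
        · left
          change mirror n (a, -n) ∈ Under n D
          rw [mirror_apply]
          refine ⟨by rw [mem_rect]; dsimp only; omega, fun hf => ?_⟩
          have := (fresh_spec hD hf).1
          dsimp only at this; omega
        · exact .inr ⟨by dsimp only; omega, by dsimp only; omega⟩)
    have hq1 : n ≤ q.1 := by
      rcases h3 with h3 | h3
      · have := (un _ h3).2.1
        rw [mirror_apply] at this; dsimp only at this; omega
      · exact h3.1.le
    have hp : p ∈ Fresh2 n D ∩ st false ω := by
      refine (hsub p h1.right_mem).resolve_left fun h => ?_
      rw [adj_iff] at h2; omega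
    have hq : q ∈ mirror n ⁻¹' Under n D := by
      rcases h3 with h3 | ⟨h3, h4⟩
      · exact h3
      · have := fr p hp.1
        rw [adj_iff] at h2; omega
    have hpc : p ∈ Clu (mirror n ⁻¹' Under n D) (Fresh2 n D ∩ st false ω) :=
      clu_step (subset_clu hq) h2.symm hp
    by_cases hpT : p ∈ topLeft n
    · exact ⟨p, hpT, hpc⟩
    obtain ⟨s, t, g1, g2, g3, g4⟩ := h1.symm.first_hit (B := topLeft n ∪ {v | v.1 = -1})
      (by
        rintro (h | h)
        · contradiction
        · have := fr p hp.1; have : p.1 = -1 := h; omega)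
      (.inl ⟨hb, .inl rfl⟩)
    have hs : Conn (Fresh2 n D ∩ st false ω) p s := g1.mono fun z hz =>
      (hsub z hz.1).resolve_left fun h => hz.2 (.inr h)
    have hsc : s ∈ Clu (mirror n ⁻¹' Under n D) (Fresh2 n D ∩ st false ω) := by
      obtain ⟨w, hw, hwp⟩ := hpc
      exact ⟨w, hw, hwp.trans (hs.mono Set.subset_union_right)⟩
    have ht : ¬ t.1 = -1 := by
      intro ht
      refine g1.right_mem.2 (.inl ?_)
      have := fr s hs.right_mem.1
      rw [adj_iff] at g2
      simp only [topLeft, Set.mem_ofPred_eq]; omega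
    exact ⟨t, g3.resolve_right ht, clu_step hsc g2 ((hsub t g4).resolve_left ht)⟩

section Prob

variable {μ : Measure Config}

theorem half_le_freshOpen (hμ : IsBernoulliHalf μ) {n : ℤ} (hn : 1 ≤ n) {D : Set Site}
    (hD : Bot 0 n 0 ⊆ D) : 1 / 2 ≤ μ.real (FreshOpen n D) := by
  have h1 : (1 : ℝ) ≤ μ.real (FreshOpen n D) + μ.real (FreshClosed n D) := by
    rw [← prob_univ hμ]
    exact (prob_mono hμ fun ω _ => freshOpen_or_closed hn hD ω).trans (prob_union_le hμ _ _)
  have h2 : μ.real (FreshClosed n D) ≤ μ.real (FreshOpen n D) := by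
    rw [← prob_relabel hμ (freshOpen_dep n D) (mirror n) true]
    refine prob_mono hμ ?_
    rintro ω ⟨v, hv, u, hu, huv⟩
    refine ⟨mirror n v, ?_, mirror n u, hu, huv.map (mirror_adj n) ?_⟩
    · simp only [topLeft, topRight, mirror_apply, Set.mem_ofPred_eq] at *; omega
    · rintro z (hz | ⟨hz1, hz2⟩)
      · exact .inl hz
      · refine .inr ⟨?_, ?_⟩
        · rcases hz1 with h | h
          · right; rwa [mirror_mirror]
          · exact .inl h
        · change (ω (mirror n (mirror n z)) ^^ true) = true
          rw [mirror_mirror, show ω z = false from hz2]; rfl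
  linarith

theorem wedge_finite (n : ℤ) : (Wedge n).Finite :=
  (rect_finite 0 n 0 n).union ((rect_finite 0 n 0 n).preimage (mirror n).injective.injOn)

theorem freshOpen_lnk {n : ℤ} (hn : 1 ≤ n) {ω : Config} (hG : ∀ v ∈ BClu 0 n 0 n ω, v.2 < n)
    (h : ω ∈ FreshOpen n (BClu 0 n 0 n ω)) : ω ∈ Lnk true (Wedge n) {v | v.1 = 0} (topRight n) := by
  set D := BClu 0 n 0 n ω with hD
  have hBD : Bot 0 n 0 ⊆ D := subset_clu
  have hFsub : ∀ z, z ∈ Fresh n D → z ∈ rect 0 n 0 n := fun z hz => by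
    have := (fresh_spec hBD hz).1
    rw [mem_rect]; omega
  have hsub : Fresh2 n D ∩ st true ω ⊆ Wedge n ∩ st true ω := by
    rintro z ⟨hz1, hz2⟩
    exact ⟨hz1.imp (hFsub _) (hFsub _), hz2⟩
  obtain ⟨v, hv, u, hu, huv⟩ := h
  have key : ∃ q, q ∈ Frontier 0 n (-1) n D ∧ (q = v ∨
      ∃ p, Adj q p ∧ Conn (Wedge n ∩ st true ω) p v) := by
    by_cases hvN : v ∈ Under n D
    · have h1 := hvN.1
      rw [mem_rect] at h1
      simp only [topRight, Set.mem_ofPred_eq] at hv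
      exact ⟨v, frontier_of_top hvN.1 hvN.2 (by omega) hG, .inl rfl⟩
    · obtain ⟨p, q, h1, h2, h3, -⟩ := huv.symm.first_hit hvN hu
      have h4 : Conn (Fresh2 n D ∩ st true ω) v p := h1.mono fun z hz => hz.1.resolve_left hz.2
      refine ⟨q, ?_, .inr ⟨p, h2.symm, (h4.mono hsub).symm⟩⟩
      have h5 := h3.1
      rw [mem_rect] at h5
      rcases h4.right_mem.1 with hp | hp
      · exact frontier_of_adj_fresh h3.1 h3.2 hp h2.symm hBD
      · have hp' := (fresh_spec hBD hp).1
        rw [mirror_apply] at hp'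
        dsimp only at hp'
        rcases eq_or_ne p.1 n with hpn | hpn
        · have e : mirror n p = p := by rw [mirror_apply]; ext <;> dsimp only <;> omega
          rw [e] at hp
          exact frontier_of_adj_fresh h3.1 h3.2 hp h2.symm hBD
        · have e : mirror n q = q := by
            rw [adj_iff] at h2
            rw [mirror_apply]; ext <;> dsimp only <;> omega
          have h6 := mirror_adj n _ _ h2.symm
          rw [e] at h6
          exact frontier_of_adj_fresh h3.1 h3.2 hp h6 hBD
  obtain ⟨q, hq, hqv⟩ := key
  obtain ⟨y, hy⟩ := botClu_frontier_conn (y0 := 0) (K := rect 0 n 0 n ∩ cl ω)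
    Set.inter_subset_left (by omega) hG le_rfl
    (show (0 : ℤ) ≤ n by omega) hq
  have hF : Frontier 0 n (-1) n D ⊆ Wedge n ∩ st true ω := by
    intro z hz
    obtain ⟨h1, h2⟩ := botClu_frontier_mem (y0 := 0) (K := rect 0 n 0 n ∩ cl ω) hz
    refine ⟨.inl h1, ?_⟩
    by_contra hc
    exact h2 ⟨h1, Bool.eq_false_iff.2 hc⟩
  have h0 := (hy.mono hF).symm
  refine ⟨(0, y), rfl, v, hv, ?_⟩
  rcases hqv with rfl | ⟨p, h1, h2⟩
  · exact h0
  · exact (h0.tail h1 h2.left_mem).trans h2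

theorem quarter_le_wedge (hμ : IsBernoulliHalf μ) {n : ℤ} (hn : 1 ≤ n) :
    1 / 4 ≤ μ.real (Lnk true (Wedge n) {v | v.1 = 0} (topRight n)) := by
  have h1 := prob_reveal_clu hμ false (p := 1 / 2) (rect_finite 0 n (0 - 1) (0 - 1))
    (rect_finite 0 n 0 n) (fun D => ∀ v ∈ D, v.2 < n) (FreshOpen n) ?_
  · have h2 : 1 / 2 ≤ μ.real {ω | ∀ v ∈ BClu 0 n 0 n ω, v.2 < n} := by
      refine (half_le_hz (c := true) hμ (x0 := 0) (x1 := n) (y0 := 0) (y1 := n) (by omega)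
        le_rfl).trans (prob_mono hμ fun ω hω v hv => ?_)
      by_contra hc
      obtain ⟨u, hu, huv⟩ := vcross_of_botClu (by omega) hv
      have h3 := (mem_rect.1 huv.right_mem.1).2.2.2
      exact hz_vt_disj hω ⟨u, hu, v, (show v.2 = n by omega), huv⟩
    have h3 := h1.trans (prob_mono hμ fun ω hω => freshOpen_lnk hn hω.1 hω.2)
    refine le_trans ?_ h3
    have : μ.real {ω | ∀ v ∈ BClu 0 n 0 n ω, v.2 < n} = μ.real {ω | ∀ v ∈ Clu (rect 0 n (0 - 1)
        (0 - 1)) (rect 0 n 0 n ∩ st false ω), v.2 < n} := rfl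
    rw [← this]
    linarith
  · intro ω hG
    refine ⟨(fresh2_finite n _).toFinset, freshOpen_dep n _, ?_, half_le_freshOpen hμ hn subset_clu⟩
    intro v hv hvR
    have hB : Bot 0 n 0 ⊆ Clu (rect 0 n (0 - 1) (0 - 1)) (rect 0 n 0 n ∩ st false ω) := subset_clu
    rcases (fresh2_finite n _).mem_toFinset.1 hv with h | h
    · exact (fresh_spec hB h).2
    · have e : mirror n v = v := by
        have := (fresh_spec hB h).1
        rw [mem_rect] at hvR
        rw [mirror_apply] at this ⊢
        ext <;> dsimp only at * <;> omega
      rw [e] at h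
      exact (fresh_spec hB h).2

end Prob


theorem mem_wedge {n : ℤ} {v : Site} : v ∈ Wedge n ↔
    (0 ≤ v.1 ∧ v.1 ≤ n ∧ 0 ≤ v.2 ∧ v.2 ≤ n) ∨
      (n ≤ v.1 ∧ v.1 ≤ 2 * n ∧ n ≤ v.1 + v.2 ∧ v.1 + v.2 ≤ 2 * n) := by
  simp only [Wedge, Set.mem_ofPred_eq, mem_rect, mirror_apply]; omega

theorem Conn.union_left {S T : Set Site} {u v : Site} (h : Conn S u v) : Conn (S ∪ T) u v :=
  h.mono Set.subset_union_left

theorem wedge_cross {n : ℤ} (hn : 1 ≤ n) {ω : Config}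
    (h1 : ω ∈ Lnk true (Wedge n) {v | v.1 = 0} (topRight n))
    (h2 : ω ∈ Lnk true (Wedge n) {v | v.1 = 2 * n} (topLeft n)) :
    ω ∈ Lnk true (Wedge n) {v | v.1 = 0} {v | v.1 = 2 * n} := by
  obtain ⟨u, hu, v, hv, huv⟩ := h1
  obtain ⟨a, ha, b, hb, hab⟩ := h2
  have hu' : u.1 = 0 := hu
  have ha' : a.1 = 2 * n := ha
  by_cases hv' : v.1 = 2 * n
  · exact ⟨u, hu, v, hv', huv⟩
  by_cases hb' : b.1 = 0
  · exact ⟨b, hb', a, ha, hab.symm⟩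
  have v1 : n ≤ v.1 ∧ v.1 + v.2 = 2 * n := ⟨hv.1, hv.2.resolve_right hv'⟩
  have b1 : b.1 ≤ n ∧ b.2 = n := ⟨hb.1, hb.2.resolve_right hb'⟩
  have hvw := mem_wedge.1 huv.right_mem.1
  have haw := mem_wedge.1 hab.left_mem.1
  have c1 : Conn ({z | Conn (Wedge n ∩ st true ω) u z} ∪ {z | v.1 < z.1 ∧ z.1 ≤ 2 * n + 1 ∧ z.2 = v.2})
      u (2 * n + 1, v.2) := by
    refine huv.component.union_left.trans ?_
    refine (conn_row (x0 := v.1) (x1 := 2 * n + 1) (y := v.2) (by omega) fun x h1 h2 => ?_)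
    rcases eq_or_lt_of_le h1 with h | h
    · left; subst h; exact huv
    · exact .inr ⟨h, h2, rfl⟩
  have c2 : Conn ({z | Conn (Wedge n ∩ st true ω) a z} ∪ {z | z.1 = 2 * n + 1 ∧ z.2 ≤ a.2})
      (2 * n + 1, -n) b := by
    refine Conn.trans (v := (2 * n + 1, a.2)) ?_ (Conn.head ?_ ?_ hab.component.union_left)
    · by_cases h : -n ≤ a.2
      · exact conn_col h fun y _ h2 => .inr ⟨rfl, h2⟩
      · omega
    · exact .inr ⟨rfl, le_rfl⟩
    · rw [adj_iff]; dsimp only; omega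
  have r1 : ∀ w ∈ {z | Conn (Wedge n ∩ st true ω) u z} ∪
      {z | v.1 < z.1 ∧ z.1 ≤ 2 * n + 1 ∧ z.2 = v.2}, -n ≤ w.2 ∧ w.2 ≤ n := by
    rintro w (hw | ⟨h1, h2, h3⟩)
    · have := mem_wedge.1 hw.right_mem.1; omega
    · omega
  have r2 : ∀ w ∈ {z | Conn (Wedge n ∩ st true ω) a z} ∪ {z | z.1 = 2 * n + 1 ∧ z.2 ≤ a.2},
      0 ≤ w.1 ∧ w.1 ≤ 2 * n + 1 := by
    rintro w (hw | ⟨h1, h2⟩)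
    · have := mem_wedge.1 hw.right_mem.1; omega
    · omega
  obtain ⟨z, z1, z2⟩ := conn_meet (x0 := 0) (x1 := 2 * n + 1) (y0 := -n) (y1 := n) c1 r1 hu'.le
    le_rfl c2 r2 le_rfl b1.2.ge
  · have z1 := z1.right_mem
    have z2 := z2.right_mem
    rcases z1 with z1 | ⟨z1, z1', z1''⟩ <;> rcases z2 with z2 | ⟨z2, z2'⟩
    · exact ⟨u, hu, a, ha, Conn.trans z1 z2.symm⟩
    · have := mem_wedge.1 z1.right_mem.1; omega
    · have := mem_wedge.1 z2.right_mem.1; omega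
    · omega

/-- The central symmetry of the mirror image of the square. -/
def halfTurn (n : ℤ) : Site ≃ Site where
  toFun v := (3 * n - v.1, -v.2)
  invFun v := (3 * n - v.1, -v.2)
  left_inv v := by ext <;> dsimp only <;> ring
  right_inv v := by ext <;> dsimp only <;> ring

theorem halfTurn_apply (n : ℤ) (v : Site) : halfTurn n v = (3 * n - v.1, -v.2) := rfl

theorem halfTurn_adj (n : ℤ) (a b : Site) (h : Adj a b) : Adj (halfTurn n a) (halfTurn n b) := by
  simp only [adj_iff, halfTurn_apply] at *; omega

/-- The mirror image of the square `[0, n]²`. -/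
def Diamond (n : ℤ) : Set Site := {v | n ≤ v.1 ∧ v.1 ≤ 2 * n ∧ n ≤ v.1 + v.2 ∧ v.1 + v.2 ≤ 2 * n}

theorem diamond_meet {n : ℤ} {ω : Config} {S : Set Site} {u v a b : Site} {p q : ℤ}
    (hpq : p ≤ n ∧ 2 * n ≤ q) (hS : Conn S u v) (hSR : S ⊆ rect p q (-n) n)
    (hSU : ∀ z ∈ S, n ≤ z.1 → z.1 ≤ 2 * n → n ≤ z.1 + z.2 ∧ z.1 + z.2 ≤ 2 * n) (hu : u.1 = p)
    (hv : v.1 = q) (hab : Conn (Diamond n ∩ st true ω) a b) (ha : a.1 + a.2 = n)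
    (hb : b.1 + b.2 = 2 * n) :
    ∃ z, Conn S u z ∧ Conn (Diamond n ∩ st true ω) a z := by
  set T := {z | Conn (Diamond n ∩ st true ω) a z} ∪
    {z : Site | n ≤ z.1 ∧ z.1 ≤ 2 * n ∧ (z.1 + z.2 < n ∨ 2 * n < z.1 + z.2)} with hT
  obtain ⟨a1, a2, -, -⟩ := hab.left_mem.1
  obtain ⟨b1, b2, -, -⟩ := hab.right_mem.1
  have c1 : Conn T (a.1, -n) a := by
    refine conn_col (x := a.1) (y0 := -n) (y1 := a.2) (by omega) fun y h1 h2 => ?_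
    rcases eq_or_lt_of_le h2 with h | h
    · left; subst h; exact .refl hab.left_mem
    · right; exact ⟨a1, a2, .inl (by dsimp only; omega)⟩
  have c2 : Conn T b (b.1, n) := by
    refine conn_col (x := b.1) (y0 := b.2) (y1 := n) (by omega) fun y h1 h2 => ?_
    rcases eq_or_lt_of_le h1 with h | h
    · left; subst h; exact hab
    · right; exact ⟨b1, b2, .inr (by dsimp only; omega)⟩
  have r : ∀ w ∈ T, n ≤ w.1 ∧ w.1 ≤ 2 * n := by
    rintro w (hw | ⟨h1, h2, _⟩)
    · obtain ⟨h1, h2, -, -⟩ := hw.right_mem.1; exact ⟨h1, h2⟩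
    · exact ⟨h1, h2⟩
  obtain ⟨z, z1, z2⟩ := conn_meet (x0 := n) (x1 := 2 * n) (y0 := -n) (y1 := n) hS
    (fun w hw => ⟨(hSR hw).2.2.1, (hSR hw).2.2.2⟩) (by omega) (by omega)
    (c1.trans (hab.component.union_left.trans c2)) r le_rfl le_rfl
  · refine ⟨z, z1, ?_⟩
    rcases z2.right_mem with h | ⟨h1, h2, h3⟩
    · exact h
    · have := hSU z z1.right_mem h1 h2; omega

section Prob

variable {μ : Measure Config}

theorem prob_wedge_cross (hμ : IsBernoulliHalf μ) {n : ℤ} (hn : 1 ≤ n) :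
    1 / 16 ≤ μ.real (Lnk true (Wedge n) {v | v.1 = 0} {v | v.1 = 2 * n}) := by
  have h1 := quarter_le_wedge hμ hn
  have h2 : 1 / 4 ≤ μ.real (Lnk true (Wedge n) {v | v.1 = 2 * n} (topLeft n)) := by
    refine h1.trans (prob_lnk_le hμ (wedge_finite n) true true (mirror n) (mirror_adj n) ?_ ?_ ?_)
    · rintro v (h | h)
      · right; rwa [mirror_mirror]
      · exact .inl h
    · intro v _ hv
      simp only [mirror_apply, Set.mem_ofPred_eq] at *; omega
    · intro v _ hv
      simp only [mirror_apply, topLeft, topRight, Set.mem_ofPred_eq] at *; omega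
  have h3 := (lnk_loc _ _ (wedge_finite n)).fkg_le hμ (lnk_loc _ _ (wedge_finite n))
    (lnk_inc _ _ _) (lnk_inc _ _ _) (by norm_num) h1 h2
  exact (by norm_num : (1 : ℝ) / 16 ≤ 1 / 4 * (1 / 4)).trans
    (h3.trans (prob_mono hμ fun ω h => wedge_cross hn h.1 h.2))

/-- Rectangles of aspect ratio `3/2` are crossed in the hard direction. -/
theorem prob_hz_three_two (hμ : IsBernoulliHalf μ) {n : ℤ} (hn : 1 ≤ n) :
    1 / 512 ≤ μ.real (Hz true 0 (3 * n) 0 (2 * n)) := by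
  have h1 := prob_wedge_cross hμ hn
  have hf : (halfTurn n ⁻¹' Wedge n).Finite := (wedge_finite n).preimage (halfTurn n).injective.injOn
  have h2 : 1 / 16 ≤ μ.real (Lnk true (halfTurn n ⁻¹' Wedge n) {v | v.1 = 3 * n} {v | v.1 = n}) := by
    refine h1.trans (prob_lnk_le hμ (wedge_finite n) true true (halfTurn n) (halfTurn_adj n) ?_ ?_ ?_)
    · intro v hv
      change halfTurn n (halfTurn n v) ∈ Wedge n
      rwa [show halfTurn n (halfTurn n v) = v from (halfTurn n).left_inv v]
    · intro v _ hv
      simp only [halfTurn_apply, Set.mem_ofPred_eq] at *; omega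
    · intro v _ hv
      simp only [halfTurn_apply, Set.mem_ofPred_eq] at *; omega
  have hfd : (Diamond n).Finite := by
    refine (wedge_finite n).subset fun v hv => mem_wedge.2 (.inr hv)
  have h3 : 1 / 2 ≤ μ.real (Lnk true (Diamond n) {v | v.1 + v.2 = n} {v | v.1 + v.2 = 2 * n}) := by
    refine (half_le_vt (c := true) hμ (x0 := 0) (x1 := n) (y0 := 0) (y1 := n) (by omega)
      le_rfl).trans (prob_lnk_le hμ (rect_finite _ _ _ _) true true (mirror n) (mirror_adj n) ?_ ?_ ?_)
    · intro v hv
      simp only [mem_rect, Diamond, mirror_apply, Set.mem_ofPred_eq] at *; omega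
    · intro v _ hv
      simp only [mirror_apply, Set.mem_ofPred_eq] at *; omega
    · intro v _ hv
      simp only [mirror_apply, Set.mem_ofPred_eq] at *; omega
  have h23 := (lnk_loc _ _ hf).fkg_le hμ (lnk_loc _ _ hfd) (lnk_inc _ _ _) (lnk_inc _ _ _)
    (by norm_num) h2 h3
  have h123 := (lnk_loc _ _ (wedge_finite n)).fkg_le hμ ((lnk_loc _ _ hf).inter (lnk_loc _ _ hfd))
    (lnk_inc _ _ _) ((lnk_inc _ _ _).inter (lnk_inc _ _ _)) (by norm_num) h1 h23
  refine (by norm_num : (1 : ℝ) / 512 ≤ 1 / 16 * (1 / 16 * (1 / 2))).trans (h123.trans ?_)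
  refine (prob_mono hμ (F := Hz true 0 (3 * n) (-n) n) ?_).trans (prob_hz_eq hμ (by omega) (by omega))
  rintro ω ⟨⟨u, hu, v, hv, huv⟩, ⟨v', hv', u', hu', hvu'⟩, a, ha, b, hb, hab⟩
  simp only [Set.mem_ofPred_eq] at hu hv hu' hv' ha hb
  have w2 : ∀ {z}, z ∈ halfTurn n ⁻¹' Wedge n → (2 * n ≤ z.1 ∧ z.1 ≤ 3 * n ∧ -n ≤ z.2 ∧ z.2 ≤ 0) ∨
      (n ≤ z.1 ∧ z.1 ≤ 2 * n ∧ n ≤ z.1 + z.2 ∧ z.1 + z.2 ≤ 2 * n) := by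
    intro z hz
    have := mem_wedge.1 (show halfTurn n z ∈ Wedge n from hz)
    rw [halfTurn_apply] at this
    dsimp only at this
    omega
  obtain ⟨z, z1, z2⟩ := diamond_meet (p := 0) (q := 2 * n) (by omega) huv
    (fun z hz => by have := mem_wedge.1 hz.1; rw [mem_rect]; omega)
    (fun z hz _ _ => by have := mem_wedge.1 hz.1; omega) hu hv hab ha hb
  obtain ⟨z', z1', z2'⟩ := diamond_meet (p := n) (q := 3 * n) (by omega) hvu'.symm
    (fun z hz => by have := w2 hz.1; rw [mem_rect]; omega)
    (fun z hz _ _ => by have := w2 hz.1; omega) hu' hv' hab ha hb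
  refine ⟨u, hu, v', hv', ?_⟩
  have s1 : Wedge n ∩ st true ω ⊆ rect 0 (3 * n) (-n) n ∩ st true ω := fun z hz =>
    ⟨by have := mem_wedge.1 hz.1; rw [mem_rect]; omega, hz.2⟩
  have s2 : halfTurn n ⁻¹' Wedge n ∩ st true ω ⊆ rect 0 (3 * n) (-n) n ∩ st true ω := fun z hz =>
    ⟨by have := w2 hz.1; rw [mem_rect]; omega, hz.2⟩
  have s3 : Diamond n ∩ st true ω ⊆ rect 0 (3 * n) (-n) n ∩ st true ω := fun z hz =>
    s1 ⟨mem_wedge.2 (.inr hz.1), hz.2⟩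
  exact (z1.mono s1).trans ((z2.mono s3).symm.trans ((z2'.mono s3).trans
    ((z1'.mono s2).symm.trans (hvu'.mono s2).symm)))

/-- The Russo-Seymour-Welsh theorem. -/
theorem rsw_hz (hμ : IsBernoulliHalf μ) (K : ℕ) : ∃ p > 0, ∀ M : ℤ, 2 ≤ M → ∀ (c : Bool)
    (x0 x1 y0 y1 : ℤ), x0 ≤ x1 → x1 - x0 ≤ K * M → M ≤ y1 - y0 → p ≤ μ.real (Hz c x0 x1 y0 y1) := by
  have h1 : ∀ k : ℕ, ∃ p : ℝ, 0 < p ∧ ∀ n : ℤ, 1 ≤ n →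
      p ≤ μ.real (Hz true 0 (2 * n + 2 ^ k * n) 0 (2 * n)) := by
    intro k
    induction k with
    | zero =>
      refine ⟨1 / 512, by norm_num, fun n hn => ?_⟩
      rw [show 2 * n + 2 ^ 0 * n = 3 * n by ring]
      exact prob_hz_three_two hμ hn
    | succ k ih =>
      obtain ⟨p, hp, h⟩ := ih
      refine ⟨p * (p * (1 / 2)), by positivity, fun n hn => ?_⟩
      rw [show 2 * n + 2 ^ (k + 1) * n = 2 * (2 * n + 2 ^ k * n) - 2 * n by ring]
      refine prob_hz_glue hμ (by omega) ?_ hp.le (h n hn)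
      have : (0 : ℤ) ≤ 2 ^ k * n := by positivity
      omega
  obtain ⟨p, hp, h⟩ := h1 (2 * K)
  refine ⟨p, hp, fun M hM c x0 x1 y0 y1 hx hK hy => (h (M / 2) (by omega)).trans ?_⟩
  refine prob_hz_le hμ hx ?_ (by omega)
  have h2 : (2 * K : ℕ) < 2 ^ (2 * K) := Nat.lt_two_pow_self
  have h3 : (2 * K : ℤ) ≤ 2 ^ (2 * K) := by exact_mod_cast h2.le
  have h4 : (2 * K : ℤ) * (M / 2) ≤ 2 ^ (2 * K) * (M / 2) :=
    mul_le_mul_of_nonneg_right h3 (by omega)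
  rcases Nat.eq_zero_or_pos K with rfl | hK0
  · simp at hK ⊢; omega
  have h5 : (4 * K : ℤ) ≤ 2 ^ (2 * K) := by
    have : (2 * (2 * K) : ℕ) ≤ 2 ^ (2 * K) := by
      clear * - hK0
      induction K, hK0 using Nat.le_induction with
      | base => norm_num
      | succ K hK ih => rw [show 2 * (K + 1) = 2 * K + 2 by ring, pow_add]; omega
    have : (2 * (2 * K) : ℤ) ≤ 2 ^ (2 * K) := by exact_mod_cast this
    linarith
  have h6 : (4 * K : ℤ) * (M / 2) ≤ 2 ^ (2 * K) * (M / 2) := mul_le_mul_of_nonneg_right h5 (by omega)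
  have h7 : (K : ℤ) * M ≤ K * (4 * (M / 2)) := mul_le_mul_of_nonneg_left (by omega) (by omega)
  have h8 : (K : ℤ) * (4 * (M / 2)) = 4 * K * (M / 2) := by ring
  omega

theorem rsw_vt (hμ : IsBernoulliHalf μ) (K : ℕ) : ∃ p > 0, ∀ M : ℤ, 2 ≤ M → ∀ (c : Bool)
    (x0 x1 y0 y1 : ℤ), y0 ≤ y1 → y1 - y0 ≤ K * M → M ≤ x1 - x0 → p ≤ μ.real (Vt c x0 x1 y0 y1) := by
  obtain ⟨p, hp, h⟩ := rsw_hz hμ K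
  exact ⟨p, hp, fun M hM c x0 x1 y0 y1 hy hK hx =>
    (h M hM c y0 y1 x0 x1 hy hK hx).trans (prob_hz_vt hμ)⟩

end Prob


theorem exists_subcrossing' {S : Set Site} {u v : Site} {a b : ℤ} (h : Conn S u v) (hu : u.2 ≤ a)
    (hv : b ≤ v.2) (hab : a ≤ b) :
    ∃ u' v' : Site, u'.2 = a ∧ v'.2 = b ∧ Conn (S ∩ {w | a ≤ w.2 ∧ w.2 ≤ b}) u' v' := by
  obtain ⟨u', v', h1, h2, h3⟩ := exists_subcrossing
    (h.map (T := {z | transp z ∈ S}) transp_adj fun _ hz => hz) hu hv hab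
  exact ⟨transp u', transp v', h1, h2, h3.map transp_adj fun _ hz => hz⟩

section Flip

variable {μ : Measure Config} {E : Set Config}

/-- The configuration with the two states exchanged. -/
def flip (ω : Config) : Config := fun v => !ω v

theorem st_flip (c : Bool) (ω : Config) : st c (flip ω) = st (!c) ω := by
  ext v
  change (!ω v) = c ↔ ω v = !c
  cases ω v <;> cases c <;> simp

theorem flip_mem_lnk {c : Bool} {S A B : Set Site} {ω : Config} :
    flip ω ∈ Lnk c S A B ↔ ω ∈ Lnk (!c) S A B := by
  simp only [Lnk, Set.mem_ofPred_eq, st_flip]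

theorem prob_flip (hμ : IsBernoulliHalf μ) (hE : Loc E) : μ.real {ω | flip ω ∈ E} = μ.real E := by
  obtain ⟨S, hS⟩ := hE
  rw [← prob_relabel hμ hS (Equiv.refl _) true]
  congr 1
  ext ω
  have : relabel (Equiv.refl _) true ω = flip ω := by
    funext v; simp [relabel, flip]
  rw [Set.mem_ofPred_eq, Set.mem_ofPred_eq, this]

end Flip

/-- The box around `d` whose top side is right above `d`. -/
def Cap (m : ℤ) (d : Site) : Set Site := rect (d.1 - m) (d.1 + m) (d.2 - m) (d.2 + 1)

/-- The cluster of `d` in a box around `d` stays below `d` and reaches the boundary of the box. -/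
def Spike (c : Bool) (m : ℤ) (d : Site) : Set Config :=
  {ω | (∃ u : Site, (u.1 = d.1 - m ∨ u.1 = d.1 + m ∨ u.2 = d.2 - m) ∧
      Conn (Cap m d ∩ st c ω) d u) ∧
    ∀ v, Conn (Cap m d ∩ st c ω) d v → v ≠ d → v.2 < d.2}

theorem spike_loc {c : Bool} {m : ℤ} {d : Site} : Loc (Spike c m d) := by
  refine Loc.of_conn (rect_finite (d.1 - m) (d.1 + m) (d.2 - m) (d.2 + 1)) fun ω ω' h hω => ?_
  have : Cap m d ∩ st c ω = Cap m d ∩ st c ω' := by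
    ext v
    refine and_congr_right fun hv => ?_
    change ω v = c ↔ ω' v = c
    rw [h v hv]
  simpa only [Spike, Set.mem_ofPred_eq, this] using hω

theorem shift_symm_adj (p q : ℤ) (a b : Site) (h : Adj a b) :
    Adj ((shift p q).symm a) ((shift p q).symm b) := by
  rw [adj_iff] at *
  change (b.1 - p = a.1 - p + 1 ∧ b.2 - q = a.2 - q) ∨ (b.1 - p = a.1 - p - 1 ∧ b.2 - q = a.2 - q) ∨
    (b.1 - p = a.1 - p ∧ b.2 - q = a.2 - q + 1) ∨ (b.1 - p = a.1 - p ∧ b.2 - q = a.2 - q - 1) ∨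
    (b.1 - p = a.1 - p + 1 ∧ b.2 - q = a.2 - q - 1) ∨
    (b.1 - p = a.1 - p - 1 ∧ b.2 - q = a.2 - q + 1)
  omega

theorem xor_xor_eq {a c c' : Bool} : (a ^^ (c ^^ c')) = c ↔ a = c' := by
  cases a <;> cases c <;> cases c' <;> simp

section Prob

variable {μ : Measure Config}

theorem prob_spike_le (hμ : IsBernoulliHalf μ) (c c' : Bool) (m : ℤ) (d d' : Site) :
    μ.real (Spike c m d) ≤ μ.real (Spike c' m d') := by
  obtain ⟨F, hF⟩ := spike_loc (c := c) (m := m) (d := d)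
  set e := shift (d'.1 - d.1) (d'.2 - d.2) with he
  have ed : e d = d' := by
    ext
    · change d.1 + (d'.1 - d.1) = d'.1; ring
    · change d.2 + (d'.2 - d.2) = d'.2; ring
  have ed' : e.symm d' = d := by rw [← ed, e.symm_apply_apply]
  have e1 : ∀ v, (e v).1 = v.1 + (d'.1 - d.1) ∧ (e v).2 = v.2 + (d'.2 - d.2) := fun v => ⟨rfl, rfl⟩
  have e2 : ∀ v, (e.symm v).1 = v.1 - (d'.1 - d.1) ∧ (e.symm v).2 = v.2 - (d'.2 - d.2) :=
    fun v => ⟨rfl, rfl⟩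
  rw [← prob_relabel hμ hF e (c ^^ c')]
  refine prob_mono hμ ?_
  rintro ω ⟨⟨u, hu, hdu⟩, hmax⟩
  refine ⟨⟨e u, ?_, ?_⟩, fun v hv hne => ?_⟩
  · have := e1 u; omega
  · rw [← ed]
    refine hdu.map (shift_adj _ _) ?_
    rintro z ⟨h1, h2⟩
    rw [ed]
    refine ⟨?_, xor_xor_eq.1 h2⟩
    have := e1 z
    have h1 := mem_rect.1 h1
    exact mem_rect.2 (by omega)
  · have h1 : Conn (Cap m d ∩ st c (relabel e (c ^^ c') ω)) (e.symm d') (e.symm v) := by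
      refine hv.map (shift_symm_adj _ _) ?_
      rintro z ⟨h1, h2⟩
      refine ⟨?_, ?_⟩
      · have := e2 z
        have h1 := mem_rect.1 h1
        exact mem_rect.2 (by omega)
      · refine xor_xor_eq.2 ?_
        rw [e.apply_symm_apply]
        exact h2
    have h2 := hmax (e.symm v)
    rw [ed'] at h1
    have h3 := h2 h1 fun h => hne (by rw [← ed, ← h, e.apply_symm_apply])
    have := e2 v
    omega

/-- The part of the cluster of `d` below `d` in a fixed rectangle. -/
def SubClu (s : ℤ) (d : Site) (ω : Config) : Set Site :=
  {z | Conn (rect (-3 * s) (4 * s) (-3 * s) s ∩ {v | v.2 ≤ d.2} ∩ op ω) d z}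

theorem subClu_conn {s : ℤ} {d z z' : Site} {ω : Config} (hd : d.1 ≤ s ∧ 0 ≤ d.1 ∧ d.2 ≤ s ∧ 0 ≤ d.2)
    {S : Set Site} (hS : S ⊆ SubClu s d ω) (h : Conn S z z') : Conn (Cap (4 * s) d ∩ op ω) z z' := by
  refine h.mono fun w hw => ?_
  obtain ⟨⟨h1, h2⟩, h3⟩ := (hS hw).right_mem
  refine ⟨?_, h3⟩
  have h1 := mem_rect.1 h1
  have h2 : w.2 ≤ d.2 := h2
  exact mem_rect.2 (by omega)

theorem subClu_disj_aux {s : ℤ} {d d' : Site} {ω : Config}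
    (hd : d.1 ≤ s ∧ 0 ≤ d.1 ∧ d.2 ≤ s ∧ 0 ≤ d.2) (hd' : d'.1 ≤ s ∧ 0 ≤ d'.1 ∧ d'.2 ≤ s ∧ 0 ≤ d'.2)
    (h : ω ∈ Spike true (4 * s) d) (h' : ω ∈ Spike true (4 * s) d') (hle : d'.2 ≤ d.2) {z : Site}
    (hz : z ∈ SubClu s d ω) (hz' : z ∈ SubClu s d' ω) : d = d' := by
  by_contra hne
  have hz'd : Conn (SubClu s d ω) d' d := by
    have : Conn (rect (-3 * s) (4 * s) (-3 * s) s ∩ {v | v.2 ≤ d.2} ∩ op ω) d' z :=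
      Conn.mono (fun w hw => ⟨⟨hw.1.1, le_trans (show w.2 ≤ d'.2 from hw.1.2) hle⟩, hw.2⟩) hz'
    have h2 := Conn.trans hz this.symm
    exact h2.component.symm
  have hd2 : Conn (Cap (4 * s) d ∩ op ω) d d' := (subClu_conn hd subset_rfl hz'd).symm
  have hlt : d'.2 < d.2 := h.2 d' hd2 (Ne.symm hne)
  obtain ⟨a, b, h1, h2, h3, h4⟩ := hz'd.first_exit (A := {v | v.2 ≤ d'.2}) (show d'.2 ≤ d'.2 from le_rfl)
    (show ¬ d.2 ≤ d'.2 by omega)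
  have hcap : ∀ w ∈ SubClu s d ω, w.2 ≤ d'.2 + 1 → w ∈ Cap (4 * s) d' ∩ op ω := by
    intro w hw hw2
    obtain ⟨⟨h1, h2⟩, h3⟩ := hw.right_mem
    refine ⟨?_, h3⟩
    have h1 := mem_rect.1 h1
    exact mem_rect.2 (by omega)
  have h1a : Conn (Cap (4 * s) d' ∩ op ω) d' a :=
    h1.mono fun w hw => hcap w hw.1 (by have : w.2 ≤ d'.2 := hw.2; omega)
  have ha : a.2 ≤ d'.2 := h1.right_mem.2
  have hb : ¬ b.2 ≤ d'.2 := h3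
  have hab := adj_iff.1 h2
  have hbd : Conn (Cap (4 * s) d' ∩ op ω) d' b := h1a.tail h2 (hcap b h4.left_mem (by omega))
  have := h'.2 b hbd (by rintro rfl; omega)
  omega

/-- One of three long crossings in the annular region around a square. -/
def Arms (s : ℤ) : Set Config :=
  Hz true (-3 * s) 0 (-3 * s) s ∪ Hz true s (4 * s) (-3 * s) s ∪ Vt true (-3 * s) (4 * s) (-3 * s) 0

theorem subClu_arms {s : ℤ} (hs : 1 ≤ s) {d : Site} {ω : Config}
    (hd : d.1 ≤ s ∧ 0 ≤ d.1 ∧ d.2 ≤ s ∧ 0 ≤ d.2) (h : ω ∈ Spike true (4 * s) d) :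
    cfg (SubClu s d ω) ∈ Arms s := by
  obtain ⟨⟨u, hu, hdu⟩, hmax⟩ := h
  have hQ : ∃ b : Site, (b.1 ≤ -3 * s ∨ 4 * s ≤ b.1 ∨ b.2 ≤ -3 * s) ∧
      Conn (SubClu s d ω) d b := by
    obtain ⟨a, b, h1, h2, h3, h4⟩ := hdu.component.first_hit
      (B := {b | b.1 ≤ -3 * s ∨ 4 * s ≤ b.1 ∨ b.2 ≤ -3 * s})
      (by simp only [Set.mem_ofPred_eq]; omega) (by simp only [Set.mem_ofPred_eq]; omega)
    have hrow : ∀ w, Conn (Cap (4 * s) d ∩ st true ω) d w → w.2 ≤ d.2 := by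
      intro w hw
      by_cases hwd : w = d
      · rw [hwd]
      · exact (hmax w hw hwd).le
    have h5 : Conn (rect (-3 * s) (4 * s) (-3 * s) s ∩ {v | v.2 ≤ d.2} ∩ op ω) d a := by
      refine h1.mono ?_
      rintro w ⟨hw, hwB⟩
      have := hrow w hw
      simp only [Set.mem_ofPred_eq] at hwB
      exact ⟨⟨mem_rect.2 (by omega), this⟩, hw.right_mem.2⟩
    have ha := h1.right_mem.2
    simp only [Set.mem_ofPred_eq] at ha
    have hab := adj_iff.1 h2
    have hb := hrow b h4
    have h6 := h5.tail h2 (w := b) ⟨⟨mem_rect.2 (by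
      have := hrow a h1.right_mem.1
      omega), hb⟩, (Conn.right_mem h4).2⟩
    exact ⟨b, h3, h6.component⟩
  have hop : op (cfg (SubClu s d ω)) = SubClu s d ω := by
    ext z; exact cfg_apply
  obtain ⟨b, hb, hdb⟩ := hQ
  have hsub : ∀ w ∈ SubClu s d ω, -3 * s ≤ w.1 ∧ w.1 ≤ 4 * s ∧ -3 * s ≤ w.2 ∧ w.2 ≤ s :=
    fun w hw => mem_rect.1 hw.right_mem.1.1
  rcases hb with hb | hb | hb
  · obtain ⟨u, v, hu, hv, huv⟩ := exists_subcrossing (a := -3 * s) (b := 0) hdb.symm hb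
      (by omega) (by omega)
    refine .inl (.inl ⟨u, hu, v, hv, huv.mono ?_⟩)
    rintro w ⟨h1, h2, h3⟩
    have := hsub w h1
    exact ⟨mem_rect.2 (by omega), by rw [st_true, hop]; exact h1⟩
  · obtain ⟨u, v, hu, hv, huv⟩ := exists_subcrossing (a := s) (b := 4 * s) hdb (by omega) hb
      (by omega)
    refine .inl (.inr ⟨u, hu, v, hv, huv.mono ?_⟩)
    rintro w ⟨h1, h2, h3⟩
    have := hsub w h1
    exact ⟨mem_rect.2 (by omega), by rw [st_true, hop]; exact h1⟩
  · obtain ⟨u, v, hu, hv, huv⟩ := exists_subcrossing' (a := -3 * s) (b := 0) hdb.symm hb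
      (by omega) (by omega)
    refine .inr ⟨u, hu, v, hv, huv.mono ?_⟩
    rintro w ⟨h1, h2, h3⟩
    have := hsub w h1
    exact ⟨mem_rect.2 (by omega), by rw [st_true, hop]; exact h1⟩

theorem arms_loc {s : ℤ} : Loc (Arms s) := (hz_loc.union hz_loc).union vt_loc

theorem arms_inc {s : ℤ} : Inc (Arms s) := by
  rintro ω ω' h ((h1 | h1) | h1)
  · exact .inl (.inl (hz_inc _ _ h h1))
  · exact .inl (.inr (hz_inc _ _ h h1))
  · exact .inr (vt_inc _ _ h h1)

theorem prob_arms_le (hμ : IsBernoulliHalf μ) :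
    ∃ ε : ℝ, 0 < ε ∧ ∀ s : ℤ, 2 ≤ s → μ.real (Arms s) ≤ 1 - ε := by
  obtain ⟨p, hp, h1⟩ := rsw_hz hμ 8
  obtain ⟨q, hq, h2⟩ := rsw_vt hμ 8
  refine ⟨q * q * p, by positivity, fun s hs => ?_⟩
  set D := Vt true (-3 * s) 0 (-3 * s) s ∩ Vt true s (4 * s) (-3 * s) s ∩
    Hz true (-3 * s) (4 * s) (-3 * s) 0 with hD
  have hDl : Loc D := (vt_loc.inter vt_loc).inter hz_loc
  have hDp : q * q * p ≤ μ.real D := by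
    refine (vt_loc.inter vt_loc).fkg_le hμ hz_loc (vt_inc.inter vt_inc) hz_inc hp.le ?_ ?_
    · refine vt_loc.fkg_le hμ vt_loc vt_inc vt_inc hq.le ?_ ?_
      · exact h2 s hs _ _ _ _ _ (by omega) (by push_cast; omega) (by omega)
      · exact h2 s hs _ _ _ _ _ (by omega) (by push_cast; omega) (by omega)
    · exact h1 s hs _ _ _ _ _ (by omega) (by push_cast; omega) (by omega)
  have hsub : Arms s ⊆ {ω | flip ω ∈ D}ᶜ := by
    rintro ω hω ⟨⟨h1, h2⟩, h3⟩
    replace h1 : ω ∈ Vt false _ _ _ _ := flip_mem_lnk.1 h1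
    replace h2 : ω ∈ Vt false _ _ _ _ := flip_mem_lnk.1 h2
    replace h3 : ω ∈ Hz false _ _ _ _ := flip_mem_lnk.1 h3
    rcases hω with (hω | hω) | hω
    · exact hz_vt_disj hω h1
    · exact hz_vt_disj hω h2
    · exact hz_vt_disj h3 hω
  have hfl : Loc {ω | flip ω ∈ D} := by
    obtain ⟨S, hS⟩ := hDl
    exact ⟨S, fun ω ω' h hω => hS _ _ (fun v hv => by simp only [flip, h v hv]) hω⟩
  obtain ⟨S, hS⟩ := hfl
  have := prob_mono hμ hsub
  rw [prob_compl hμ hS, prob_flip hμ hDl] at this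
  linarith

theorem prob_spike_upper (hμ : IsBernoulliHalf μ) :
    ∃ C : ℝ, 0 < C ∧ ∀ s : ℕ, 2 ≤ s → ∀ (c : Bool) (d : Site),
      (s : ℝ) ^ 2 * μ.real (Spike c (4 * s) d) ≤ C := by
  obtain ⟨ε, hε, harms⟩ := prob_arms_le hμ
  refine ⟨1 / ε, by positivity, fun s hs c d => ?_⟩
  set I : Finset Site := Finset.Icc (0 : ℤ) s ×ˢ Finset.Icc (0 : ℤ) s with hI
  have hmem : ∀ d ∈ I, d.1 ≤ s ∧ 0 ≤ d.1 ∧ d.2 ≤ s ∧ 0 ≤ d.2 := by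
    intro d hd
    simp only [hI, Finset.mem_product, Finset.mem_Icc] at hd
    omega
  obtain ⟨F, hF⟩ := arms_loc (s := s)
  have h1 := sum_prob_le hμ I (fun d => Spike true (4 * s) d) (BoxPow (Arms s))
    (fun d _ => spike_loc) (fun k => ⟨F, dep_boxPow hF k⟩) ?_
  · have h2 : (s : ℝ) ^ 2 * μ.real (Spike c (4 * s) d) ≤ ∑ d ∈ I, μ.real (Spike true (4 * s) d) := by
      have h3 : ∑ _d' ∈ I, μ.real (Spike c (4 * s) d) ≤ ∑ d ∈ I, μ.real (Spike true (4 * s) d) :=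
        Finset.sum_le_sum fun d' _ => prob_spike_le hμ c true (4 * s) d d'
      refine le_trans ?_ h3
      rw [Finset.sum_const, nsmul_eq_mul]
      refine mul_le_mul_of_nonneg_right ?_ measureReal_nonneg
      have : I.card = (s + 1) * (s + 1) := by
        rw [hI, Finset.card_product, Int.card_Icc]
        congr 1
      rw [this]
      push_cast
      nlinarith [(Nat.cast_nonneg s : (0 : ℝ) ≤ s)]
    refine h2.trans (h1.trans ?_)
    have hA0 : 0 ≤ μ.real (Arms s) := measureReal_nonneg
    have hA := harms s (by exact_mod_cast hs)
    have hle : ∑ k ∈ Finset.range I.card, μ.real (BoxPow (Arms s) (k + 1)) ≤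
        ∑ k ∈ Finset.range I.card, (1 - ε) ^ k := by
      refine Finset.sum_le_sum fun k _ => ?_
      refine (prob_mono hμ (inc_boxPow_anti (Nat.le_succ k))).trans
        ((prob_boxPow_le hμ hF arms_inc k).trans ?_)
      exact pow_le_pow_left₀ hA0 hA k
    refine hle.trans ?_
    have hg := mul_neg_geom_sum (1 - ε) I.card
    rw [le_div_iff₀ hε]
    have hp : (0 : ℝ) ≤ (1 - ε) ^ I.card := pow_nonneg (hA0.trans hA) _
    have : (1 - (1 - ε)) = ε := by ring
    rw [this] at hg
    linarith
  · intro J hJ ω hω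
    refine mem_boxPow J (fun d => SubClu s d ω) ω (fun d _ z hz => hz.right_mem.2) ?_ ?_
    · intro d hd d' hd' hne
      rw [Set.disjoint_left]
      intro z hz hz'
      have m1 := hmem d (hJ hd)
      have m2 := hmem d' (hJ hd')
      rcases le_total d'.2 d.2 with h | h
      · exact hne (subClu_disj_aux m1 m2 (hω d hd) (hω d' hd') h hz hz')
      · exact hne (subClu_disj_aux m2 m1 (hω d' hd') (hω d hd) h hz' hz).symm
    · intro d hd
      exact subClu_arms (by omega) (hmem d (hJ hd)) (hω d hd)

end Prob

theorem peak_spike {x0 x1 y0 y1 m : ℤ} {d : Site} {ω : Config} (hm : 1 ≤ m) (h0 : x0 ≤ d.1 - m)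
    (h1 : d.1 + m ≤ x1) (h2 : y0 ≤ d.2 - m) (h3 : d.2 + 1 ≤ y1) (h : Peak x0 x1 y0 y1 d ω) :
    ω ∈ Spike false m d := by
  obtain ⟨hd, hmax⟩ := h
  have hclu : ∀ v, Conn (rect x0 x1 y0 y1 ∩ cl ω) d v → v ∈ BClu x0 x1 y0 y1 ω := fun v hv =>
    hv.induction hd fun a b _ hab hb ih => clu_step ih hab hb
  have hrow : ∀ v, Conn (rect x0 x1 y0 y1 ∩ cl ω) d v → v.2 ≤ d.2 := by
    intro v hv
    by_cases hvd : v = d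
    · rw [hvd]
    · exact (hmax v (hclu v hv) hvd).le
  have hcap : Cap m d ⊆ rect x0 x1 y0 y1 := fun v hv => by
    have := mem_rect.1 hv
    exact mem_rect.2 (by omega)
  refine ⟨?_, fun v hv => hmax v (hclu v (hv.mono (Set.inter_subset_inter_left _ hcap)))⟩
  obtain ⟨u, hu, hud⟩ := vcross_of_botClu (by omega) hd
  obtain ⟨a, b, h1, h2, h3, h4⟩ := hud.symm.component.first_hit
    (B := {b | b.1 ≤ d.1 - m ∨ d.1 + m ≤ b.1 ∨ b.2 ≤ d.2 - m})
    (by simp only [Set.mem_ofPred_eq]; omega) (by simp only [Set.mem_ofPred_eq]; omega)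
  have h5 : Conn (Cap m d ∩ st false ω) d a := by
    refine h1.mono ?_
    rintro w ⟨hw, hwB⟩
    have := hrow w hw
    simp only [Set.mem_ofPred_eq] at hwB
    exact ⟨mem_rect.2 (by omega), hw.right_mem.2⟩
  have ha := h1.right_mem.2
  simp only [Set.mem_ofPred_eq] at ha h3
  have hab := adj_iff.1 h2
  have hb := hrow b h4
  have hac := mem_rect.1 h5.right_mem.1
  refine ⟨b, by omega, h5.tail h2 ⟨mem_rect.2 (by omega), (Conn.right_mem h4).2⟩⟩


/-- The sites lying far away from the core or high above it. -/
def Far (s : ℤ) : Set Site :=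
  {v | -(400 * s) ≤ v.1 ∧ v.1 ≤ 400 * s ∧ v.2 ≤ 2 * s + 1 ∧
    (((v.1 < -(2 * s) ∨ 2 * s < v.1) ∧ s ≤ v.2) ∨ 2 * s + 1 ≤ v.2)}

/-- The region between the core and the far sites. -/
def Moat (s : ℤ) : Set Site :=
  {v | -(400 * s) ≤ v.1 ∧ v.1 ≤ 400 * s ∧ 0 ≤ v.2 ∧ v.2 ≤ 2 * s ∧
    (v.1 < -s ∨ s < v.1 ∨ s < v.2) ∧ (v.2 < s ∨ (-(2 * s) ≤ v.1 ∧ v.1 ≤ 2 * s))}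

/-- The closed cluster of the far sites. -/
def FarClu (s : ℤ) (ω : Config) : Set Site := Clu (Far s) (Moat s ∩ st false ω)

/-- A set of sites together with its neighbours in the moat. -/
def Thick (s : ℤ) (K : Set Site) : Set Site := K ∪ {v | v ∈ Moat s ∧ ∃ w ∈ K, Adj w v}

/-- The cluster of the far sites neither touches the core nor extends sideways. -/
def Good (s : ℤ) (K : Set Site) : Prop :=
  (∀ w ∈ K, ∀ v, Adj w v → 0 ≤ v.2 ∧ (v.1 < -s ∨ s < v.1 ∨ s < v.2)) ∧
  (∀ w ∈ K, w.1 ≤ -(4 * s) + 1 → ∃ u ∈ Far s, Conn (K ∩ {v | v.1 < -(2 * s)}) w u) ∧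
  (∀ w ∈ K, 4 * s - 1 ≤ w.1 → ∃ u ∈ Far s, Conn (K ∩ {v | 2 * s < v.1}) w u)

/-- Open crossings separating the core from the far sites. -/
def Frame (s : ℤ) : Set Config :=
  Hz true (-(400 * s)) (-s - 1) 0 (s - 1) ∩ (Vt true (-(2 * s)) (-s - 1) 0 (2 * s) ∩
    (Hz true (-(2 * s)) (2 * s) (s + 1) (2 * s) ∩ (Vt true (s + 1) (2 * s) 0 (2 * s) ∩
      (Hz true (s + 1) (400 * s) 0 (s - 1) ∩ (Vt true (-(3 * s)) (-(2 * s) - 1) 0 (s - 1) ∩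
        Vt true (2 * s + 1) (3 * s) 0 (s - 1))))))

/-- Closed crossings: a horizontal one below the core and three vertical ones. -/
def Towers (s : ℤ) (c : Bool) : Set Config :=
  Hz c (-(400 * s)) (400 * s) (-s) (-1) ∩ (Vt c (-s) s (-(400 * s)) s ∩
    (Vt c (-(5 * s)) (-(4 * s)) (-(400 * s)) (s - 1) ∩
      Vt c (4 * s) (5 * s) (-(400 * s)) (s - 1)))

theorem far_finite (s : ℤ) : (Far s).Finite :=
  (rect_finite (-(400 * s)) (400 * s) (min s (2 * s + 1)) (2 * s + 1)).subset fun v hv => by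
    simp only [Far, Set.mem_ofPred_eq] at hv
    exact mem_rect.2 (by omega)

theorem moat_finite (s : ℤ) : (Moat s).Finite :=
  (rect_finite (-(400 * s)) (400 * s) 0 (2 * s)).subset fun v hv => by
    simp only [Moat, Set.mem_ofPred_eq] at hv
    exact mem_rect.2 (by omega)

theorem farClu_cases {s : ℤ} {ω : Config} {w : Site} (hw : w ∈ FarClu s ω) :
    w ∈ Far s ∨ w ∈ Moat s ∧ ω w = false :=
  clu_subset hw

section FrameGood

variable {s : ℤ} {ω : Config}

theorem frame_cross (hs : 1 ≤ s) (h : ω ∈ Frame s) :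
    ∃ u v : Site, u.1 ≤ -(400 * s) ∧ 400 * s ≤ v.1 ∧
      Conn {v | v ∈ Moat s ∧ v ∉ Far s ∧ ω v = true} u v := by
  obtain ⟨⟨u1, hu1, v1, hv1, h1⟩, ⟨u2, hu2, v2, hv2, h2⟩, ⟨u3, hu3, v3, hv3, h3⟩,
    ⟨u4, hu4, v4, hv4, h4⟩, ⟨u5, hu5, v5, hv5, h5⟩, -⟩ := h
  simp only [Set.mem_ofPred_eq] at hu1 hv1 hu2 hv2 hu3 hv3 hu4 hv4 hu5 hv5
  set Γ : Set Site := {v | v ∈ Moat s ∧ v ∉ Far s ∧ ω v = true}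
  have hΓ : ∀ (x0 x1 y0 y1 : ℤ) (u v : Site), (∀ v : Site, x0 ≤ v.1 → v.1 ≤ x1 → y0 ≤ v.2 → v.2 ≤ y1 →
      v ∈ Moat s ∧ v ∉ Far s) → Conn (rect x0 x1 y0 y1 ∩ st true ω) u v → Conn Γ u v := by
    intro x0 x1 y0 y1 u v h hc
    refine hc.mono fun w hw => ?_
    obtain ⟨a, b, c, d⟩ := mem_rect.1 hw.1
    obtain ⟨e, f⟩ := h w a b c d
    exact ⟨e, f, hw.2⟩
  obtain ⟨z1, a1, b1⟩ := conn_meet (x0 := -(2 * s)) (x1 := -s - 1) (y0 := 0) (y1 := s - 1) h1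
    (fun w hw => ⟨hw.1.2.2.1, hw.1.2.2.2⟩) (by omega) (by omega) h2
    (fun w hw => ⟨hw.1.1, hw.1.2.1⟩) (by omega) (by omega)
  obtain ⟨z2, a2, b2⟩ := conn_meet (x0 := -(2 * s)) (x1 := -s - 1) (y0 := s + 1) (y1 := 2 * s) h3
    (fun w hw => ⟨hw.1.2.2.1, hw.1.2.2.2⟩) (by omega) (by omega) h2
    (fun w hw => ⟨hw.1.1, hw.1.2.1⟩) (by omega) (by omega)
  obtain ⟨z3, a3, b3⟩ := conn_meet (x0 := s + 1) (x1 := 2 * s) (y0 := s + 1) (y1 := 2 * s) h3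
    (fun w hw => ⟨hw.1.2.2.1, hw.1.2.2.2⟩) (by omega) (by omega) h4
    (fun w hw => ⟨hw.1.1, hw.1.2.1⟩) (by omega) (by omega)
  obtain ⟨z4, a4, b4⟩ := conn_meet (x0 := s + 1) (x1 := 2 * s) (y0 := 0) (y1 := s - 1) h5
    (fun w hw => ⟨hw.1.2.2.1, hw.1.2.2.2⟩) (by omega) (by omega) h4
    (fun w hw => ⟨hw.1.1, hw.1.2.1⟩) (by omega) (by omega)
  have g1 := hΓ _ _ _ _ _ _ (fun v _ _ _ _ => by
    simp only [Moat, Far, Set.mem_ofPred_eq]; omega) a1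
  have g2 := hΓ _ _ _ _ _ _ (fun v _ _ _ _ => by
    simp only [Moat, Far, Set.mem_ofPred_eq]; omega) (b1.symm.trans b2)
  have g3 := hΓ _ _ _ _ _ _ (fun v _ _ _ _ => by
    simp only [Moat, Far, Set.mem_ofPred_eq]; omega) (a2.symm.trans a3)
  have g4 := hΓ _ _ _ _ _ _ (fun v _ _ _ _ => by
    simp only [Moat, Far, Set.mem_ofPred_eq]; omega) (b3.symm.trans b4)
  have g5 := hΓ _ _ _ _ _ _ (fun v _ _ _ _ => by
    simp only [Moat, Far, Set.mem_ofPred_eq]; omega) (a4.symm.trans h5)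
  exact ⟨u1, v5, hu1.le, hv5.ge, g1.trans (g2.trans (g3.trans (g4.trans g5)))⟩

theorem frame_good (hs : 1 ≤ s) (h : ω ∈ Frame s) : Good s (FarClu s ω) := by
  refine ⟨fun w hw v hwv => ?_, fun w hw hw1 => ?_, fun w hw hw1 => ?_⟩
  · by_contra hv
    obtain ⟨p, q, hp, hq, hpq⟩ := frame_cross hs h
    obtain ⟨u, hu, huw⟩ := clu_conn hw
    set T : Set Site := {z | -(400 * s) ≤ z.1 ∧ z.1 ≤ 400 * s ∧
      (z ∈ FarClu s ω ∨ z.2 < 0 ∨ (-s ≤ z.1 ∧ z.1 ≤ s ∧ z.2 ≤ s))}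
    have hfar : ∀ z ∈ FarClu s ω, -(400 * s) ≤ z.1 ∧ z.1 ≤ 400 * s ∧ 0 ≤ z.2 := by
      intro z hz
      rcases farClu_cases hz with h | ⟨h, -⟩ <;>
        simp only [Far, Moat, Set.mem_ofPred_eq] at h <;> omega
    have hFT : FarClu s ω ⊆ T := fun z hz => ⟨(hfar z hz).1, (hfar z hz).2.1, .inl hz⟩
    have c1 : Conn T u w := huw.mono hFT
    have c0 : Conn T (u.1, 2 * s + 1) u := by
      have hu' := hu
      simp only [Far, Set.mem_ofPred_eq] at hu'
      refine (conn_col (x := u.1) (y0 := u.2) (y1 := 2 * s + 1) (by omega) fun y _ _ => ?_).symm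
      refine hFT (subset_clu ?_)
      simp only [Far, Set.mem_ofPred_eq]
      omega
    have hw' := hfar w hw
    have hwv' := adj_iff.1 hwv
    have c2 : ∃ b : Site, b.2 ≤ 0 ∧ Conn T w b := by
      by_cases hv2 : v.2 < 0
      · exact ⟨w, by omega, .refl (hFT hw)⟩
      · refine ⟨(v.1, 0), le_rfl, Conn.head (hFT hw) hwv
          (conn_col (x := v.1) (y0 := 0) (y1 := v.2) (by omega) ?_).symm⟩
        intro y h1 h2
        refine ⟨?_, ?_, .inr (.inr ?_)⟩ <;> dsimp only <;> omega
    obtain ⟨b, hb, c3⟩ := c2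
    obtain ⟨z, z1, z2⟩ := conn_meet (x0 := -(400 * s)) (x1 := 400 * s) (y0 := 0) (y1 := 2 * s) hpq
      (fun z hz => by
        have h1 : z ∈ Moat s := hz.1
        simp only [Moat, Set.mem_ofPred_eq] at h1
        omega) hp hq ((c0.trans c1).trans c3).symm (fun z hz => ⟨hz.1, hz.2.1⟩) hb (by dsimp only; omega)
    obtain ⟨m1, m2, m3⟩ := z1.right_mem
    obtain ⟨-, -, hz⟩ := z2.right_mem
    rcases hz with hz | hz | hz
    · rcases farClu_cases hz with h | ⟨-, h⟩
      · exact m2 h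
      · rw [m3] at h; simp at h
    · simp only [Moat, Set.mem_ofPred_eq] at m1; omega
    · simp only [Moat, Set.mem_ofPred_eq] at m1; omega
  · by_cases hwF : w ∈ Far s
    · exact ⟨w, hwF, .refl ⟨hw, (show w.1 < -(2 * s) by omega)⟩⟩
    obtain ⟨u, hu, huw⟩ := clu_conn hw
    obtain ⟨a, b, h1, h2, h3, h4⟩ := huw.symm.first_hit (B := Far s ∪ {v | -(2 * s) ≤ v.1})
      (by rintro (h | h); exacts [hwF h, by simp only [Set.mem_ofPred_eq] at h; omega]) (.inl hu)
    have hlt : ∀ z ∈ FarClu s ω \ (Far s ∪ {v | -(2 * s) ≤ v.1}),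
        z.1 < -(2 * s) ∧ 0 ≤ z.2 ∧ z.2 ≤ s - 1 ∧ ω z = false := by
      rintro z ⟨hz, hz'⟩
      rcases farClu_cases hz with h | ⟨h, h'⟩
      · exact absurd (.inl h) hz'
      · have hx : ¬ -(2 * s) ≤ z.1 := fun h => hz' (.inr h)
        simp only [Moat, Set.mem_ofPred_eq] at h
        exact ⟨by omega, by omega, by omega, h'⟩
    by_cases hb : b.1 < -(2 * s)
    · refine ⟨b, h3.resolve_right fun h => absurd hb (not_lt.2 h), ?_⟩
      exact Conn.tail (h1.mono fun z hz => ⟨hz.1, (hlt z hz).1⟩) h2 ⟨h4, hb⟩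
    · exfalso
      obtain ⟨-, -, -, -, -, ⟨p, hp, q, hq, hpq⟩, -⟩ := h
      have ha := hlt a h1.right_mem
      have hab := adj_iff.1 h2
      obtain ⟨z, z1, z2⟩ := conn_meet (x0 := -(3 * s)) (x1 := -(2 * s) - 1) (y0 := 0) (y1 := s - 1) h1
        (fun z hz => ⟨(hlt z hz).2.1, (hlt z hz).2.2.1⟩) (by omega) (by omega) hpq
        (fun z hz => ⟨hz.1.1, hz.1.2.1⟩) hp.le hq.ge
      have e1 := (hlt z z1.right_mem).2.2.2
      have e2 : ω z = true := z2.right_mem.2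
      simp [e1] at e2
  · by_cases hwF : w ∈ Far s
    · exact ⟨w, hwF, .refl ⟨hw, (show 2 * s < w.1 by omega)⟩⟩
    obtain ⟨u, hu, huw⟩ := clu_conn hw
    obtain ⟨a, b, h1, h2, h3, h4⟩ := huw.symm.first_hit (B := Far s ∪ {v | v.1 ≤ 2 * s})
      (by rintro (h | h); exacts [hwF h, by simp only [Set.mem_ofPred_eq] at h; omega]) (.inl hu)
    have hlt : ∀ z ∈ FarClu s ω \ (Far s ∪ {v | v.1 ≤ 2 * s}),
        2 * s < z.1 ∧ 0 ≤ z.2 ∧ z.2 ≤ s - 1 ∧ ω z = false := by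
      rintro z ⟨hz, hz'⟩
      rcases farClu_cases hz with h | ⟨h, h'⟩
      · exact absurd (.inl h) hz'
      · have hx : ¬ z.1 ≤ 2 * s := fun h => hz' (.inr h)
        simp only [Moat, Set.mem_ofPred_eq] at h
        exact ⟨by omega, by omega, by omega, h'⟩
    by_cases hb : 2 * s < b.1
    · refine ⟨b, h3.resolve_right fun h => absurd hb (not_lt.2 h), ?_⟩
      exact Conn.tail (h1.mono fun z hz => ⟨hz.1, (hlt z hz).1⟩) h2 ⟨h4, hb⟩
    · exfalso
      obtain ⟨-, -, -, -, -, -, ⟨p, hp, q, hq, hpq⟩⟩ := h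
      have ha := hlt a h1.right_mem
      have hab := adj_iff.1 h2
      obtain ⟨z, z1, z2⟩ := conn_meet (x0 := 2 * s + 1) (x1 := 3 * s) (y0 := 0) (y1 := s - 1) h1.symm
        (fun z hz => ⟨(hlt z hz).2.1, (hlt z hz).2.2.1⟩) (by omega) (by omega) hpq
        (fun z hz => ⟨hz.1.1, hz.1.2.1⟩) hp.le hq.ge
      have e1 := (hlt z z1.right_mem).2.2.2
      have e2 : ω z = true := z2.right_mem.2
      simp [e1] at e2

end FrameGood


open Classical in
/-- The configuration in which all the sites of a set are made closed. -/
noncomputable def close (T : Set Site) (ω : Config) : Config := fun v => if v ∈ T then false else ω v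

theorem close_eq_false {T : Set Site} {ω : Config} {v : Site} :
    close T ω v = false ↔ v ∈ T ∨ ω v = false := by
  by_cases h : v ∈ T <;> simp [close, h]

/-- The closed cluster of the bottom of the large box. -/
def Ground (s : ℤ) (ω : Config) : Set Site :=
  BClu (-(400 * s)) (400 * s) (-(400 * s)) (2 * s + 1) ω

section Ground

variable {s : ℤ} {ω : Config}

theorem thick_cases {v : Site} (h : v ∈ Thick s (FarClu s ω)) : v ∈ Far s ∨ v ∈ Moat s := by
  rcases h with h | h
  · exact (farClu_cases h).imp_right And.left
  · exact .inr h.1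

theorem ground_step {v w : Site} (hv : v ∈ Ground s ω) (h : Adj v w) (hw : ω w = false)
    (hR : w ∈ rect (-(400 * s)) (400 * s) (-(400 * s)) (2 * s + 1)) : w ∈ Ground s ω :=
  clu_step hv h ⟨hR, hw⟩

theorem ground_conn {S : Set Site} {v w : Site} (hv : v ∈ Ground s ω) (h : Conn S v w)
    (hS : S ⊆ rect (-(400 * s)) (400 * s) (-(400 * s)) (2 * s + 1) ∩ cl ω) : w ∈ Ground s ω :=
  h.induction hv fun _ _ _ hab hb ih => clu_step ih hab (hS hb)

theorem ground_of_bottom {v : Site} (h0 : -(400 * s) ≤ v.1) (h1 : v.1 ≤ 400 * s)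
    (h2 : v.2 = -(400 * s)) (hs : 0 ≤ s) (hv : ω v = false) : v ∈ Ground s ω := by
  have hb : ((v.1, v.2 - 1) : Site) ∈ Bot (-(400 * s)) (400 * s) (-(400 * s)) :=
    mem_bot.2 (by dsimp only; omega)
  have ha : Adj ((v.1, v.2 - 1) : Site) v := adj_iff.2 (by dsimp only; omega)
  exact clu_step (subset_clu hb) ha ⟨mem_rect.2 (by omega), hv⟩

theorem ground_subset (hs : 0 ≤ s) {v : Site} (hv : v ∈ Ground s ω) :
    -(400 * s) ≤ v.1 ∧ v.1 ≤ 400 * s ∧ -(400 * s) - 1 ≤ v.2 ∧ v.2 ≤ 2 * s + 1 :=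
  mem_rect.1 (botClu_subset Set.inter_subset_left (by omega) hv)

theorem ground_closed {v : Site} (hv : v ∈ Ground s ω) (h : -(400 * s) ≤ v.2) : ω v = false := by
  rcases clu_subset hv with h' | h'
  · have := mem_bot.1 h'; omega
  · exact h'.2

theorem ground_notMem_thick (hs : 1 ≤ s) (hg : Good s (FarClu s ω)) {v : Site}
    (hv : v ∈ Ground s ω) : v ∉ Thick s (FarClu s ω) := by
  have hrow : ∀ v ∈ Thick s (FarClu s ω), 0 ≤ v.2 := by
    intro v hv
    rcases thick_cases hv with h | h <;> simp only [Far, Moat, Set.mem_ofPred_eq] at h <;> omega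
  obtain ⟨u, hu, huv⟩ := hv
  refine huv.induction (fun h => ?_) fun a b ha hab hb ih hbT => ?_
  · have h1 := hrow u h
    have h2 := mem_bot.1 hu
    omega
  · have hb0 := hrow b hbT
    rcases hb with hb | ⟨hbR, hbc⟩
    · have h2 := mem_bot.1 hb
      omega
    have hbW : b ∈ FarClu s ω := by
      rcases hbT with h | ⟨h, w, hw, hwb⟩
      · exact h
      · exact clu_step hw hwb ⟨h, hbc⟩
    obtain ⟨h1, h2⟩ := hg.1 b hbW a hab.symm
    rcases ha.right_mem with ha | ⟨haR, hac⟩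
    · have h3 := mem_bot.1 ha
      omega
    have haR := mem_rect.1 haR
    refine ih (.inl ?_)
    by_cases haF : a ∈ Far s
    · exact subset_clu haF
    · refine clu_step hbW hab.symm ⟨?_, hac⟩
      simp only [Far, Moat, Set.mem_ofPred_eq] at haF ⊢
      omega

/-- A highest site of the ground cluster, reached inside a narrow strip. -/
structure Summit (s : ℤ) (ω : Config) (d : Site) : Prop where
  left : -(2 * s) ≤ d.1
  right : d.1 ≤ 2 * s
  low : s ≤ d.2
  high : d.2 ≤ 2 * s
  mem : d ∈ Ground s ω
  max : ∀ v ∈ Ground s ω, v.2 ≤ d.2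
  strip : ∃ u : Site, u.2 = -(400 * s) ∧ Conn (rect (-(5 * s)) (5 * s) (-(400 * s)) d.2 ∩ cl ω) u d
  base : ∃ u v : Site, u.1 = -(400 * s) ∧ v.1 = 400 * s ∧
    Conn (rect (-(400 * s)) (400 * s) (-s) (-1) ∩ Ground s ω) u v

theorem towers_real {x0 x1 y0 y1 : ℤ} {u v : Site}
    (h : ∀ v ∈ rect x0 x1 y0 y1, v ∉ Far s ∧ v ∉ Moat s)
    (hc : Conn (rect x0 x1 y0 y1 ∩ st false (close (Thick s (FarClu s ω)) ω)) u v) :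
    Conn (rect x0 x1 y0 y1 ∩ cl ω) u v := by
  refine hc.mono ?_
  rintro w ⟨h1, h2⟩
  refine ⟨h1, ?_⟩
  rcases close_eq_false.1 h2 with h3 | h3
  · exact absurd (thick_cases h3) (by have := h w h1; tauto)
  · exact h3

/-- From a site of the thickened far cluster one reaches a vertical side of the large box. -/
theorem thick_to_left (hs : 1 ≤ s) (hg : Good s (FarClu s ω)) {z : Site}
    (hz : z ∈ Thick s (FarClu s ω)) (hz1 : z.1 ≤ -(4 * s)) :
    ∃ p : Site, p.1 ≤ -(400 * s) ∧
      Conn {v | v ∈ Thick s (FarClu s ω) ∧ v.1 < -(2 * s)} p z := by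
  have hW : ∃ w ∈ FarClu s ω, w.1 ≤ -(4 * s) + 1 ∧
      Conn {v | v ∈ Thick s (FarClu s ω) ∧ v.1 < -(2 * s)} w z := by
    rcases id hz with h | ⟨h, w, hw, hwz⟩
    · exact ⟨z, h, by omega, .refl ⟨.inl h, by omega⟩⟩
    · have := adj_iff.1 hwz
      exact ⟨w, hw, by omega, .single ⟨.inl hw, by omega⟩ ⟨hz, by omega⟩ hwz⟩
  obtain ⟨w, hw, hw1, hwz⟩ := hW
  obtain ⟨u, hu, hwu⟩ := hg.2.1 w hw hw1
  have huF := hu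
  simp only [Far, Set.mem_ofPred_eq] at huF
  have hu1 : u.1 < -(2 * s) := hwu.right_mem.2
  have huw : Conn {v | v ∈ Thick s (FarClu s ω) ∧ v.1 < -(2 * s)} u w :=
    hwu.symm.mono fun v hv => ⟨.inl hv.1, hv.2⟩
  refine ⟨(-(400 * s), u.2), le_rfl, Conn.trans ?_ (huw.trans hwz)⟩
  refine conn_row (x0 := -(400 * s)) (x1 := u.1) (y := u.2) (by omega) fun x _ _ =>
    ⟨.inl (subset_clu ?_), (show x < -(2 * s) by omega)⟩
  simp only [Far, Set.mem_ofPred_eq]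
  omega

theorem thick_to_right (hs : 1 ≤ s) (hg : Good s (FarClu s ω)) {z : Site}
    (hz : z ∈ Thick s (FarClu s ω)) (hz1 : 4 * s ≤ z.1) :
    ∃ p : Site, 400 * s ≤ p.1 ∧
      Conn {v | v ∈ Thick s (FarClu s ω) ∧ 2 * s < v.1} z p := by
  have hW : ∃ w ∈ FarClu s ω, 4 * s - 1 ≤ w.1 ∧
      Conn {v | v ∈ Thick s (FarClu s ω) ∧ 2 * s < v.1} z w := by
    rcases id hz with h | ⟨h, w, hw, hwz⟩
    · exact ⟨z, h, by omega, .refl ⟨.inl h, by omega⟩⟩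
    · have := adj_iff.1 hwz
      exact ⟨w, hw, by omega, .single ⟨hz, by omega⟩ ⟨.inl hw, by omega⟩ hwz.symm⟩
  obtain ⟨w, hw, hw1, hwz⟩ := hW
  obtain ⟨u, hu, hwu⟩ := hg.2.2 w hw hw1
  have huF := hu
  simp only [Far, Set.mem_ofPred_eq] at huF
  have hu1 : 2 * s < u.1 := hwu.right_mem.2
  have hwu' : Conn {v | v ∈ Thick s (FarClu s ω) ∧ 2 * s < v.1} w u :=
    hwu.mono fun v hv => ⟨.inl hv.1, hv.2⟩
  refine ⟨(400 * s, u.2), le_rfl, hwz.trans (hwu'.trans ?_)⟩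
  refine conn_row (x0 := u.1) (x1 := 400 * s) (y := u.2) (by omega) fun x _ _ =>
    ⟨.inl (subset_clu ?_), (show 2 * s < x by omega)⟩
  simp only [Far, Set.mem_ofPred_eq]
  omega

/-- An open crossing of the strip meets the thickened far cluster above each outer tower. -/
theorem tower_meet {x0 x1 j : ℤ} (hj : s ≤ j) (hj' : j ≤ 2 * s) (hx : 2 * s < x0 ∨ x1 < -(2 * s))
    (hx0 : -(400 * s) ≤ x0) (hx1 : x1 ≤ 400 * s)
    (ht : close (Thick s (FarClu s ω)) ω ∈ Vt false x0 x1 (-(400 * s)) (s - 1)) {S : Set Site} {u v : Site}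
    (hS : Conn S u v) (hSy : ∀ w ∈ S, -(400 * s) ≤ w.2 ∧ w.2 ≤ j) (hSo : ∀ w ∈ S, ω w = true)
    (hu : u.1 ≤ x0) (hv : x1 ≤ v.1) :
    ∃ z, Conn S u z ∧ x0 ≤ z.1 ∧ z.1 ≤ x1 ∧ z ∈ Thick s (FarClu s ω) := by
  obtain ⟨a, ha, b, hb, hab⟩ := ht
  have ha : a.2 = -(400 * s) := ha
  have hb : b.2 = s - 1 := hb
  have hb1 := mem_rect.1 hab.right_mem.1
  set T : Set Site := {w | x0 ≤ w.1 ∧ w.1 ≤ x1 ∧ (w ∈ Thick s (FarClu s ω) ∨ ω w = false)}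
  have c1 : Conn T a b := by
    refine hab.mono ?_
    rintro w ⟨h1, h2⟩
    have h1 := mem_rect.1 h1
    exact ⟨h1.1, h1.2.1, close_eq_false.1 h2⟩
  have c2 : Conn T b (b.1, j) := by
    refine conn_col (x := b.1) (y0 := b.2) (y1 := j) (by omega) fun y h1 h2 => ?_
    rcases eq_or_lt_of_le h1 with h | h
    · subst h; exact c1.right_mem
    · refine ⟨hb1.1, hb1.2.1, .inl (.inl (subset_clu ?_))⟩
      simp only [Far, Set.mem_ofPred_eq]
      omega
  obtain ⟨z, z1, z2⟩ := conn_meet (x0 := x0) (x1 := x1) (y0 := -(400 * s)) (y1 := j) hS hSy hu hv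
    (c1.trans c2) (fun w hw => ⟨hw.1, hw.2.1⟩) ha.le le_rfl
  obtain ⟨h1, h2, h3⟩ := z2.right_mem
  refine ⟨z, z1, h1, h2, h3.resolve_right ?_⟩
  rw [hSo z z1.right_mem]
  simp

theorem exists_summit (hs : 1 ≤ s) (hg : Good s (FarClu s ω))
    (ht : close (Thick s (FarClu s ω)) ω ∈ Towers s false) : ∃ d, Summit s ω d := by
  obtain ⟨⟨p, hp, q, hq, hpq⟩, ⟨a, ha, b, hb, hab⟩, tl, tr⟩ := ht
  have hp : p.1 = -(400 * s) := hp
  have hq : q.1 = 400 * s := hq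
  have ha : a.2 = -(400 * s) := ha
  have hb : b.2 = s := hb
  replace hpq := towers_real (fun v hv => by
    have hv := mem_rect.1 hv
    simp only [Far, Moat, Set.mem_ofPred_eq]; omega) hpq
  replace hab := towers_real (fun v hv => by
    have hv := mem_rect.1 hv
    simp only [Far, Moat, Set.mem_ofPred_eq]; omega) hab
  have haR := mem_rect.1 hab.left_mem.1
  have haD : a ∈ Ground s ω :=
    ground_of_bottom (by omega) (by omega) ha (by omega) hab.left_mem.2
  have hsubV : rect (-s) s (-(400 * s)) s ∩ cl ω ⊆
      rect (-(400 * s)) (400 * s) (-(400 * s)) (2 * s + 1) ∩ cl ω := by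
    rintro w ⟨h1, h2⟩
    have h1 := mem_rect.1 h1
    exact ⟨mem_rect.2 (by omega), h2⟩
  have hsubH : rect (-(400 * s)) (400 * s) (-s) (-1) ∩ cl ω ⊆
      rect (-(400 * s)) (400 * s) (-(400 * s)) (2 * s + 1) ∩ cl ω := by
    rintro w ⟨h1, h2⟩
    have h1 := mem_rect.1 h1
    exact ⟨mem_rect.2 (by omega), h2⟩
  have hbD : b ∈ Ground s ω := ground_conn haD hab hsubV
  obtain ⟨z, z1, z2⟩ := conn_meet (x0 := -s) (x1 := s) (y0 := -s) (y1 := -1) hpq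
    (fun w hw => ⟨hw.1.2.2.1, hw.1.2.2.2⟩) (by omega) (by omega) hab
    (fun w hw => ⟨hw.1.1, hw.1.2.1⟩) (by omega) (by omega)
  have hzD : z ∈ Ground s ω := ground_conn haD z2 hsubV
  have hbase : Conn (rect (-(400 * s)) (400 * s) (-s) (-1) ∩ Ground s ω) p q := by
    refine hpq.component.mono fun w hw => ⟨(Conn.right_mem hw).1, ?_⟩
    exact ground_conn hzD (z1.symm.trans hw) hsubH
  have hfar : ∀ v ∈ Ground s ω, v ∉ Far s := fun v hv h =>
    ground_notMem_thick hs hg hv (.inl (subset_clu h))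
  have htop : ∀ v ∈ Ground s ω, v.2 ≤ 2 * s := by
    intro v hv
    have h1 := ground_subset (by omega) hv
    have h2 := hfar v hv
    simp only [Far, Set.mem_ofPred_eq] at h2
    omega
  obtain ⟨j, ⟨d0, hd0, hdj⟩, hmax⟩ := Int.exists_greatest_of_bdd
    (P := fun j => ∃ v ∈ Ground s ω, v.2 = j) ⟨2 * s, by rintro _ ⟨v, hv, rfl⟩; exact htop v hv⟩
    ⟨b.2, b, hbD, rfl⟩
  have hmax' : ∀ v ∈ Ground s ω, v.2 ≤ j := fun v hv => hmax _ ⟨v, hv, rfl⟩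
  have hjs : s ≤ j := hb ▸ hmax' b hbD
  have hj2 : j ≤ 2 * s := hdj ▸ htop d0 hd0
  have hrow : ∀ v ∈ Ground s ω, s ≤ v.2 → -(2 * s) ≤ v.1 ∧ v.1 ≤ 2 * s := by
    intro v hv h
    have h1 := ground_subset (by omega) hv
    have h2 := hfar v hv
    simp only [Far, Set.mem_ofPred_eq] at h2
    omega
  suffices h : ∃ u v : Site, u.2 = -(400 * s) ∧ v.2 = j ∧
      Conn (rect (-(5 * s)) (5 * s) (-(400 * s)) j ∩ cl ω) u v by
    obtain ⟨u, v, hu, hv, huv⟩ := h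
    have huR := mem_rect.1 huv.left_mem.1
    have hvD : v ∈ Ground s ω := by
      refine ground_conn (ground_of_bottom (by omega) (by omega) hu (by omega) huv.left_mem.2) huv ?_
      rintro w ⟨h1, h2⟩
      have h1 := mem_rect.1 h1
      exact ⟨mem_rect.2 (by omega), h2⟩
    have hvr := hrow v hvD (by omega)
    exact ⟨v, hvr.1, hvr.2, by omega, by omega, hvD, fun w hw => (hmax' w hw).trans hv.ge,
      ⟨u, hu, by rw [hv]; exact huv⟩, ⟨p, q, hp, hq, hbase⟩⟩
  rcases cross_or (x0 := -(5 * s)) (x1 := 5 * s) (y0 := -(400 * s)) (y1 := j) (op ω)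
    (by omega) (by omega) with ⟨a', b', h⟩ | ⟨a', b', h⟩
  swap
  · exact ⟨_, _, rfl, rfl, h.mono fun w hw => ⟨hw.1, not_not.1 fun h => hw.2 (mem_op_iff.2 h)⟩⟩
  exfalso
  have hβy : ∀ w ∈ rect (-(5 * s)) (5 * s) (-(400 * s)) j ∩ op ω, -(400 * s) ≤ w.2 ∧ w.2 ≤ j :=
    fun w hw => ⟨hw.1.2.2.1, hw.1.2.2.2⟩
  obtain ⟨zl, l1, l2, l3, l4⟩ := tower_meet hjs hj2 (.inr (by omega)) (by omega) (by omega) tl h hβy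
    (fun w hw => hw.2) (by dsimp only; omega) (by dsimp only; omega)
  obtain ⟨zr, r1, r2, r3, r4⟩ := tower_meet hjs hj2 (.inl (by omega)) (by omega) (by omega) tr h hβy
    (fun w hw => hw.2) (by dsimp only; omega) (by dsimp only; omega)
  obtain ⟨pl, hpl, cl'⟩ := thick_to_left hs hg l4 (by omega)
  obtain ⟨pr, hpr, cr⟩ := thick_to_right hs hg r4 (by omega)
  set S : Set Site := {v | v ∉ Ground s ω ∧ -(400 * s) ≤ v.2 ∧ v.2 ≤ 2 * s + 1 ∧
    (v.1 < -(2 * s) ∨ 2 * s < v.1 ∨ v.2 ≤ j)}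
  have hTS : ∀ v ∈ Thick s (FarClu s ω), v ∉ Ground s ω ∧ -(400 * s) ≤ v.2 ∧ v.2 ≤ 2 * s + 1 := by
    intro v hv
    refine ⟨fun h => ground_notMem_thick hs hg h hv, ?_⟩
    rcases thick_cases hv with h | h <;> simp only [Far, Moat, Set.mem_ofPred_eq] at h <;> omega
  have hc : Conn S pl pr := by
    refine (cl'.mono fun v hv => ?_).trans ((Conn.mono (fun v hv => ?_) (l1.symm.trans r1)).trans
      (cr.mono fun v hv => ?_))
    · obtain ⟨h1, h2, h3⟩ := hTS v hv.1
      exact ⟨h1, h2, h3, .inl hv.2⟩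
    · have h1 := mem_rect.1 hv.1
      refine ⟨fun h => ?_, by omega, by omega, by omega⟩
      have h2 := ground_closed h (by omega)
      have h3 : ω v = true := hv.2
      simp [h2] at h3
    · obtain ⟨h1, h2, h3⟩ := hTS v hv.1
      exact ⟨h1, h2, h3, .inr (.inl hv.2)⟩
  obtain ⟨e, he, hed⟩ := clu_conn hd0
  have he := mem_bot.1 he
  have hd0r := hrow d0 hd0 (by omega)
  set T : Set Site := Ground s ω ∪ {v | v.1 = d0.1 ∧ j < v.2}
  have hT : Conn T e (d0.1, 2 * s + 1) := by
    refine (hed.mono (Set.subset_union_left (s := Ground s ω))).trans ?_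
    refine conn_col (x := d0.1) (y0 := d0.2) (y1 := 2 * s + 1) (by omega) fun y h1 h2 => ?_
    rcases eq_or_lt_of_le h1 with h | h
    · subst h; exact .inl hd0
    · exact .inr ⟨rfl, (show j < y by omega)⟩
  obtain ⟨z, z1, z2⟩ := conn_meet (x0 := -(400 * s)) (x1 := 400 * s) (y0 := -(400 * s))
    (y1 := 2 * s + 1) hc (fun w hw => ⟨hw.2.1, hw.2.2.1⟩) hpl hpr hT (by
      rintro w (hw | ⟨hw, -⟩)
      · have := ground_subset (by omega) hw; omega
      · omega) (by omega) le_rfl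
  obtain ⟨s1, s2, s3, s4⟩ := z1.right_mem
  rcases z2.right_mem with h | ⟨h1, h2⟩
  · exact s1 h
  · omega

end Ground


/-- Changing the states of a few sites above a summit turns it into a peak. -/
theorem peak_of_summit {s a b h t : ℤ} {ω ω' : Config} {d : Site} (hs : 3 ≤ s)
    (hd : Summit s ω (d.1, d.2 - 1)) (ha : 50 * s - 1 ≤ a) (ha' : a ≤ 300 * s + 1)
    (hb : 50 * s - 1 ≤ b) (hb' : b ≤ 300 * s + 1) (hh : 50 * s - 1 ≤ h) (hh' : h ≤ 300 * s + 1)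
    (ht : 0 ≤ t) (h0 : ω' d = false) (h1 : ω' (d.1 + 1, d.2) = true) (h2 : ω' (d.1 - 1, d.2) = true)
    (h3 : ω' (d.1, d.2 + 1) = true) (h4 : ω' (d.1 - 1, d.2 + 1) = true)
    (hω : ∀ v, v ≠ d → v ≠ (d.1 + 1, d.2) → v ≠ (d.1 - 1, d.2) → v ≠ (d.1, d.2 + 1) →
      v ≠ (d.1 - 1, d.2 + 1) → ω' v = ω v) :
    Peak (d.1 - a) (d.1 + b) (d.2 - h) (d.2 + t) d ω' := by
  obtain ⟨hl, hr, hlow, hhigh, hmem, hmax, ⟨u, hu, hud⟩, ⟨p, q, hp, hq, hpq⟩⟩ := hd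
  dsimp only at hl hr hlow hhigh hmax hud
  have hω' : ∀ v : Site, v.2 ≤ d.2 - 1 → ω' v = ω v := by
    intro v hv
    apply hω <;> rintro rfl <;> simp at hv
  have hdR : d ∈ rect (d.1 - a) (d.1 + b) (d.2 - h) (d.2 + t) := mem_rect.2 (by omega)
  constructor
  · obtain ⟨v, hv, hvd⟩ : ∃ v : Site, v.2 = d.2 - h ∧
        Conn (rect (d.1 - a) (d.1 + b) (d.2 - h) (d.2 + t) ∩ cl ω') v (d.1, d.2 - 1) := by
      have hsub : rect (-(5 * s)) (5 * s) (-(400 * s)) (d.2 - 1) ∩ cl ω ∩ {v | d.2 - h ≤ v.2} ⊆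
          rect (d.1 - a) (d.1 + b) (d.2 - h) (d.2 + t) ∩ cl ω' := by
        rintro w ⟨⟨w1, w2⟩, w3⟩
        have w1 := mem_rect.1 w1
        have w3 : d.2 - h ≤ w.2 := w3
        exact ⟨mem_rect.2 (by omega), (hω' w (by omega)).trans w2⟩
      by_cases hu' : d.2 - h ≤ u.2
      · refine ⟨u, by omega, hud.mono fun w hw => hsub ⟨hw, ?_⟩⟩
        have hw1 := mem_rect.1 hw.1
        exact (show d.2 - h ≤ w.2 by omega)
      obtain ⟨x, y, e1, e2, e3, -⟩ := hud.symm.first_exit (A := {v | d.2 - h ≤ v.2})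
        (show d.2 - h ≤ d.2 - 1 by omega) hu'
      have e4 : d.2 - h ≤ x.2 := e1.right_mem.2
      have e3 : ¬ d.2 - h ≤ y.2 := e3
      have e2 := adj_iff.1 e2
      exact ⟨x, by omega, (e1.mono hsub).symm⟩
    have hvR := mem_rect.1 hvd.left_mem.1
    have c0 : ((v.1, v.2 - 1) : Site) ∈ Bot (d.1 - a) (d.1 + b) (d.2 - h) :=
      mem_bot.2 (by dsimp only; omega)
    have c1 : v ∈ BClu (d.1 - a) (d.1 + b) (d.2 - h) (d.2 + t) ω' :=
      clu_step (subset_clu c0) (adj_iff.2 (by dsimp only; omega)) hvd.left_mem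
    have c2 : ((d.1, d.2 - 1) : Site) ∈ BClu (d.1 - a) (d.1 + b) (d.2 - h) (d.2 + t) ω' :=
      hvd.induction c1 fun _ _ _ hxy hy ih => clu_step ih hxy hy
    exact clu_step c2 (adj_iff.2 (by dsimp only; omega)) ⟨hdR, h0⟩
  · intro v hv hne
    rcases lt_or_ge v.2 0 with hv0 | hv0
    · omega
    obtain ⟨w, hw, hwv⟩ := vcross_of_botClu (by omega) hv
    obtain ⟨z, z1, z2⟩ := conn_meet (x0 := -(400 * s)) (x1 := 400 * s) (y0 := -s) (y1 := -1) hpq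
      (fun w hw => ⟨hw.1.2.2.1, hw.1.2.2.2⟩) (by omega) (by omega) hwv
      (by rintro x ⟨hx, -⟩; have := mem_rect.1 hx; omega) (by omega) (by omega)
    have key : ∀ x, Conn (rect (d.1 - a) (d.1 + b) (d.2 - h) (d.2 + t) ∩ cl ω') z x →
        x ∈ Ground s ω ∨ x = d := by
      intro x hx
      refine hx.induction (P := fun x => x ∈ Ground s ω ∨ x = d) (.inl z1.right_mem.2) ?_
      rintro x y - hxy ⟨hyR, hyc⟩ ih
      have hyR := mem_rect.1 hyR
      have hyc : ω' y = false := hyc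
      by_cases hyd : y = d
      · exact .inr hyd
      have hn : ∀ y', ω' y' = true → y ≠ y' := by rintro y' h rfl; simp [hyc] at h
      have hyω : ω y = false := by
        rw [← hω y hyd (hn _ h1) (hn _ h2) (hn _ h3) (hn _ h4)]; exact hyc
      left
      rcases ih with ih | rfl
      · have h5 := hmax x ih
        have h6 := adj_iff.1 hxy
        exact ground_step ih hxy hyω (mem_rect.2 (by omega))
      · have h6 := adj_iff.1 hxy
        have hn : ∀ i j : ℤ, ω' (i, j) = true → ¬ (y.1 = i ∧ y.2 = j) :=
          fun i j h e => hn _ h (Prod.ext e.1 e.2)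
        have hstep : y.2 = x.2 - 1 ∧ (y.1 = x.1 ∨ y.1 = x.1 + 1) := by
          rcases h6 with h | h | h | h | h | h
          · exact absurd h (hn _ _ h1)
          · exact absurd h (hn _ _ h2)
          · exact absurd h (hn _ _ h3)
          · exact ⟨h.2, .inl h.1⟩
          · exact ⟨h.2, .inr h.1⟩
          · exact absurd h (hn _ _ h4)
        obtain ⟨hy2, hy | hy⟩ := hstep
        · have : y = (x.1, x.2 - 1) := Prod.ext hy hy2
          rw [this]; exact hmem
        · have had : Adj ((x.1, x.2 - 1) : Site) y := adj_iff.2 (by dsimp only; omega)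
          exact ground_step hmem had hyω (mem_rect.2 ⟨by omega, by omega, by omega, by omega⟩)
    rcases key v (z2.symm.trans hwv) with h5 | h5
    · have := hmax v h5
      omega
    · exact absurd h5 hne


theorem close_mem_lnk {T S A B : Set Site} {ω : Config} (h : ω ∈ Lnk false S A B) :
    close T ω ∈ Lnk false S A B := by
  obtain ⟨u, hu, v, hv, huv⟩ := h
  exact ⟨u, hu, v, hv, huv.mono fun z hz => ⟨hz.1, close_eq_false.2 (.inr hz.2)⟩⟩

theorem close_mem_towers {s : ℤ} {T : Set Site} {ω : Config} (h : ω ∈ Towers s false) :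
    close T ω ∈ Towers s false :=
  ⟨close_mem_lnk h.1, close_mem_lnk h.2.1, close_mem_lnk h.2.2.1, close_mem_lnk h.2.2.2⟩

theorem towers_loc (s : ℤ) (c : Bool) : Loc (Towers s c) :=
  hz_loc.inter (vt_loc.inter (vt_loc.inter vt_loc))

section Prob

variable {μ : Measure Config}

theorem frame_towers_prob (hμ : IsBernoulliHalf μ) : ∃ q > 0, ∀ s : ℤ, 3 ≤ s →
    q ≤ μ.real (Frame s) ∧ q ≤ μ.real (Towers s false) := by
  obtain ⟨p, hp, hH⟩ := rsw_hz hμ 1300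
  obtain ⟨p', hp', hV⟩ := rsw_vt hμ 1300
  refine ⟨min (p * (p' * (p * (p' * (p * (p' * p')))))) (p * (p' * (p' * p'))),
    lt_min (by positivity) (by positivity), fun s hs => ⟨(min_le_left _ _).trans ?_,
    (min_le_right _ _).trans ?_⟩⟩
  · have hH' : ∀ x0 x1 y0 y1 : ℤ, x0 ≤ x1 → x1 - x0 ≤ 1300 * (s - 1) → s - 1 ≤ y1 - y0 →
        p ≤ μ.real (Hz true x0 x1 y0 y1) := fun x0 x1 y0 y1 h1 h2 h3 =>
      hH (s - 1) (by omega) true x0 x1 y0 y1 h1 (by push_cast; omega) h3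
    have hV' : ∀ x0 x1 y0 y1 : ℤ, y0 ≤ y1 → y1 - y0 ≤ 1300 * (s - 1) → s - 1 ≤ x1 - x0 →
        p' ≤ μ.real (Vt true x0 x1 y0 y1) := fun x0 x1 y0 y1 h1 h2 h3 =>
      hV (s - 1) (by omega) true x0 x1 y0 y1 h1 (by push_cast; omega) h3
    refine Loc.fkg_le hμ hz_loc (vt_loc.inter (hz_loc.inter (vt_loc.inter (hz_loc.inter
      (vt_loc.inter vt_loc))))) hz_inc (vt_inc.inter (hz_inc.inter (vt_inc.inter (hz_inc.inter
      (vt_inc.inter vt_inc))))) (by positivity) (hH' _ _ _ _ (by omega) (by omega) (by omega)) ?_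
    refine Loc.fkg_le hμ vt_loc (hz_loc.inter (vt_loc.inter (hz_loc.inter
      (vt_loc.inter vt_loc)))) vt_inc (hz_inc.inter (vt_inc.inter (hz_inc.inter
      (vt_inc.inter vt_inc)))) (by positivity) (hV' _ _ _ _ (by omega) (by omega) (by omega)) ?_
    refine Loc.fkg_le hμ hz_loc (vt_loc.inter (hz_loc.inter (vt_loc.inter vt_loc))) hz_inc
      (vt_inc.inter (hz_inc.inter (vt_inc.inter vt_inc))) (by positivity)
      (hH' _ _ _ _ (by omega) (by omega) (by omega)) ?_
    refine Loc.fkg_le hμ vt_loc (hz_loc.inter (vt_loc.inter vt_loc)) vt_inc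
      (hz_inc.inter (vt_inc.inter vt_inc)) (by positivity)
      (hV' _ _ _ _ (by omega) (by omega) (by omega)) ?_
    refine Loc.fkg_le hμ hz_loc (vt_loc.inter vt_loc) hz_inc (vt_inc.inter vt_inc) (by positivity)
      (hH' _ _ _ _ (by omega) (by omega) (by omega)) ?_
    exact Loc.fkg_le hμ vt_loc vt_loc vt_inc vt_inc hp'.le
      (hV' _ _ _ _ (by omega) (by omega) (by omega))
      (hV' _ _ _ _ (by omega) (by omega) (by omega))
  · have hV' : ∀ x0 x1 y0 y1 : ℤ, y0 ≤ y1 → y1 - y0 ≤ 1300 * (s - 1) → s - 1 ≤ x1 - x0 →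
        p' ≤ μ.real (Vt true x0 x1 y0 y1) := fun x0 x1 y0 y1 h1 h2 h3 =>
      hV (s - 1) (by omega) true x0 x1 y0 y1 h1 (by push_cast; omega) h3
    have h : p * (p' * (p' * p')) ≤ μ.real (Towers s true) := by
      refine Loc.fkg_le hμ hz_loc (vt_loc.inter (vt_loc.inter vt_loc)) hz_inc
        (vt_inc.inter (vt_inc.inter vt_inc)) (by positivity)
        (hH (s - 1) (by omega) true _ _ _ _ (by omega) (by push_cast; omega) (by omega)) ?_
      refine Loc.fkg_le hμ vt_loc (vt_loc.inter vt_loc) vt_inc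
        (vt_inc.inter vt_inc) (by positivity) (hV' _ _ _ _ (by omega) (by omega) (by omega)) ?_
      exact Loc.fkg_le hμ vt_loc vt_loc vt_inc vt_inc hp'.le
        (hV' _ _ _ _ (by omega) (by omega) (by omega))
        (hV' _ _ _ _ (by omega) (by omega) (by omega))
    refine h.trans (le_of_eq ?_)
    rw [← prob_flip hμ (towers_loc s true)]
    congr 1
    ext ω
    exact and_congr flip_mem_lnk (and_congr flip_mem_lnk (and_congr flip_mem_lnk flip_mem_lnk))

/-- With probability bounded below there is a summit. -/
theorem prob_summit (hμ : IsBernoulliHalf μ) : ∃ q > 0, ∀ s : ℤ, 3 ≤ s →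
    q ≤ μ.real {ω | ∃ d, Summit s ω d} := by
  classical
  obtain ⟨q, hq, h⟩ := frame_towers_prob hμ
  refine ⟨q * q, by positivity, fun s hs => ?_⟩
  obtain ⟨h1, h2⟩ := h s hs
  have key := prob_reveal_clu hμ false (far_finite s) (moat_finite s) (Good s)
    (fun K => {ω | close (Thick s K) ω ∈ Towers s false}) (p := q) (fun ω hω => by
      change ∃ T : Finset Site, Dep T {ω' | close (Thick s (FarClu s ω)) ω' ∈ Towers s false} ∧
        (∀ v ∈ T, v ∈ Moat s → v ∉ FarClu s ω ∧ ∀ w ∈ FarClu s ω, ¬ Adj w v) ∧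
        q ≤ μ.real {ω' | close (Thick s (FarClu s ω)) ω' ∈ Towers s false}
      obtain ⟨S, hS⟩ := towers_loc s false
      refine ⟨S.filter (· ∉ Thick s (FarClu s ω)), ?_, ?_, ?_⟩
      · intro ω1 ω2 h12
        refine hS _ _ fun v hv => ?_
        by_cases hvT : v ∈ Thick s (FarClu s ω)
        · simp [close, hvT]
        · simp [close, hvT, h12 v (Finset.mem_filter.2 ⟨hv, hvT⟩)]
      · intro v hv hvM
        have hvT := (Finset.mem_filter.1 hv).2
        exact ⟨fun h => hvT (.inl h), fun w hw hwv => hvT (.inr ⟨hvM, w, hw, hwv⟩)⟩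
      · exact h2.trans (prob_mono hμ fun ω' h => close_mem_towers h))
  refine le_trans ?_ (key.trans (prob_mono hμ ?_))
  · refine mul_le_mul_of_nonneg_left (h1.trans (prob_mono hμ ?_)) hq.le
    exact fun ω hω => frame_good (by omega) hω
  · rintro ω ⟨h3, h4⟩
    exact exists_summit (by omega) h3 h4

end Prob

/-! ### Translation invariance of peaks -/

theorem peak_loc (x0 x1 y0 y1 : ℤ) (d : Site) : Loc {ω | Peak x0 x1 y0 y1 d ω} := by
  refine .of_conn (rect_finite x0 x1 y0 y1) fun ω ω' h hω => ?_
  have : BClu x0 x1 y0 y1 ω' = BClu x0 x1 y0 y1 ω := by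
    unfold BClu
    congr 1
    ext v
    refine and_congr_right fun hv => ?_
    simp only [cl, Set.mem_ofPred_eq, h v hv]
  simpa only [Set.mem_ofPred_eq, Peak, this] using hω

theorem relabel_shift_bClu {x0 x1 y0 y1 p q : ℤ} {ω : Config} {v : Site} :
    shift p q v ∈ BClu (x0 + p) (x1 + p) (y0 + q) (y1 + q) ω ↔
      v ∈ BClu x0 x1 y0 y1 (relabel (shift p q) false ω) := by
  have e1 : ∀ v, (shift p q v).1 = v.1 + p ∧ (shift p q v).2 = v.2 + q := fun v => ⟨rfl, rfl⟩
  have hB : ∀ v, shift p q v ∈ Bot (x0 + p) (x1 + p) (y0 + q) ↔ v ∈ Bot x0 x1 y0 := by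
    intro v
    have := e1 v
    simp only [mem_bot]
    omega
  have hK : ∀ v, shift p q v ∈ rect (x0 + p) (x1 + p) (y0 + q) (y1 + q) ∩ cl ω ↔
      v ∈ rect x0 x1 y0 y1 ∩ cl (relabel (shift p q) false ω) := by
    intro v
    have := e1 v
    have h2 : v ∈ cl (relabel (shift p q) false ω) ↔ shift p q v ∈ cl ω := by
      simp [cl, relabel]
    exact and_congr (by simp only [mem_rect]; omega) h2.symm
  constructor
  · rintro ⟨u, hu, huv⟩
    refine ⟨(shift p q).symm u, (hB _).1 (by rwa [Equiv.apply_symm_apply]), ?_⟩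
    have := huv.map (f := (shift p q).symm) (shift_symm_adj p q)
      (T := Bot x0 x1 y0 ∪ rect x0 x1 y0 y1 ∩ cl (relabel (shift p q) false ω)) (by
        intro a ha
        refine ha.imp (fun h => (hB _).1 ?_) (fun h => (hK _).1 ?_) <;> rwa [Equiv.apply_symm_apply])
    rwa [Equiv.symm_apply_apply] at this
  · rintro ⟨u, hu, huv⟩
    exact ⟨shift p q u, (hB u).2 hu, huv.map (shift_adj p q) fun a ha =>
      ha.imp (hB a).2 (hK a).2⟩

theorem prob_peak_shift {μ : Measure Config} (hμ : IsBernoulliHalf μ) (x0 x1 y0 y1 p q : ℤ) (d : Site) :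
    μ.real {ω | Peak (x0 + p) (x1 + p) (y0 + q) (y1 + q) (d.1 + p, d.2 + q) ω} =
      μ.real {ω | Peak x0 x1 y0 y1 d ω} := by
  obtain ⟨S, hS⟩ := peak_loc x0 x1 y0 y1 d
  rw [← prob_relabel hμ hS (shift p q) false]
  congr 1
  ext ω
  have hd : ((d.1 + p, d.2 + q) : Site) = shift p q d := rfl
  have e2 : ∀ v, (shift p q v).2 = v.2 + q := fun v => rfl
  simp only [Set.mem_ofPred_eq, Peak, hd, relabel_shift_bClu]
  refine and_congr_right fun _ => ⟨fun h v hv hne => ?_, fun h v hv hne => ?_⟩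
  · have := h (shift p q v) (relabel_shift_bClu.2 hv) (fun h => hne ((shift p q).injective h))
    rw [e2] at this
    omega
  · obtain ⟨w, rfl⟩ := (shift p q).surjective v
    have := h w (relabel_shift_bClu.1 hv) (fun h => hne (by rw [h]))
    rw [e2]
    omega

/-! ### The lower bound -/

/-- A peak at distance of order `s` from the boundary has probability at least of order `s⁻²`. -/
theorem prob_peak_lower {μ : Measure Config} (hμ : IsBernoulliHalf μ) : ∃ q > 0, ∀ s : ℕ, 3 ≤ s →
    ∀ a b h t : ℤ, 50 * s - 1 ≤ a → a ≤ 300 * s + 1 → 50 * s - 1 ≤ b → b ≤ 300 * s + 1 →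
      50 * s - 1 ≤ h → h ≤ 300 * s + 1 → 0 ≤ t → ∀ d : Site,
      q ≤ (s : ℝ) ^ 2 * μ.real {ω | Peak (d.1 - a) (d.1 + b) (d.2 - h) (d.2 + t) d ω} := by
  classical
  have := hμ.1
  obtain ⟨q, hq, hS⟩ := prob_summit hμ
  refine ⟨q / 320, by positivity, fun s hs a b h t ha ha' hb hb' hh hh' ht d => ?_⟩
  set F : Site → Set Config := fun d => {ω | Peak (d.1 - a) (d.1 + b) (d.2 - h) (d.2 + t) d ω} with hF
  have hFd : ∀ e, μ.real (F e) = μ.real (F d) := by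
    intro e
    have := prob_peak_shift hμ (d.1 - a) (d.1 + b) (d.2 - h) (d.2 + t) (e.1 - d.1) (e.2 - d.2) d
    rwa [show d.1 - a + (e.1 - d.1) = e.1 - a by ring, show d.1 + b + (e.1 - d.1) = e.1 + b by ring,
      show d.2 - h + (e.2 - d.2) = e.2 - h by ring, show d.2 + t + (e.2 - d.2) = e.2 + t by ring,
      show d.1 + (e.1 - d.1) = e.1 by ring, show d.2 + (e.2 - d.2) = e.2 by ring] at this
  set G : Site → Set Config := fun e => sec e false (sec (e.1 + 1, e.2) true
    (sec (e.1 - 1, e.2) true (sec (e.1, e.2 + 1) true (sec (e.1 - 1, e.2 + 1) true (F e))))) with hG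
  have hGe : ∀ e, μ.real (G e) ≤ 32 * μ.real (F d) := by
    intro e
    obtain ⟨S, hS⟩ := peak_loc (e.1 - a) (e.1 + b) (e.2 - h) (e.2 + t) e
    rw [← hFd e]
    have h1 := prob_sec_le hμ hS (e.1 - 1, e.2 + 1) true
    have h2 := prob_sec_le hμ (hS.sec (v := (e.1 - 1, e.2 + 1)) (b := true)) (e.1, e.2 + 1) true
    have h3 := prob_sec_le hμ ((hS.sec (v := (e.1 - 1, e.2 + 1)) (b := true)).sec
      (v := (e.1, e.2 + 1)) (b := true)) (e.1 - 1, e.2) true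
    have h4 := prob_sec_le hμ (((hS.sec (v := (e.1 - 1, e.2 + 1)) (b := true)).sec
      (v := (e.1, e.2 + 1)) (b := true)).sec (v := (e.1 - 1, e.2)) (b := true)) (e.1 + 1, e.2) true
    have h5 := prob_sec_le hμ ((((hS.sec (v := (e.1 - 1, e.2 + 1)) (b := true)).sec
      (v := (e.1, e.2 + 1)) (b := true)).sec (v := (e.1 - 1, e.2)) (b := true)).sec
      (v := (e.1 + 1, e.2)) (b := true)) e false
    simp only [hG, hF]
    linarith
  set I : Finset Site := Finset.Icc (-(2 * s : ℤ)) (2 * s) ×ˢ Finset.Icc ((s : ℤ) + 1) (2 * s + 1) with hI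
  have hcover : {ω | ∃ d, Summit s ω d} ⊆ ⋃ e ∈ I, G e := by
    rintro ω ⟨d', hd⟩
    have hl := hd.left
    have hr := hd.right
    have hlow := hd.low
    have hhigh := hd.high
    refine Set.mem_biUnion (x := ((d'.1, d'.2 + 1) : Site)) ?_ ?_
    · simp only [hI, Finset.coe_product, Finset.coe_Icc, Set.mem_prod, Set.mem_Icc]
      omega
    · simp only [hG, hF, sec, Set.mem_ofPred_eq]
      have hne : ∀ i j k l : ℤ, (i ≠ k ∨ j ≠ l) → ((i, j) : Site) ≠ (k, l) := by
        intro i j k l h e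
        simp only [Prod.mk.injEq] at e
        omega
      refine peak_of_summit (s := s) (ω := ω) (d := (d'.1, d'.2 + 1)) (by omega) (by simpa using hd)
        ha ha' hb hb' hh hh' ht ?_ ?_ ?_ ?_ ?_ ?_
      · rw [Function.update_of_ne (hne _ _ _ _ (by omega)), Function.update_of_ne (hne _ _ _ _ (by omega)),
          Function.update_of_ne (hne _ _ _ _ (by omega)), Function.update_of_ne (hne _ _ _ _ (by omega)),
          Function.update_self]
      · rw [Function.update_of_ne (hne _ _ _ _ (by omega)), Function.update_of_ne (hne _ _ _ _ (by omega)),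
          Function.update_of_ne (hne _ _ _ _ (by omega)), Function.update_self]
      · rw [Function.update_of_ne (hne _ _ _ _ (by omega)), Function.update_of_ne (hne _ _ _ _ (by omega)),
          Function.update_self]
      · rw [Function.update_of_ne (hne _ _ _ _ (by omega)), Function.update_self]
      · rw [Function.update_self]
      · intro v h1 h2 h3 h4 h5
        rw [Function.update_of_ne h5, Function.update_of_ne h4, Function.update_of_ne h3,
          Function.update_of_ne h2, Function.update_of_ne h1]
  have hcard : (I.card : ℝ) ≤ 10 * (s : ℝ) ^ 2 := by
    have h1 : I.card = (4 * s + 1) * (s + 1) := by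
      rw [hI, Finset.card_product, Int.card_Icc, Int.card_Icc]
      congr 1 <;> omega
    have h2 : (3 : ℝ) ≤ s := by exact_mod_cast hs
    rw [h1]
    push_cast
    nlinarith
  have h1 : q ≤ I.card * (32 * μ.real (F d)) := calc
    q ≤ μ.real (⋃ e ∈ I, G e) := (hS s (by exact_mod_cast hs)).trans (prob_mono hμ hcover)
    _ ≤ ∑ e ∈ I, μ.real (G e) := measureReal_biUnion_finset_le _ _
    _ ≤ ∑ e ∈ I, 32 * μ.real (F d) := Finset.sum_le_sum fun e _ => hGe e
    _ = I.card * (32 * μ.real (F d)) := by rw [Finset.sum_const, nsmul_eq_mul]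
  have h2 : (0 : ℝ) ≤ μ.real (F d) := measureReal_nonneg
  have h3 := mul_le_mul_of_nonneg_right hcard (mul_nonneg (by norm_num : (0:ℝ) ≤ 32) h2)
  change q / 320 ≤ (s : ℝ) ^ 2 * μ.real (F d)
  linarith


/-- A peak on top of a closed column has positive probability. -/
theorem prob_peak_pos {μ : Measure Config} (hμ : IsBernoulliHalf μ) {x0 x1 y0 y1 : ℤ} {d : Site}
    (hd : d ∈ rect x0 x1 y0 y1) :
    (1 / 2 : ℝ) ^ (Finset.Icc ((x0, y0) : Site) (x1, y1)).card ≤ μ.real {ω | Peak x0 x1 y0 y1 d ω} := by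
  classical
  have h0 := hμ.2 (Finset.Icc ((x0, y0) : Site) (x1, y1)) fun v => !decide (v.1 = d.1 ∧ v.2 ≤ d.2)
  have h1 : (1 / 2 : ℝ) ^ (Finset.Icc ((x0, y0) : Site) (x1, y1)).card =
      μ.real {ω | ∀ v ∈ Finset.Icc ((x0, y0) : Site) (x1, y1), ω v = !decide (v.1 = d.1 ∧ v.2 ≤ d.2)} := by
    rw [measureReal_def, h0]; simp
  rw [h1]
  refine prob_mono hμ fun ω hω => ?_
  have hω : ∀ v ∈ rect x0 x1 y0 y1, ω v = !decide (v.1 = d.1 ∧ v.2 ≤ d.2) := fun v hv => by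
    have hv := mem_rect.1 hv
    exact hω v (Finset.mem_Icc.2 ⟨Prod.mk_le_mk.2 (by omega), Prod.mk_le_mk.2 (by omega)⟩)
  have hd' := mem_rect.1 hd
  constructor
  · have hb : ((d.1, y0 - 1) : Site) ∈ Bot x0 x1 y0 := mem_bot.2 (by dsimp only; omega)
    refine ⟨_, hb, conn_col (x := d.1) (y0 := y0 - 1) (y1 := d.2) (by omega) fun y h1 h2 => ?_⟩
    rcases eq_or_lt_of_le h1 with h | h
    · subst h; exact .inl hb
    · have hR : ((d.1, y) : Site) ∈ rect x0 x1 y0 y1 := mem_rect.2 (by dsimp only; omega)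
      refine .inr ⟨hR, ?_⟩
      change ω _ = false
      rw [hω _ hR]
      simp [h2]
  · intro v hv hne
    rcases clu_subset hv with h | ⟨h, hc⟩
    · have := mem_bot.1 h
      omega
    · have hc : ω v = false := hc
      rw [hω v h] at hc
      simp only [Bool.not_eq_false', decide_eq_true_eq] at hc
      exact lt_of_le_of_ne hc.2 fun h => hne (Prod.ext hc.1 h)

theorem prob_peak_bounds {μ : Measure Config} (hμ : IsBernoulliHalf μ) : ∃ c C : ℝ, 0 < c ∧ c ≤ C ∧
    ∀ n : ℕ, 1 ≤ n → ∀ y : Site, 2 * |y.1| ≤ (n : ℤ) → 2 * |y.2| ≤ (n : ℤ) →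
      c ≤ (n : ℝ) ^ 2 * μ.real {ω | Peak (-n) n (-n) n (y.1 + 1, y.2 - 1) ω} ∧
      (n : ℝ) ^ 2 * μ.real {ω | Peak (-n) n (-n) n (y.1 + 1, y.2 - 1) ω} ≤ C := by
  obtain ⟨C, hC, hup⟩ := prob_spike_upper hμ
  obtain ⟨q, hq, hlow⟩ := prob_peak_lower hμ
  obtain ⟨K, hK⟩ : ∃ K : ℕ, ∀ n : ℕ, n < 300 →
      (Finset.Icc ((-(n : ℤ), -(n : ℤ)) : Site) (n, n)).card ≤ K :=
    ⟨∑ n ∈ Finset.range 300, (Finset.Icc ((-(n : ℤ), -(n : ℤ)) : Site) (n, n)).card, fun n hn =>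
      Finset.single_le_sum (f := fun n : ℕ => (Finset.Icc ((-(n : ℤ), -(n : ℤ)) : Site) (n, n)).card)
        (fun _ _ => Nat.zero_le _) (Finset.mem_range.2 hn)⟩
  suffices h : ∀ n : ℕ, 1 ≤ n → ∀ y : Site, 2 * |y.1| ≤ (n : ℤ) → 2 * |y.2| ≤ (n : ℤ) →
      min q ((1 / 2) ^ K) ≤ (n : ℝ) ^ 2 * μ.real {ω | Peak (-n) n (-n) n (y.1 + 1, y.2 - 1) ω} ∧
      (n : ℝ) ^ 2 * μ.real {ω | Peak (-n) n (-n) n (y.1 + 1, y.2 - 1) ω} ≤ 256 * C + 324 by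
    refine ⟨_, _, lt_min hq (by positivity), ?_, h⟩
    obtain ⟨h1, h2⟩ := h 1 le_rfl (0, 0) (by simp) (by simp)
    exact h1.trans h2
  intro n hn y hy1 hy2
  obtain ⟨a1, a2⟩ := abs_le.1 (show |y.1| ≤ (n : ℤ) / 2 by omega)
  obtain ⟨b1, b2⟩ := abs_le.1 (show |y.2| ≤ (n : ℤ) / 2 by omega)
  have hn1 : (1 : ℝ) ≤ n := by exact_mod_cast hn
  set P := μ.real {ω | Peak (-n) n (-n) n (y.1 + 1, y.2 - 1) ω} with hP
  have hP0 : 0 ≤ P := measureReal_nonneg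
  have hP1 : P ≤ 1 := prob_le_one hμ _
  constructor
  · by_cases hn3 : n < 300
    · refine (min_le_right _ _).trans ?_
      have h1 : (1 / 2 : ℝ) ^ K ≤ P :=
        (pow_le_pow_of_le_one (by norm_num) (by norm_num) (hK n hn3)).trans
          (prob_peak_pos hμ (mem_rect.2 (by dsimp only; omega)))
      exact h1.trans (le_mul_of_one_le_left hP0 (one_le_pow₀ hn1))
    · refine (min_le_left _ _).trans ?_
      have h1 := hlow (n / 100) (by omega) (y.1 + 1 + n) (n - (y.1 + 1)) (y.2 - 1 + n) (n - (y.2 - 1))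
        (by omega) (by omega) (by omega) (by omega) (by omega) (by omega) (by omega) (y.1 + 1, y.2 - 1)
      have e1 : y.1 + 1 - (y.1 + 1 + (n : ℤ)) = -n := by ring
      have e2 : y.1 + 1 + ((n : ℤ) - (y.1 + 1)) = n := by ring
      have e3 : y.2 - 1 - (y.2 - 1 + (n : ℤ)) = -n := by ring
      have e4 : y.2 - 1 + ((n : ℤ) - (y.2 - 1)) = n := by ring
      dsimp only at h1
      rw [e1, e2, e3, e4] at h1
      have h2 : ((n / 100 : ℕ) : ℝ) ≤ n := by exact_mod_cast Nat.div_le_self n 100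
      refine h1.trans (mul_le_mul_of_nonneg_right (pow_le_pow_left₀ (by positivity) h2 2) hP0)
  · by_cases hn3 : n < 18
    · have h1 : (n : ℝ) ≤ 18 := by exact_mod_cast hn3.le
      nlinarith [mul_le_mul (pow_le_pow_left₀ (by positivity) h1 2) hP1 hP0 (by norm_num)]
    · obtain ⟨s, hs⟩ : ∃ s, s = (n - 2) / 8 := ⟨_, rfl⟩
      have h1 := hup s (by omega) false (y.1 + 1, y.2 - 1)
      have h2 : P ≤ μ.real (Spike false (4 * s) (y.1 + 1, y.2 - 1)) :=
        prob_mono hμ fun ω hω => peak_spike (by omega) (by dsimp only; omega) (by dsimp only; omega)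
          (by dsimp only; omega) (by dsimp only; omega) hω
      have h3 : (n : ℝ) ≤ 16 * s := by exact_mod_cast (show n ≤ 16 * s by omega)
      have h4 : (n : ℝ) ^ 2 ≤ 256 * (s : ℝ) ^ 2 := by nlinarith
      have h5 := mul_le_mul h4 h2 hP0 (by positivity)
      linarith

/-- Local events have the same probability under all Bernoulli measures. -/
theorem Loc.prob_eq {μ ν : Measure Config} {E : Set Config} (hE : Loc E) (hμ : IsBernoulliHalf μ)
    (hν : IsBernoulliHalf ν) : μ.real E = ν.real E := by
  obtain ⟨S, hS⟩ := hE
  rw [prob_eq_sum hμ hS, prob_eq_sum hν hS]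

end Perc

/-- There exist constants `0 < c ≤ C < ∞` such that for all integers `n ≥ 1`
and all `y ∈ B(n/2)`, `c/n² ≤ P(U(y, B(n))) ≤ C/n²`, where `U(y, B(n))` is the
event that there is a lowest horizontal open crossing of `B(n)` whose sites of
maximal `y`-coordinate are exactly the pair `y`, `y+(1,0)`. -/
theorem statement16 :
    ∃ c C : ℝ≥0∞, 0 < c ∧ c ≤ C ∧ C < ⊤ ∧
      ∀ μ : Measure Config, IsBernoulliHalf μ →
        ∀ n : ℕ, 1 ≤ n → ∀ y : Site, 2 * |y.1| ≤ (n : ℤ) → 2 * |y.2| ≤ (n : ℤ) →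
          c / (n : ℝ≥0∞) ^ 2 ≤
              μ {ω | ∃ p, IsLowestCrossing (-(n : ℤ)) n (-(n : ℤ)) n ω p ∧
                  HighestPair p y} ∧
            μ {ω | ∃ p, IsLowestCrossing (-(n : ℤ)) n (-(n : ℤ)) n ω p ∧
                  HighestPair p y} ≤ C / (n : ℝ≥0∞) ^ 2 := by
  by_cases hex : ∃ ν : Measure Config, IsBernoulliHalf ν
  swap
  · exact ⟨1, 1, one_pos, le_rfl, ENNReal.one_lt_top, fun μ hμ => absurd ⟨μ, hμ⟩ hex⟩
  obtain ⟨ν, hν⟩ := hex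
  obtain ⟨c, C, hc, hcC, h⟩ := Perc.prob_peak_bounds hν
  refine ⟨ENNReal.ofReal c, ENNReal.ofReal C, ENNReal.ofReal_pos.2 hc, ENNReal.ofReal_le_ofReal hcC,
    ENNReal.ofReal_lt_top, fun μ hμ n hn y hy1 hy2 => ?_⟩
  have := hμ.1
  obtain ⟨h1, h2⟩ := h n hn y hy1 hy2
  obtain ⟨a1, a2⟩ := abs_le.1 (show |y.1| ≤ (n : ℤ) / 2 by omega)
  obtain ⟨b1, b2⟩ := abs_le.1 (show |y.2| ≤ (n : ℤ) / 2 by omega)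
  have hset : {ω | ∃ p, IsLowestCrossing (-(n : ℤ)) n (-(n : ℤ)) n ω p ∧ HighestPair p y} =
      {ω | Perc.Peak (-n) n (-n) n (y.1 + 1, y.2 - 1) ω} :=
    Set.ext fun ω => Perc.highestPair_iff_peak (by omega) (by omega) (by omega) (by omega)
  have hn0 : (0 : ℝ) < (n : ℝ) ^ 2 := by positivity
  have hn2 : (n : ℝ≥0∞) ^ 2 = ENNReal.ofReal ((n : ℝ) ^ 2) := by
    rw [ENNReal.ofReal_pow (by positivity), ENNReal.ofReal_natCast]
  rw [hset, ← ofReal_measureReal, (Perc.peak_loc _ _ _ _ _).prob_eq hμ hν, hn2,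
    ← ENNReal.ofReal_div_of_pos hn0, ← ENNReal.ofReal_div_of_pos hn0]
  exact ⟨ENNReal.ofReal_le_ofReal ((div_le_iff₀' hn0).2 h1),
    ENNReal.ofReal_le_ofReal ((le_div_iff₀' hn0).2 h2)⟩
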